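/- arXiv:1003.5286 — 2 statements merged into one kernel-verified Lean document; each statement's English description precedes it below -/
import Mathlib

section
/- There exists an absolute constant C > 0 such that: if f : ℂ → ℂ admits a Littlewood–Paley decomposition with homogeneous Besov B¹_{∞1}(ℝ²)-norm at most M, then for all bounded normal operators N₁, N₂ on a complex Hilbert space H one has ‖f(N₁) − f(N₂)‖ ≤ C · M · ‖N₁ − N₂‖; that is, functions of class B¹_{∞1}(ℝ²) are operator Lipschitz on normal operators. -/
open MeasureTheory Filter
open scoped FourierTransform

/-- Fourier transform of `f` (as a tempered distribution, identifying `ℝ²` with `ℂ`)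
is supported in the closed disc of radius `σ` centered at the origin. -/
def FourierSupportedIn (f : ℂ → ℂ) (σ : ℝ) : Prop :=
  ∀ φ : SchwartzMap ℂ ℂ, Disjoint (tsupport ⇑φ) (Metric.closedBall (0 : ℂ) σ) →
    ∫ x : ℂ, f x * 𝓕 (⇑φ) x = 0

/-- `f : ℂ → ℂ` admits a Littlewood–Paley decomposition with homogeneous Besov
`B¹_{∞1}(ℝ²)`-norm at most `M`: there are bounded continuous functions `fₙ` (`n ∈ ℤ`)
with Fourier transforms supported in the disc of radius `2^{n+1}`, whose symmetric
partial sums converge to `f` uniformly on compact sets, and `Σₙ 2ⁿ ‖fₙ‖_∞ ≤ M`. -/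
def HasLPDecompBesov1 (f : ℂ → ℂ) (M : ℝ) : Prop :=
  ∃ F : ℤ → BoundedContinuousFunction ℂ ℂ,
    (∀ n : ℤ, FourierSupportedIn (⇑(F n)) ((2 : ℝ) ^ (n + 1))) ∧
    (∀ K : Set ℂ, IsCompact K →
      TendstoUniformlyOn (fun (N : ℕ) z => ∑ n ∈ Finset.Icc (-(N : ℤ)) (N : ℤ), F n z)
        f atTop K) ∧
    (Summable fun n : ℤ => (2 : ℝ) ^ n * ‖F n‖) ∧
    ∑' n : ℤ, (2 : ℝ) ^ n * ‖F n‖ ≤ M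

/-- `k` is continuous and decays at least as fast as `(1 + u ^ 2)⁻¹`. -/
def QuadDecay (k : ℝ → ℂ) : Prop :=
  Continuous k ∧ ∃ c : ℝ, ∀ u, ‖k u‖ ≤ c * (1 + u ^ 2)⁻¹

namespace QuadDecay

theorem integrable {k : ℝ → ℂ} (hk : QuadDecay k) : Integrable k := by
  obtain ⟨c, hc⟩ := hk.2
  exact (integrable_inv_one_add_sq.const_mul c).mono' hk.1.aestronglyMeasurable (ae_of_all _ hc)

theorem star {k : ℝ → ℂ} (hk : QuadDecay k) : QuadDecay (fun u => star (k u)) := by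
  obtain ⟨hk1, c, hc⟩ := hk
  exact ⟨hk1.star, c, fun u => by rw [norm_star]; exact hc u⟩

theorem _root_.inv_one_add_sub_sq_le {t y R : ℝ} (hy : |y| ≤ R) :
    (1 + (t - y) ^ 2)⁻¹ ≤ (2 + 2 * R ^ 2) * (1 + t ^ 2)⁻¹ := by
  have h1 : 0 < 1 + (t - y) ^ 2 := by positivity
  have h2 : 0 < 1 + t ^ 2 := by positivity
  rw [← div_eq_mul_inv, inv_eq_one_div, div_le_div_iff₀ h1 h2]
  have h3 : y ^ 2 ≤ R ^ 2 := sq_le_sq' (neg_le_of_abs_le hy) (le_of_abs_le hy)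
  nlinarith [sq_nonneg (t - 2 * y), mul_nonneg (sq_nonneg R) (sq_nonneg (t - y))]

/-- The translates of `k` by points of a bounded set have a common quadratic decay. -/
theorem exists_bound_sub {k : ℝ → ℂ} (hk : QuadDecay k) (R : ℝ) :
    ∃ c : ℝ, 0 ≤ c ∧ ∀ t y : ℝ, |y| ≤ R → ‖k (t - y)‖ ≤ c * (1 + t ^ 2)⁻¹ := by
  obtain ⟨-, c, hc⟩ := hk
  have hc0 : 0 ≤ c := by simpa using (norm_nonneg _).trans (hc 0)
  refine ⟨c * (2 + 2 * R ^ 2), by positivity, fun t y hy => (hc _).trans ?_⟩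
  rw [mul_assoc]
  exact mul_le_mul_of_nonneg_left (inv_one_add_sub_sq_le hy) hc0

end QuadDecay

open SchwartzMap in
theorem SchwartzMap.quadDecay (f : 𝓢(ℝ, ℂ)) : QuadDecay f := by
  refine ⟨f.continuous, ?_⟩
  obtain ⟨c0, h0⟩ := f.decay 0 0
  obtain ⟨c2, h2⟩ := f.decay 2 0
  refine ⟨c0 + c2, fun u => ?_⟩
  have h0 := h0.2 u
  have h2 := h2.2 u
  simp only [norm_iteratedFDeriv_zero, pow_zero, one_mul, Real.norm_eq_abs, sq_abs] at h0 h2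
  rw [← div_eq_mul_inv, le_div_iff₀ (by positivity)]
  linarith

/-- The properties of a pair of kernels on the line that the interpolation argument uses: `k` and
`l` are the Fourier transforms of cut-off functions, the second of which equals `1` on the support
of the first, so that `k` is annihilated by convolution with `s ↦ s * l s`. -/
structure KernelPair (k k' l : ℝ → ℂ) : Prop where
  decay : QuadDecay k
  hasDerivAt : ∀ u, HasDerivAt k (k' u) u
  decay_deriv : QuadDecay k'
  decay_right : QuadDecay l
  decay_mul : QuadDecay (fun s => s * l s)
  integral_right : ∫ s, l s = 1
  integral_mul_eq_zero : ∀ v : ℝ, ∫ s, k (v - s) * (s * l s) = 0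

theorem KernelPair.star {k k' l : ℝ → ℂ} (h : KernelPair k k' l) :
    KernelPair (fun u => star (k u)) (fun u => star (k' u)) (fun u => star (l u)) where
  decay := h.decay.star
  hasDerivAt u := (h.hasDerivAt u).star
  decay_deriv := h.decay_deriv.star
  decay_right := h.decay_right.star
  decay_mul := by
    convert h.decay_mul.star using 2 with s
    simp
  integral_right := by
    have := integral_conj (f := l) (μ := volume)
    simpa [h.integral_right] using this
  integral_mul_eq_zero v := by
    have := integral_conj (f := fun s : ℝ => k (v - s) * (s * l s)) (μ := volume)
    rw [h.integral_mul_eq_zero v] at this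
    simpa using this

open SchwartzMap in
theorem integral_fourier (c : 𝓢(ℝ, ℂ)) : ∫ s, (𝓕 c : 𝓢(ℝ, ℂ)) s = c 0 := by
  have h := congrArg (fun g : 𝓢(ℝ, ℂ) => g 0)
    (FourierTransform.fourierInv_fourier_eq (E := 𝓢(ℝ, ℂ)) (F := 𝓢(ℝ, ℂ)) c)
  simp only [SchwartzMap.fourierInv_coe, Real.fourierInv_eq'] at h
  simpa using h

open SchwartzMap in
theorem kernelPair_fourier (b c : 𝓢(ℝ, ℂ)) (hc : c 0 = 1) (hbc : ∀ ξ, b ξ * deriv c ξ = 0) :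
    KernelPair (𝓕 b : 𝓢(ℝ, ℂ)) (deriv (𝓕 b : 𝓢(ℝ, ℂ))) (𝓕 c : 𝓢(ℝ, ℂ)) := by
  have hw : ∀ s : ℝ, (s : ℂ) * (𝓕 c : 𝓢(ℝ, ℂ)) s
      = (2 * Real.pi * Complex.I)⁻¹ * (𝓕 (SchwartzMap.derivCLM ℂ ℂ c) : 𝓢(ℝ, ℂ)) s := by
    intro s
    have h := congrFun (Real.fourier_deriv c.integrable c.differentiable
      (SchwartzMap.derivCLM ℂ ℂ c).integrable) s
    have h' : (𝓕 (SchwartzMap.derivCLM ℂ ℂ c) : 𝓢(ℝ, ℂ)) s = 𝓕 (deriv c) s := rfl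
    rw [h', h, SchwartzMap.fourier_coe]
    have : (Real.pi : ℂ) ≠ 0 := by exact_mod_cast Real.pi_ne_zero
    simp only [smul_eq_mul]
    field_simp [Complex.I_ne_zero]
  refine ⟨SchwartzMap.quadDecay _, fun u => (SchwartzMap.differentiable _ u).hasDerivAt,
    (SchwartzMap.derivCLM ℂ ℂ (𝓕 b)).quadDecay, SchwartzMap.quadDecay _, ?_, ?_, ?_⟩
  · simp_rw [hw]
    exact ((2 * Real.pi * Complex.I : ℂ)⁻¹ •
      (𝓕 (SchwartzMap.derivCLM ℂ ℂ c) : 𝓢(ℝ, ℂ))).quadDecay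
  · rw [integral_fourier, hc]
  · intro v
    simp_rw [hw]
    have h1 : ∀ ξ : ℝ, 𝓕 (fun s : ℝ => (𝓕 b : 𝓢(ℝ, ℂ)) (v - s)) ξ
        = Real.fourierChar (-(ξ * v)) • b ξ := by
      intro ξ
      have h := congrArg (fun g : 𝓢(ℝ, ℂ) => g ξ)
        (FourierTransform.fourierInv_fourier_eq (E := 𝓢(ℝ, ℂ)) (F := 𝓢(ℝ, ℂ)) b)
      simp only [SchwartzMap.fourierInv_coe, Real.fourierInv_eq] at h
      rw [← h, Real.fourier_real_eq, ← integral_sub_left_eq_self _ _ v,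
        Circle.smul_def, ← integral_smul]
      congr 1 with s
      rw [← Circle.smul_def, smul_smul, ← AddChar.map_add_eq_mul]
      simp only [RCLike.inner_apply, conj_trivial, sub_sub_cancel]
      congr 2
      ring
    have h2 := VectorFourier.integral_fourierIntegral_smul_eq_flip (μ := volume) (ν := volume)
      (L := innerₗ ℝ) (f := fun s : ℝ => (𝓕 b : 𝓢(ℝ, ℂ)) (v - s))
      (g := SchwartzMap.derivCLM ℂ ℂ c) Real.continuous_fourierChar continuous_inner
      (((𝓕 b : 𝓢(ℝ, ℂ)).integrable).comp_sub_left v) (SchwartzMap.integrable _)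
    have h3 : ∫ s, (𝓕 b : 𝓢(ℝ, ℂ)) (v - s) * (𝓕 (SchwartzMap.derivCLM ℂ ℂ c) : 𝓢(ℝ, ℂ)) s
        = ∫ ξ, 𝓕 (fun s : ℝ => (𝓕 b : 𝓢(ℝ, ℂ)) (v - s)) ξ * SchwartzMap.derivCLM ℂ ℂ c ξ := by
      refine Eq.trans ?_ (h2.symm.trans ?_)
      · rw [flip_innerₗ]; rfl
      · rfl
    calc _ = (2 * Real.pi * Complex.I : ℂ)⁻¹ * ∫ s, (𝓕 b : 𝓢(ℝ, ℂ)) (v - s) *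
            (𝓕 (SchwartzMap.derivCLM ℂ ℂ c) : 𝓢(ℝ, ℂ)) s := by
          rw [← integral_const_mul]
          congr 1 with s
          ring
      _ = 0 := by
          rw [h3]
          have : ∀ ξ, 𝓕 (fun s : ℝ => (𝓕 b : 𝓢(ℝ, ℂ)) (v - s)) ξ * SchwartzMap.derivCLM ℂ ℂ c ξ
              = 0 := by
            intro ξ
            rw [h1, Circle.smul_def, smul_eq_mul, mul_assoc, SchwartzMap.derivCLM_apply, hbc,
              mul_zero]
          rw [integral_eq_zero_of_ae (ae_of_all _ this), mul_zero]

/-- `g` is reproduced by averaging it against all dilates `r ∈ [0, 1]` of `k` in the first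
variable. -/
def Reproducing (k : ℝ → ℂ) (g : ℝ → ℝ → ℂ) : Prop :=
  ∀ r ∈ Set.Icc (0 : ℝ) 1, ∀ x y, ∫ u, g (x + r * u) y * k u = g x y

section DividedDifference

variable {k k' : ℝ → ℂ} {g : ℝ → ℝ → ℂ} {M : ℝ}

theorem integrable_bounded_mul {h l : ℝ → ℂ} {M : ℝ} (hh : Continuous h) (hM : ∀ u, ‖h u‖ ≤ M)
    (hl : Integrable l) : Integrable (fun u => h u * l u) :=
  hl.bdd_mul hh.aestronglyMeasurable (ae_of_all _ hM)

theorem norm_integral_bounded_mul_le {h l : ℝ → ℂ} {M : ℝ} (hM : ∀ u, ‖h u‖ ≤ M)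
    (hl : Integrable l) : ‖∫ u, h u * l u‖ ≤ M * ∫ u, ‖l u‖ := by
  rw [← integral_const_mul]
  refine norm_integral_le_of_norm_le (hl.norm.const_mul M) (ae_of_all _ fun u => ?_)
  rw [norm_mul]
  exact mul_le_mul_of_nonneg_right (hM u) (norm_nonneg _)

/-- A bounded function reproduced by a differentiable kernel is differentiable. -/
theorem hasDerivAt_of_reproducing (hk : QuadDecay k) (hkk' : ∀ u, HasDerivAt k (k' u) u)
    (hk' : QuadDecay k') (hg : Continuous (Function.uncurry g)) (hM : ∀ x y, ‖g x y‖ ≤ M)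
    (hrep : Reproducing k g) (x y : ℝ) :
    HasDerivAt (fun x => g x y) (-∫ u, g (x + u) y * k' u) x := by
  obtain ⟨c, hc0, hc⟩ := hk'.exists_bound_sub (|x| + 1)
  have hgc : Continuous (fun t => g t y) := hg.comp (Continuous.prodMk_left y)
  have hmem : Set.Ioo (x - 1) (x + 1) ∈ nhds x := Ioo_mem_nhds (by linarith) (by linarith)
  have key := (hasDerivAt_integral_of_dominated_loc_of_deriv_le (μ := volume)
    (F := fun x t => g t y * k (t - x)) (F' := fun x t => g t y * (-k' (t - x))) (x₀ := x)
    (s := Set.Ioo (x - 1) (x + 1)) (bound := fun t => M * (c * (1 + t ^ 2)⁻¹))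
    hmem ?_ ?_ ?_ ?_ ?_ ?_).2
  · convert! key using 1
    · ext x
      have h := hrep 1 (by simp) x y
      rw [← h, ← integral_sub_right_eq_self _ x]
      simp
    · rw [← integral_neg, ← integral_sub_right_eq_self _ x]
      simp
  · exact Eventually.of_forall fun z =>
      (hgc.mul (hk.1.comp (continuous_id.sub continuous_const))).aestronglyMeasurable
  · exact integrable_bounded_mul hgc (fun t => hM t y) (hk.integrable.comp_sub_right x)
  · exact (hgc.mul (hk'.1.comp (continuous_id.sub continuous_const)).neg).aestronglyMeasurable
  · refine ae_of_all _ fun t z hz => ?_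
    rw [norm_mul, norm_neg]
    have hz' : |z| ≤ |x| + 1 := by
      have : |z - x| ≤ 1 := abs_le.2 ⟨by linarith [hz.1], by linarith [hz.2]⟩
      calc |z| = |x + (z - x)| := by ring_nf
        _ ≤ _ := (abs_add_le _ _).trans (by linarith)
    exact mul_le_mul (hM t y) (hc t z hz') (norm_nonneg _) ((norm_nonneg _).trans (hM 0 0))
  · exact ((integrable_inv_one_add_sq).const_mul c).const_mul M
  · refine ae_of_all _ fun t z _ => ?_
    have h1 : HasDerivAt (fun z : ℝ => t - z) (-1) z := by
      simpa using (hasDerivAt_id z).const_sub t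
    have h2 := ((hkk' (t - z)).scomp z h1).const_mul (g t y)
    simpa using! h2

theorem continuous_integral_add_mul (hk' : QuadDecay k') (hg : Continuous (Function.uncurry g))
    (hM : ∀ x y, ‖g x y‖ ≤ M) :
    Continuous (fun p : ℝ × ℝ => ∫ u, g (p.1 + u) p.2 * k' u) := by
  refine continuous_of_dominated (bound := fun u => M * ‖k' u‖) (fun p => ?_) (fun p => ?_)
    (hk'.integrable.norm.const_mul M) (ae_of_all _ fun u => ?_)
  · have : Continuous (fun u => g (p.1 + u) p.2) :=
      hg.comp (f := fun u => (p.1 + u, p.2)) (by fun_prop)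
    exact (this.mul hk'.1).aestronglyMeasurable
  · exact ae_of_all _ fun u => by
      rw [norm_mul]
      exact mul_le_mul_of_nonneg_right (hM _ _) (norm_nonneg _)
  · exact (hg.comp (f := fun p : ℝ × ℝ => (p.1 + u, p.2)) (by fun_prop)).mul continuous_const

/-- The derivative of a reproduced function is reproduced. -/
theorem Reproducing.integral_add_mul (hk : QuadDecay k) (hk' : QuadDecay k')
    (hg : Continuous (Function.uncurry g)) (hM : ∀ x y, ‖g x y‖ ≤ M) (hrep : Reproducing k g) :
    Reproducing k (fun x y => -∫ u, g (x + u) y * k' u) := by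
  intro r hr x y
  have hint : Integrable (Function.uncurry fun u v : ℝ => g (x + r * u + v) y * k' v * k u)
      (volume.prod volume) := by
    have h1 : Integrable (fun p : ℝ × ℝ => k p.1 * k' p.2) (volume.prod volume) :=
      hk.integrable.mul_prod hk'.integrable
    have h2 : Continuous (fun p : ℝ × ℝ => g (x + r * p.1 + p.2) y) :=
      hg.comp (f := fun p : ℝ × ℝ => (x + r * p.1 + p.2, y)) (by fun_prop)
    refine (h1.bdd_mul h2.aestronglyMeasurable (ae_of_all _ fun p => hM _ _)).congr
      (ae_of_all _ fun p => ?_)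
    simp only [Function.uncurry]
    ring
  calc ∫ u, (-∫ v, g (x + r * u + v) y * k' v) * k u
      = -∫ u, ∫ v, g (x + r * u + v) y * k' v * k u := by
        rw [← integral_neg]
        congr 1 with u
        rw [integral_mul_const, neg_mul]
    _ = -∫ v, ∫ u, g (x + r * u + v) y * k' v * k u := by rw [integral_integral_swap hint]
    _ = -∫ v, g (x + v) y * k' v := by
        congr 2 with v
        rw [← hrep r hr (x + v) y, ← integral_mul_const]
        congr 1 with u
        rw [add_right_comm]
        ring

/-- The divided difference in the first variable of a reproduced function. -/
theorem exists_dividedDifference (hk : QuadDecay k) (hkk' : ∀ u, HasDerivAt k (k' u) u)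
    (hk' : QuadDecay k') (hg : Continuous (Function.uncurry g)) (hM : ∀ x y, ‖g x y‖ ≤ M)
    (hrep : Reproducing k g) :
    ∃ a : ℝ → ℝ → ℝ → ℂ, Continuous (fun p : ℝ × ℝ × ℝ => a p.1 p.2.1 p.2.2) ∧
      (∀ t x y : ℝ, ((x : ℂ) - t) * a t x y = g x y - g t y) ∧
      (∀ t x y, ‖a t x y‖ ≤ M * ∫ u, ‖k' u‖) ∧
      (∀ t x y, ∫ u, a u x y * k (u - t) = a t x y) := by
  set G : ℝ → ℝ → ℂ := fun x y => -∫ u, g (x + u) y * k' u with hG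
  have hGc : Continuous (Function.uncurry G) := (continuous_integral_add_mul hk' hg hM).neg
  have hGM : ∀ x y, ‖G x y‖ ≤ M * ∫ u, ‖k' u‖ := fun x y => by
    rw [hG, norm_neg]
    exact norm_integral_bounded_mul_le (fun u => hM _ _) hk'.integrable
  have hGrep : Reproducing k G := hrep.integral_add_mul hk hk' hg hM
  have hderiv := hasDerivAt_of_reproducing hk hkk' hk' hg hM hrep
  refine ⟨fun t x y => ∫ r in (0 : ℝ)..1, G (x + r * (t - x)) y, ?_, ?_, ?_, ?_⟩
  · refine intervalIntegral.continuous_parametric_intervalIntegral_of_continuous'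
      (f := fun (p : ℝ × ℝ × ℝ) r => G (p.2.1 + r * (p.1 - p.2.1)) p.2.2) ?_ 0 1
    exact hGc.comp (f := fun q : (ℝ × ℝ × ℝ) × ℝ =>
      (q.1.2.1 + q.2 * (q.1.1 - q.1.2.1), q.1.2.2)) (by fun_prop)
  · intro t x y
    have h1 : ∀ r ∈ Set.uIcc (0 : ℝ) 1, HasDerivAt (fun r : ℝ => g (x + r * (t - x)) y)
        ((t - x) • G (x + r * (t - x)) y) r := by
      intro r _
      have h2 : HasDerivAt (fun r : ℝ => x + r * (t - x)) (t - x) r := by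
        simpa using ((hasDerivAt_id r).mul_const (t - x)).const_add x
      exact (hderiv (x + r * (t - x)) y).scomp r h2
    have h3 : Continuous fun r : ℝ => (t - x) • G (x + r * (t - x)) y := by
      have := hGc.comp (f := fun r : ℝ => (x + r * (t - x), y)) (by fun_prop)
      exact (continuous_const (y := t - x)).smul this
    have h4 := intervalIntegral.integral_eq_sub_of_hasDerivAt h1 (h3.intervalIntegrable 0 1)
    rw [intervalIntegral.integral_smul] at h4
    simp only [one_mul, zero_mul, add_zero, add_sub_cancel, Complex.real_smul] at h4
    push_cast at h4
    linear_combination -h4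
  · intro t x y
    simpa using intervalIntegral.norm_integral_le_of_norm_le_const (a := 0) (b := 1)
      (f := fun r => G (x + r * (t - x)) y) (fun r _ => hGM _ _)
  · intro t x y
    rw [← integral_add_right_eq_self _ t]
    simp only [add_sub_cancel_right]
    have hint : Integrable (Function.uncurry fun r u : ℝ => G (x + r * (u + t - x)) y * k u)
        ((volume.restrict (Set.uIoc 0 1)).prod volume) := by
      have hfin : IsFiniteMeasure (volume.restrict (Set.uIoc (0 : ℝ) 1)) :=
        ⟨by simp [Set.uIoc_of_le]⟩
      have h1 : Integrable (fun p : ℝ × ℝ => k p.2)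
          ((volume.restrict (Set.uIoc (0 : ℝ) 1)).prod volume) := hk.integrable.comp_snd _
      have h2 : Continuous (fun p : ℝ × ℝ => G (x + p.1 * (p.2 + t - x)) y) :=
        hGc.comp (f := fun p : ℝ × ℝ => (x + p.1 * (p.2 + t - x), y)) (by fun_prop)
      exact h1.bdd_mul h2.aestronglyMeasurable (ae_of_all _ fun p => hGM _ _)
    simp_rw [← intervalIntegral.integral_mul_const]
    rw [← intervalIntegral_integral_swap hint]
    refine intervalIntegral.integral_congr fun r hr => ?_
    rw [Set.uIcc_of_le zero_le_one] at hr
    rw [← hGrep r hr]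
    congr 1 with u
    congr 2
    ring

end DividedDifference

section Operator

variable {H : Type*} [NormedAddCommGroup H] [InnerProductSpace ℂ H] [CompleteSpace H]

theorem integral_mul_le_of_integral_sq_le {f g : ℝ → ℝ} (hf0 : ∀ t, 0 ≤ f t) (hg0 : ∀ t, 0 ≤ g t)
    (hf : Continuous f) (hg : Continuous g) (hf2 : Integrable (fun t => f t ^ 2))
    (hg2 : Integrable (fun t => g t ^ 2)) {α β : ℝ} (hα : 0 ≤ α) (hβ : 0 ≤ β)
    (hfα : ∫ t, f t ^ 2 ≤ α ^ 2) (hgβ : ∫ t, g t ^ 2 ≤ β ^ 2) : ∫ t, f t * g t ≤ α * β := by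
  have h := integral_mul_le_Lp_mul_Lq_of_nonneg (μ := volume) Real.HolderConjugate.two_two
    (ae_of_all _ hf0) (ae_of_all _ hg0)
    (by simpa using (memLp_two_iff_integrable_sq hf.aestronglyMeasurable).2 hf2)
    (by simpa using (memLp_two_iff_integrable_sq hg.aestronglyMeasurable).2 hg2)
  simp only [Real.rpow_two, ← Real.sqrt_eq_rpow] at h
  exact h.trans (mul_le_mul ((Real.sqrt_le_sqrt hfα).trans_eq (Real.sqrt_sq hα))
    ((Real.sqrt_le_sqrt hgβ).trans_eq (Real.sqrt_sq hβ)) (Real.sqrt_nonneg _) hα)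

theorem integrable_norm_sq_apply {Y : ℝ → H →L[ℂ] H}
    (hY : Integrable (fun t => star (Y t) * Y t)) {β : ℝ}
    (hβ : ‖∫ t, star (Y t) * Y t‖ ≤ β ^ 2) (v : H) :
    Integrable (fun t => ‖Y t v‖ ^ 2) ∧ ∫ t, ‖Y t v‖ ^ 2 ≤ (β * ‖v‖) ^ 2 := by
  have h1 : ∀ t, inner ℂ v ((star (Y t) * Y t) v) = ((‖Y t v‖ ^ 2 : ℝ) : ℂ) := by
    intro t
    rw [ContinuousLinearMap.star_eq_adjoint, mul_apply_eq_comp,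
      ContinuousLinearMap.adjoint_inner_right, inner_self_eq_norm_sq_to_K]
    norm_cast
  have h2 : Integrable (fun t => (star (Y t) * Y t) v) := hY.apply_continuousLinearMap v
  have h3 : Integrable (fun t => inner ℂ v ((star (Y t) * Y t) v)) := h2.const_inner (𝕜 := ℂ) v
  have h4 := integral_inner (𝕜 := ℂ) h2 v
  simp_rw [h1] at h3 h4
  rw [integral_complex_ofReal, ← ContinuousLinearMap.integral_apply hY] at h4
  refine ⟨by simpa only [RCLike.re_to_complex, Complex.ofReal_re] using h3.re,
    (le_abs_self _).trans ?_⟩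
  have h5 : ‖((∫ t, ‖Y t v‖ ^ 2 : ℝ) : ℂ)‖ = |∫ t, ‖Y t v‖ ^ 2| := by
    rw [Complex.norm_real, Real.norm_eq_abs]
  rw [← h5]
  refine (congrArg norm h4).trans_le ((norm_inner_le_norm _ _).trans ?_)
  calc _ ≤ ‖v‖ * (β ^ 2 * ‖v‖) := by
        refine mul_le_mul_of_nonneg_left ?_ (norm_nonneg v)
        exact (ContinuousLinearMap.le_opNorm _ _).trans
          (mul_le_mul_of_nonneg_right hβ (norm_nonneg v))
    _ = _ := by ring

/-- Cauchy–Schwarz inequality for operator-valued integrals. -/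
theorem norm_integral_mul_mul_le {X Y : ℝ → H →L[ℂ] H} (D : H →L[ℂ] H)
    (hXc : Continuous X) (hYc : Continuous Y)
    (hX : Integrable (fun t => X t * star (X t))) (hY : Integrable (fun t => star (Y t) * Y t))
    (hXY : Integrable (fun t => X t * D * Y t)) {α β : ℝ} (hα : 0 ≤ α) (hβ : 0 ≤ β)
    (hXα : ‖∫ t, X t * star (X t)‖ ≤ α ^ 2) (hYβ : ‖∫ t, star (Y t) * Y t‖ ≤ β ^ 2) :
    ‖∫ t, X t * D * Y t‖ ≤ α * ‖D‖ * β := by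
  have key : ∀ w v, ‖inner ℂ w ((∫ t, X t * D * Y t) v)‖ ≤ α * ‖D‖ * β * ‖v‖ * ‖w‖ := by
    intro w v
    obtain ⟨hx1, hx2⟩ := integrable_norm_sq_apply (Y := fun t => star (X t))
      (by simpa using hX) (by simpa using hXα) w
    obtain ⟨hy1, hy2⟩ := integrable_norm_sq_apply hY hYβ v
    have hxc : Continuous fun t => ‖star (X t) w‖ := (hXc.star.clm_apply continuous_const).norm
    have hyc : Continuous fun t => ‖Y t v‖ := (hYc.clm_apply continuous_const).norm
    have hcs := integral_mul_le_of_integral_sq_le (fun t => norm_nonneg _) (fun t => norm_nonneg _)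
      hxc hyc hx1 hy1 (by positivity) (by positivity) hx2 hy2
    have hint : Integrable fun t => ‖star (X t) w‖ * ‖Y t v‖ := by
      refine (hx1.add hy1).mono' (hxc.mul hyc).aestronglyMeasurable (ae_of_all _ fun t => ?_)
      rw [Real.norm_of_nonneg (by positivity)]
      simp only [Pi.add_apply]
      nlinarith [sq_nonneg (‖star (X t) w‖ - ‖Y t v‖), sq_nonneg (‖star (X t) w‖ + ‖Y t v‖)]
    rw [ContinuousLinearMap.integral_apply hXY, ← integral_inner (hXY.apply_continuousLinearMap v)]
    calc _ ≤ ∫ t, ‖D‖ * (‖star (X t) w‖ * ‖Y t v‖) := by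
          refine norm_integral_le_of_norm_le (hint.const_mul _) (ae_of_all _ fun t => ?_)
          rw [mul_apply_eq_comp, mul_apply_eq_comp,
            ← ContinuousLinearMap.adjoint_inner_left, ← ContinuousLinearMap.star_eq_adjoint]
          refine (norm_inner_le_norm _ _).trans ?_
          calc _ ≤ ‖star (X t) w‖ * (‖D‖ * ‖Y t v‖) :=
                mul_le_mul_of_nonneg_left (D.le_opNorm _) (norm_nonneg _)
            _ = _ := by ring
      _ ≤ ‖D‖ * (α * ‖w‖ * (β * ‖v‖)) := by
          rw [integral_const_mul]
          exact mul_le_mul_of_nonneg_left hcs (norm_nonneg D)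
      _ = _ := by ring
  refine ContinuousLinearMap.opNorm_le_bound _ (by positivity) fun v => ?_
  have h := key ((∫ t, X t * D * Y t) v) v
  rcases (norm_nonneg ((∫ t, X t * D * Y t) v)).eq_or_lt with h0 | h0
  · rw [← h0]; positivity
  · rw [inner_self_eq_norm_sq_to_K, norm_pow, RCLike.norm_ofReal, abs_norm, sq] at h
    exact le_of_mul_le_mul_right h h0

/-- Joint continuity of a family of functions gives norm continuity of the functional calculus. -/
theorem continuous_cfc_of_uncurry {h : ℝ → ℂ → ℂ}
    (hh : Continuous (Function.uncurry h)) (N : H →L[ℂ] H) :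
    Continuous (fun t => cfc (h t) N) := by
  refine continuous_iff_continuousAt.2 fun z => continuousAt_cfc_fun ?_
    (Eventually.of_forall fun t => (hh.comp (Continuous.prodMk_right t)).continuousOn)
  rw [tendstoUniformlyOn_iff_tendstoUniformly_comp_coe]
  exact Continuous.tendstoUniformly (fun t (w : spectrum ℂ N) => h t w)
    (hh.comp (f := fun q : ℝ × spectrum ℂ N => (q.1, (q.2 : ℂ)))
      (continuous_fst.prodMk (continuous_subtype_val.comp continuous_snd))) z

end Operator

section Interpolation

variable {H : Type*} [NormedAddCommGroup H] [InnerProductSpace ℂ H] [CompleteSpace H]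

theorem hasFiniteIntegral_const_mul_inv_one_add_sq (c : ℝ) :
    HasFiniteIntegral (fun t : ℝ => c * (1 + t ^ 2)⁻¹) :=
  (integrable_inv_one_add_sq.const_mul c).2

theorem integrable_cfc_of_norm_le {h : ℝ → ℂ → ℂ} (hh : Continuous (Function.uncurry h))
    {N : H →L[ℂ] H} (hN : IsStarNormal N) {c : ℝ}
    (hc : ∀ t, ∀ z ∈ spectrum ℂ N, ‖h t z‖ ≤ c * (1 + t ^ 2)⁻¹) :
    Integrable (fun t => cfc (h t) N) :=
  integrable_cfc h _ N hh.continuousOn (ae_of_all _ hc)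
    (hasFiniteIntegral_const_mul_inv_one_add_sq c)

theorem integral_cfc_of_norm_le {h : ℝ → ℂ → ℂ} (hh : Continuous (Function.uncurry h))
    {N : H →L[ℂ] H} (hN : IsStarNormal N) {c : ℝ}
    (hc : ∀ t, ∀ z ∈ spectrum ℂ N, ‖h t z‖ ≤ c * (1 + t ^ 2)⁻¹) :
    ∫ t, cfc (h t) N = cfc (fun z => ∫ t, h t z) N :=
  (cfc_integral h _ N hh.continuousOn (ae_of_all _ hc)
    (hasFiniteIntegral_const_mul_inv_one_add_sq c)).symm

theorem exists_abs_le_of_mem_spectrum {p : ℂ → ℝ} (hp : Continuous p) (N : H →L[ℂ] H) :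
    ∃ R : ℝ, ∀ z ∈ spectrum ℂ N, |p z| ≤ R :=
  (spectrum.isCompact N).exists_bound_of_continuousOn hp.continuousOn

theorem QuadDecay.exists_bound_on_spectrum {l : ℝ → ℂ} (hl : QuadDecay l) {p : ℂ → ℝ}
    (hp : Continuous p) (N : H →L[ℂ] H) :
    ∃ c : ℝ, 0 ≤ c ∧ ∀ t, ∀ z ∈ spectrum ℂ N, ‖l (t - p z)‖ ≤ c * (1 + t ^ 2)⁻¹ := by
  obtain ⟨R, hR⟩ := exists_abs_le_of_mem_spectrum hp N
  obtain ⟨c, hc0, hc⟩ := hl.exists_bound_sub R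
  exact ⟨c, hc0, fun t z hz => hc t _ (hR z hz)⟩

theorem QuadDecay.continuous_sub {l : ℝ → ℂ} (hl : QuadDecay l) {p : ℂ → ℝ}
    (hp : Continuous p) : Continuous (Function.uncurry fun (t : ℝ) z => l (t - p z)) :=
  hl.1.comp (continuous_fst.sub (hp.comp continuous_snd))

theorem QuadDecay.integrable_cfc_sub {l : ℝ → ℂ} (hl : QuadDecay l) {p : ℂ → ℝ}
    (hp : Continuous p) {N : H →L[ℂ] H} (hN : IsStarNormal N) :
    Integrable fun t => cfc (fun z => l (t - p z)) N := by
  obtain ⟨c, -, hc⟩ := hl.exists_bound_on_spectrum hp N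
  exact integrable_cfc_of_norm_le (hl.continuous_sub hp) hN hc

theorem QuadDecay.integral_cfc_sub {l : ℝ → ℂ} (hl : QuadDecay l) {p : ℂ → ℝ}
    (hp : Continuous p) {N : H →L[ℂ] H} (hN : IsStarNormal N) :
    ∫ t, cfc (fun z => l (t - p z)) N = algebraMap ℂ _ (∫ t, l t) := by
  obtain ⟨c, -, hc⟩ := hl.exists_bound_on_spectrum hp N
  rw [integral_cfc_of_norm_le (hl.continuous_sub hp) hN hc, ← cfc_const _ N]
  congr 1 with z
  exact integral_sub_right_eq_self l (p z)

theorem QuadDecay.star_mul_self {l : ℝ → ℂ} (hl : QuadDecay l) :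
    QuadDecay fun t => Star.star (l t) * l t := by
  obtain ⟨hlc, c, hc⟩ := hl
  refine ⟨hlc.star.mul hlc, c ^ 2, fun u => ?_⟩
  have h1 : (1 + u ^ 2)⁻¹ ≤ 1 := inv_le_one_of_one_le₀ (by nlinarith [sq_nonneg u])
  rw [norm_mul, norm_star, ← sq]
  refine (pow_le_pow_left₀ (norm_nonneg _) (hc u) 2).trans ?_
  rw [mul_pow, sq (1 + u ^ 2)⁻¹]
  exact mul_le_mul_of_nonneg_left (mul_le_of_le_one_left (by positivity) h1) (sq_nonneg c)

theorem norm_integral_star_mul_cfc_sub_le {l : ℝ → ℂ} (hl : QuadDecay l) {p : ℂ → ℝ}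
    (hp : Continuous p) {N : H →L[ℂ] H} (hN : IsStarNormal N) :
    Integrable (fun t => star (cfc (fun z => l (t - p z)) N) * cfc (fun z => l (t - p z)) N) ∧
    ‖∫ t, star (cfc (fun z => l (t - p z)) N) * cfc (fun z => l (t - p z)) N‖
      ≤ ∫ t, ‖l t‖ ^ 2 := by
  have hcont : ∀ t, Continuous fun z => l (t - p z) := fun t =>
    (hl.continuous_sub hp).comp (Continuous.prodMk_right t)
  have h1 : ∀ t, star (cfc (fun z => l (t - p z)) N) * cfc (fun z => l (t - p z)) N
      = cfc (fun z => star (l (t - p z)) * l (t - p z)) N := fun t => by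
    rw [← cfc_star, ← cfc_mul _ _ N (hcont t).star.continuousOn (hcont t).continuousOn]
  simp_rw [h1]
  refine ⟨hl.star_mul_self.integrable_cfc_sub hp hN, ?_⟩
  rw [hl.star_mul_self.integral_cfc_sub hp hN, ← cfc_const _ N]
  refine norm_cfc_le (integral_nonneg fun t => by positivity) fun z _ => ?_
  refine norm_integral_le_of_norm_le ?_ (ae_of_all _ fun t => ?_)
  · simpa [sq] using! hl.star_mul_self.integrable.norm
  · simp [sq]

theorem norm_integral_cfc_mul_star_le {a : ℝ → ℂ → ℂ} (ha : Continuous (Function.uncurry a))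
    {p : ℂ → ℝ} (hp : Continuous p) {B : ℝ} (hB : 0 ≤ B)
    (haB : ∀ t z, ‖a t z‖ ^ 2 ≤ B * (1 + (t - p z) ^ 2)⁻¹)
    {N : H →L[ℂ] H} (hN : IsStarNormal N) :
    Integrable (fun t => cfc (a t) N * star (cfc (a t) N)) ∧
    ‖∫ t, cfc (a t) N * star (cfc (a t) N)‖ ≤ B * Real.pi := by
  have hcont : ∀ t, Continuous (a t) := fun t => ha.comp (Continuous.prodMk_right t)
  have h1 : ∀ t, cfc (a t) N * star (cfc (a t) N) = cfc (fun z => a t z * star (a t z)) N :=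
    fun t => by
      rw [← cfc_star, ← cfc_mul _ _ N (hcont t).continuousOn (hcont t).star.continuousOn]
  have h2 : Continuous (Function.uncurry fun t z => a t z * star (a t z)) := ha.mul ha.star
  obtain ⟨R, hR⟩ := exists_abs_le_of_mem_spectrum hp N
  have h3 : ∀ t, ∀ z ∈ spectrum ℂ N,
      ‖a t z * star (a t z)‖ ≤ B * (2 + 2 * R ^ 2) * (1 + t ^ 2)⁻¹ := fun t z hz => by
    rw [norm_mul, norm_star, ← sq, mul_assoc]
    exact (haB t z).trans (mul_le_mul_of_nonneg_left (inv_one_add_sub_sq_le (hR z hz)) hB)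
  simp_rw [h1]
  refine ⟨integrable_cfc_of_norm_le h2 hN h3, ?_⟩
  rw [integral_cfc_of_norm_le h2 hN h3]
  refine norm_cfc_le (by positivity) fun z _ => ?_
  have h4 : ∫ t, B * (1 + (t - p z) ^ 2)⁻¹ = B * Real.pi := by
    rw [integral_const_mul, integral_sub_right_eq_self (fun t : ℝ => (1 + t ^ 2)⁻¹) (p z),
      integral_univ_inv_one_add_sq]
  rw [← h4]
  refine norm_integral_le_of_norm_le ((integrable_inv_one_add_sq.comp_sub_right (p z)).const_mul B)
    (ae_of_all _ fun t => ?_)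
  rw [norm_mul, norm_star, ← sq]
  exact haB t z

/-- The constant in the interpolation estimate. -/
noncomputable def kernelConst (k' l : ℝ → ℂ) : ℝ :=
  √(((∫ u, ‖k' u‖) ^ 2 + 4) * Real.pi) * √(∫ t, ‖l t‖ ^ 2)

theorem norm_sq_le_of_mul_eq_sub {a u v x t : ℂ} {s M A : ℝ} (hs : ‖x - t‖ ^ 2 = s ^ 2)
    (h : (x - t) * a = u - v) (hu : ‖u‖ ≤ M) (hv : ‖v‖ ≤ M) (ha : ‖a‖ ≤ M * A) :
    ‖a‖ ^ 2 ≤ M ^ 2 * (A ^ 2 + 4) * (1 + s ^ 2)⁻¹ := by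
  rw [← div_eq_mul_inv, le_div_iff₀ (by positivity), ← hs]
  have h1 : ‖x - t‖ * ‖a‖ ≤ 2 * M := by
    rw [← norm_mul, h]
    exact (norm_sub_le _ _).trans (by linarith)
  have h2 := pow_le_pow_left₀ (by positivity) h1 2
  have h3 := pow_le_pow_left₀ (norm_nonneg a) ha 2
  nlinarith

theorem MeasureTheory.Integrable.mul_of_norm_le {X W : ℝ → H →L[ℂ] H} (hW : Integrable W)
    (hX : Continuous X) {B : ℝ} (hXB : ∀ t, ‖X t‖ ≤ B) : Integrable fun t => X t * W t :=
  (hW.norm.const_mul B).mono' (hX.aestronglyMeasurable.mul hW.1) (ae_of_all _ fun t =>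
    (norm_mul_le _ _).trans (mul_le_mul_of_nonneg_right (hXB t) (norm_nonneg _)))

theorem integral_mul_cfc_eq_zero {k k' l : ℝ → ℂ} (hK : KernelPair k k' l)
    {X : ℝ → H →L[ℂ] H} (hXc : Continuous X) {B : ℝ} (hXB : ∀ t, ‖X t‖ ≤ B)
    (hX : ∀ t, X t = ∫ u, k (u - t) • X u) {p : ℂ → ℝ} (hp : Continuous p)
    {N : H →L[ℂ] H} (hN : IsStarNormal N) :
    ∫ t, X t * cfc (fun z => (t - p z : ℝ) * l (t - p z)) N = 0 := by
  have hWint := hK.decay_mul.integrable_cfc_sub hp hN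
  have hWc := continuous_cfc_of_uncurry (hK.decay_mul.continuous_sub hp) N
  set W : ℝ → H →L[ℂ] H := fun t => cfc (fun z => (t - p z : ℝ) * l (t - p z)) N
  have hkX : ∀ t, Integrable fun u => k (u - t) • X u := fun t =>
    (hK.decay.integrable.comp_sub_right t).smul_bdd B hXc.aestronglyMeasurable (ae_of_all _ hXB)
  obtain ⟨c, hc0, hc⟩ := hK.decay_mul.exists_bound_on_spectrum hp N
  obtain ⟨c', hc'0, hc'⟩ := hK.decay.exists_bound_sub 0
  have hkc : ∀ s, ‖k s‖ ≤ c' := fun s => by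
    have h := hc' s 0 (by simp)
    rw [sub_zero] at h
    exact h.trans (mul_le_of_le_one_right hc'0 (inv_le_one_of_one_le₀ (by nlinarith [sq_nonneg s])))
  have hkW1 : ∀ u t, cfc (fun z => k (u - t) * ((t - p z : ℝ) * l (t - p z))) N
      = k (u - t) • W t := fun u t =>
    cfc_const_mul _ _ N ((hK.decay_mul.continuous_sub hp).comp
      (Continuous.prodMk_right t)).continuousOn
  have hkW2 : ∀ u, Continuous (Function.uncurry fun (t : ℝ) z =>
      k (u - t) * ((t - p z : ℝ) * l (t - p z))) := fun u =>
    (hK.decay.1.comp (continuous_const.sub continuous_fst)).mul (hK.decay_mul.continuous_sub hp)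
  have hkW3 : ∀ u t, ∀ z ∈ spectrum ℂ N,
      ‖k (u - t) * ((t - p z : ℝ) * l (t - p z))‖ ≤ c' * c * (1 + t ^ 2)⁻¹ := fun u t z hz => by
    rw [norm_mul, mul_assoc]
    exact mul_le_mul (hkc _) (hc t z hz) (norm_nonneg _) hc'0
  have hkW : ∀ u, Integrable fun t => k (u - t) • W t := fun u => by
    simp_rw [← hkW1]
    exact integrable_cfc_of_norm_le (hkW2 u) hN (hkW3 u)
  have hkW0 : ∀ u, ∫ t, k (u - t) • W t = 0 := fun u => by
    simp_rw [← hkW1]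
    rw [integral_cfc_of_norm_le (hkW2 u) hN (hkW3 u), ← cfc_const_zero ℂ N]
    congr 1 with z
    rw [← hK.integral_mul_eq_zero (u - p z),
      ← integral_sub_right_eq_self (fun s : ℝ => k (u - p z - s) * (s * l s)) (p z)]
    simp
  have hint : Integrable (Function.uncurry fun t u => k (u - t) • (X u * W t))
      (volume.prod volume) := by
    have h1 := (Integrable.convolution_integrand (ContinuousLinearMap.mul ℝ ℝ) hWint.norm
      hK.decay.integrable.norm).swap
    have h2 : Continuous (Function.uncurry fun t u => k (u - t) • (X u * W t)) :=
      (hK.decay.1.comp (continuous_snd.sub continuous_fst)).smul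
        ((hXc.comp continuous_snd).mul (hWc.comp continuous_fst))
    refine (h1.const_mul B).mono' h2.aestronglyMeasurable (ae_of_all _ fun p => ?_)
    simp only [Function.uncurry, Function.comp, Prod.swap, ContinuousLinearMap.mul_apply',
      norm_smul]
    calc _ ≤ ‖k (p.2 - p.1)‖ * (B * ‖W p.1‖) :=
          mul_le_mul_of_nonneg_left ((norm_mul_le _ _).trans
            (mul_le_mul_of_nonneg_right (hXB _) (norm_nonneg _))) (norm_nonneg _)
      _ = _ := by ring
  calc ∫ t, X t * W t = ∫ t, ∫ u, k (u - t) • (X u * W t) := by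
        congr 1 with t : 1
        rw [hX t, ← integral_mul_const_of_integrable (hkX t)]
        simp_rw [smul_mul_assoc]
    _ = ∫ u, ∫ t, k (u - t) • (X u * W t) := integral_integral_swap hint
    _ = ∫ u, X u * ∫ t, k (u - t) • W t := by
        congr 1 with u : 1
        rw [← integral_const_mul_of_integrable (hkW u)]
        simp_rw [mul_smul_comm]
    _ = 0 := by
        simp_rw [hkW0, mul_zero, integral_zero]

/-- Interpolation between the functional calculi of two normal operators, one variable at a
time. -/
theorem norm_cfc_sub_integral_le {k k' l : ℝ → ℂ} (hK : KernelPair k k' l) {g : ℝ → ℝ → ℂ} {M : ℝ}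
    (hg : Continuous (Function.uncurry g)) (hM : ∀ x y, ‖g x y‖ ≤ M) (hrep : Reproducing k g)
    {p q : ℂ → ℝ} (hp : Continuous p) (hq : Continuous q) {N N' : H →L[ℂ] H}
    (hN : IsStarNormal N) (hN' : IsStarNormal N') :
    ‖cfc (fun z => g (p z) (q z)) N
        - ∫ t, cfc (fun z => g t (q z)) N * cfc (fun z => l (t - p z)) N'‖
      ≤ kernelConst k' l * M * ‖cfc (fun z => (p z : ℂ)) N - cfc (fun z => (p z : ℂ)) N'‖ := by
  obtain ⟨a, hac, hasub, haM, haint⟩ :=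
    exists_dividedDifference hK.decay hK.hasDerivAt hK.decay_deriv hg hM hrep
  have hM0 : 0 ≤ M := (norm_nonneg _).trans (hM 0 0)
  set A := ∫ u, ‖k' u‖
  have hA0 : 0 ≤ A := integral_nonneg fun u => norm_nonneg _
  have hxc : Continuous (Function.uncurry fun t z => a t (p z) (q z)) :=
    hac.comp (f := fun r : ℝ × ℂ => (r.1, p r.2, q r.2)) (by fun_prop)
  have hfc : Continuous (Function.uncurry fun t z => g t (q z)) :=
    hg.comp (f := fun r : ℝ × ℂ => (r.1, q r.2)) (by fun_prop)
  have hx : ∀ t, Continuous fun z => a t (p z) (q z) := fun t =>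
    hxc.comp (Continuous.prodMk_right t)
  have hf : ∀ t, Continuous fun z => g t (q z) := fun t => hfc.comp (Continuous.prodMk_right t)
  have hl : ∀ t : ℝ, Continuous fun z => l (t - p z) := fun t =>
    (hK.decay_right.continuous_sub hp).comp (Continuous.prodMk_right t)
  have hw : ∀ t : ℝ, Continuous fun z => ((t - p z : ℝ) : ℂ) * l (t - p z) := fun t =>
    (hK.decay_mul.continuous_sub hp).comp (Continuous.prodMk_right t)
  have hgpq : Continuous fun z => g (p z) (q z) := hg.comp (hp.prodMk hq)
  have hpc : Continuous fun z => (p z : ℂ) := Complex.continuous_ofReal.comp hp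
  have hXc := continuous_cfc_of_uncurry hxc N
  have hFc := continuous_cfc_of_uncurry hfc N
  have hYc := continuous_cfc_of_uncurry (hK.decay_right.continuous_sub hp) N'
  have hYint := hK.decay_right.integrable_cfc_sub hp hN'
  have hWint := hK.decay_mul.integrable_cfc_sub hp hN'
  have hYone := hK.decay_right.integral_cfc_sub hp hN'
  have hXB : ∀ t, ‖cfc (fun z => a t (p z) (q z)) N‖ ≤ M * A := fun t =>
    norm_cfc_le (by positivity) fun z _ => haM _ _ _
  have hFB : ∀ t, ‖cfc (fun z => g t (q z)) N‖ ≤ M := fun t => norm_cfc_le hM0 fun z _ => hM _ _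
  have hXW : ∫ t, cfc (fun z => a t (p z) (q z)) N
      * cfc (fun z => (t - p z : ℝ) * l (t - p z)) N' = 0 := by
    refine integral_mul_cfc_eq_zero hK hXc hXB (fun t => ?_) hp hN'
    have h1 : ∀ u, k (u - t) • cfc (fun z => a u (p z) (q z)) N
        = cfc (fun z => k (u - t) * a u (p z) (q z)) N := fun u =>
      (cfc_const_mul _ _ N (hx u).continuousOn).symm
    have h2 : Continuous (Function.uncurry fun u z => k (u - t) * a u (p z) (q z)) :=
      (hK.decay.1.comp (continuous_fst.sub continuous_const)).mul hxc
    simp_rw [h1]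
    rw [← cfc_integral _ (fun u => ‖k (u - t)‖ * (M * A)) N h2.continuousOn
      (ae_of_all _ fun u z _ => ?_)
      ((hK.decay.integrable.comp_sub_right t).norm.mul_const (M * A)).2]
    · congr 1 with z
      rw [← haint t]
      simp_rw [mul_comm]
    · rw [norm_mul]
      exact mul_le_mul_of_nonneg_left (haM _ _ _) (norm_nonneg _)
  have hXP : ∀ t : ℝ, cfc (fun z => a t (p z) (q z)) N * cfc (fun z => (p z : ℂ)) N
      = cfc (fun z => g (p z) (q z)) N - cfc (fun z => g t (q z)) N
        + (t : ℂ) • cfc (fun z => a t (p z) (q z)) N := fun t => by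
    rw [← cfc_mul _ _ N (hx t).continuousOn hpc.continuousOn,
      ← cfc_sub _ _ N hgpq.continuousOn (hf t).continuousOn,
      ← cfc_const_mul _ _ N (hx t).continuousOn,
      ← cfc_add N (fun z => g (p z) (q z) - g t (q z)) (fun z => (t : ℂ) * a t (p z) (q z))
        (hgpq.sub (hf t)).continuousOn (continuous_const.mul (hx t)).continuousOn]
    congr 1 with z
    linear_combination hasub t (p z) (q z)
  have hPY : ∀ t : ℝ, cfc (fun z => (p z : ℂ)) N' * cfc (fun z => l (t - p z)) N'
      = (t : ℂ) • cfc (fun z => l (t - p z)) N'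
        - cfc (fun z => (t - p z : ℝ) * l (t - p z)) N' := fun t => by
    rw [← cfc_mul _ _ N' hpc.continuousOn (hl t).continuousOn,
      ← cfc_const_mul _ _ N' (hl t).continuousOn,
      ← cfc_sub (fun z => (t : ℂ) * l (t - p z)) (fun z => (t - p z : ℝ) * l (t - p z)) N'
        (continuous_const.mul (hl t)).continuousOn (hw t).continuousOn]
    congr 1 with z
    push_cast
    ring
  set X : ℝ → H →L[ℂ] H := fun t => cfc (fun z => a t (p z) (q z)) N
  set F : ℝ → H →L[ℂ] H := fun t => cfc (fun z => g t (q z)) N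
  set Y : ℝ → H →L[ℂ] H := fun t => cfc (fun z => l (t - p z)) N'
  set W : ℝ → H →L[ℂ] H := fun t => cfc (fun z => (t - p z : ℝ) * l (t - p z)) N'
  set G := cfc (fun z => g (p z) (q z)) N
  set D := cfc (fun z => (p z : ℂ)) N - cfc (fun z => (p z : ℂ)) N' with hD
  have hXDY : ∀ t, X t * D * Y t = G * Y t - F t * Y t + X t * W t := fun t => by
    rw [hD, mul_sub, sub_mul, mul_assoc (X t) (cfc _ N') (Y t), hPY t, hXP t]
    simp only [add_mul, sub_mul, mul_sub, smul_mul_assoc, mul_smul_comm]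
    abel
  have hGYint : Integrable fun t => G * Y t := hYint.const_mul G
  have hFYint : Integrable fun t => F t * Y t := hYint.mul_of_norm_le hFc hFB
  have hXWint : Integrable fun t => X t * W t := hWint.mul_of_norm_le hXc hXB
  have hXDYint : Integrable fun t => X t * D * Y t := by
    simp_rw [hXDY]
    exact (hGYint.sub hFYint).add hXWint
  have hint : ∫ t, X t * D * Y t = G - ∫ t, F t * Y t := by
    simp_rw [hXDY]
    rw [integral_add (f := fun t => G * Y t - F t * Y t) (hGYint.sub hFYint) hXWint, hXW, add_zero,
      integral_sub hGYint hFYint, integral_const_mul_of_integrable hYint, hYone, hK.integral_right,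
      map_one, mul_one]
  rw [← hint]
  have haB : ∀ (t : ℝ) z, ‖a t (p z) (q z)‖ ^ 2
      ≤ M ^ 2 * (A ^ 2 + 4) * (1 + (t - p z) ^ 2)⁻¹ := fun t z => by
    refine norm_sq_le_of_mul_eq_sub ?_ (hasub t (p z) (q z)) (hM _ _) (hM _ _) (haM _ _ _)
    rw [← Complex.ofReal_sub, Complex.norm_real, Real.norm_eq_abs, sq_abs]
    ring
  obtain ⟨hX1, hX2⟩ := norm_integral_cfc_mul_star_le hxc hp (by positivity) haB hN
  obtain ⟨hY1, hY2⟩ := norm_integral_star_mul_cfc_sub_le hK.decay_right hp hN'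
  refine (norm_integral_mul_mul_le D hXc hYc hX1 hY1 hXDYint
    (α := M * √((A ^ 2 + 4) * Real.pi)) (β := √(∫ t, ‖l t‖ ^ 2)) (by positivity) (by positivity)
    (hX2.trans_eq ?_) (hY2.trans_eq ?_)).trans_eq ?_
  · rw [mul_pow, Real.sq_sqrt (by positivity)]
    ring
  · rw [Real.sq_sqrt (integral_nonneg fun t => by positivity)]
  · rw [kernelConst]
    ring

end Interpolation

section Commutation

variable {H : Type*} [NormedAddCommGroup H] [InnerProductSpace ℂ H] [CompleteSpace H]

theorem cfc_eq_integral_smul {l : ℝ → ℂ} (hl : QuadDecay l) {g : ℝ → ℝ → ℂ} {M : ℝ}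
    (hg : Continuous (Function.uncurry g)) (hM : ∀ x y, ‖g x y‖ ≤ M) (hrep : Reproducing l g)
    {p : ℂ → ℝ} (hp : Continuous p) {N : H →L[ℂ] H} (hN : IsStarNormal N) (y : ℝ) :
    cfc (fun z => g (p z) y) N = ∫ t, g t y • cfc (fun z => l (t - p z)) N := by
  have h1 : ∀ t, g t y • cfc (fun z => l (t - p z)) N = cfc (fun z => g t y * l (t - p z)) N :=
    fun t => (cfc_const_mul _ _ N
      ((hl.continuous_sub hp).comp (Continuous.prodMk_right t)).continuousOn).symm
  have h2 : Continuous (Function.uncurry fun (t : ℝ) z => g t y * l (t - p z)) :=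
    (hg.comp (f := fun r : ℝ × ℂ => (r.1, y)) (by fun_prop)).mul (hl.continuous_sub hp)
  obtain ⟨c, hc0, hc⟩ := hl.exists_bound_on_spectrum hp N
  have h3 : ∀ t, ∀ z ∈ spectrum ℂ N, ‖g t y * l (t - p z)‖ ≤ M * c * (1 + t ^ 2)⁻¹ :=
    fun t z hz => by
      rw [norm_mul, mul_assoc]
      exact mul_le_mul (hM t y) (hc t z hz) (norm_nonneg _) ((norm_nonneg _).trans (hM 0 0))
  simp_rw [h1]
  rw [integral_cfc_of_norm_le h2 hN h3]
  congr 1 with z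
  rw [← hrep 1 (by simp), ← integral_sub_right_eq_self _ (p z)]
  simp

/-- The two one-variable interpolations between `N₁` and `N₂` meet in the same operator. -/
theorem integral_cfc_mul_cfc_comm {l : ℝ → ℂ} (hl : QuadDecay l) {g : ℝ → ℝ → ℂ} {M : ℝ}
    (hg : Continuous (Function.uncurry g)) (hM : ∀ x y, ‖g x y‖ ≤ M) (hrep : Reproducing l g)
    (hrep' : Reproducing l (fun y x => g x y)) {p q : ℂ → ℝ} (hp : Continuous p)
    (hq : Continuous q) {N₁ N₂ : H →L[ℂ] H} (hN₁ : IsStarNormal N₁) (hN₂ : IsStarNormal N₂) :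
    ∫ t, cfc (fun z => g t (q z)) N₁ * cfc (fun z => l (t - p z)) N₂
      = ∫ s, cfc (fun z => l (s - q z)) N₁ * cfc (fun z => g (p z) s) N₂ := by
  have hg' : Continuous (Function.uncurry fun y x => g x y) := hg.comp continuous_swap
  have hL₁ := hl.integrable_cfc_sub hq hN₁
  have hL₂ := hl.integrable_cfc_sub hp hN₂
  simp_rw [cfc_eq_integral_smul hl hg hM hrep hp hN₂,
    cfc_eq_integral_smul hl hg' (fun y x => hM x y) hrep' hq hN₁]
  set L₁ : ℝ → H →L[ℂ] H := fun s => cfc (fun z => l (s - q z)) N₁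
  set L₂ : ℝ → H →L[ℂ] H := fun t => cfc (fun z => l (t - p z)) N₂
  have h1 : ∀ t, Integrable fun s => g t s • L₁ s := fun t =>
    hL₁.bdd_smul M (hg.comp (Continuous.prodMk_right t)).aestronglyMeasurable
      (ae_of_all _ fun s => hM t s)
  have h2 : ∀ s, Integrable fun t => g t s • L₂ t := fun s =>
    hL₂.bdd_smul M (hg.comp (Continuous.prodMk_left s)).aestronglyMeasurable
      (ae_of_all _ fun t => hM t s)
  have hint : Integrable (Function.uncurry fun t s => g t s • (L₁ s * L₂ t))
      (volume.prod volume) := by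
    refine ((hL₂.norm.mul_prod hL₁.norm).const_mul M).mono' (hg.aestronglyMeasurable.smul
      (hL₁.1.comp_snd.mul hL₂.1.comp_fst)) (ae_of_all _ fun r => ?_)
    simp only [Function.uncurry, norm_smul]
    refine mul_le_mul (hM _ _) ((norm_mul_le _ _).trans_eq (mul_comm _ _)) (norm_nonneg _)
      ((norm_nonneg _).trans (hM 0 0))
  calc ∫ t, (∫ s, g t s • L₁ s) * L₂ t = ∫ t, ∫ s, g t s • (L₁ s * L₂ t) := by
        congr 1 with t : 1
        rw [← integral_mul_const_of_integrable (h1 t)]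
        simp_rw [smul_mul_assoc]
    _ = ∫ s, ∫ t, g t s • (L₁ s * L₂ t) := integral_integral_swap hint
    _ = ∫ s, L₁ s * ∫ t, g t s • L₂ t := by
        congr 1 with s : 1
        rw [← integral_const_mul_of_integrable (h2 s)]
        simp_rw [mul_smul_comm]

theorem norm_cfc_re_sub_le {N₁ N₂ : H →L[ℂ] H} (hN₁ : IsStarNormal N₁) (hN₂ : IsStarNormal N₂) :
    ‖cfc (fun z => (z.re : ℂ)) N₁ - cfc (fun z => (z.re : ℂ)) N₂‖ ≤ ‖N₁ - N₂‖ := by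
  rw [cfc_re_id N₁, cfc_re_id N₂, ← AddSubgroupClass.coe_sub, ← map_sub]
  exact realPart.norm_le (N₁ - N₂)

theorem norm_cfc_im_sub_le {N₁ N₂ : H →L[ℂ] H} (hN₁ : IsStarNormal N₁) (hN₂ : IsStarNormal N₂) :
    ‖cfc (fun z => (z.im : ℂ)) N₁ - cfc (fun z => (z.im : ℂ)) N₂‖ ≤ ‖N₁ - N₂‖ := by
  rw [cfc_im_id N₁, cfc_im_id N₂, ← AddSubgroupClass.coe_sub, ← map_sub]
  exact imaginaryPart.norm_le (N₁ - N₂)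

theorem norm_cfc_sub_cfc_le_of_reproducing {k k' l : ℝ → ℂ} (hK : KernelPair k k' l)
    {g : ℝ → ℝ → ℂ} {M : ℝ} (hg : Continuous (Function.uncurry g)) (hM : ∀ x y, ‖g x y‖ ≤ M)
    (hk : Reproducing k g) (hk' : Reproducing k (fun y x => g x y))
    (hl : Reproducing l g) (hl' : Reproducing l (fun y x => g x y))
    {N₁ N₂ : H →L[ℂ] H} (hN₁ : IsStarNormal N₁) (hN₂ : IsStarNormal N₂) :
    ‖cfc (fun z => g z.re z.im) N₁ - cfc (fun z => g z.re z.im) N₂‖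
      ≤ 2 * kernelConst k' l * M * ‖N₁ - N₂‖ := by
  have hM0 : 0 ≤ M := (norm_nonneg _).trans (hM 0 0)
  have hC0 : 0 ≤ kernelConst k' l := by unfold kernelConst; positivity
  have hg' : Continuous (Function.uncurry fun y x => star (g x y)) := (hg.comp continuous_swap).star
  have hks : Reproducing (fun u => star (k u)) (fun y x => star (g x y)) := fun r hr y x => by
    have := integral_conj (f := fun u => g x (y + r * u) * k u) (μ := volume)
    rw [hk' r hr y x] at this
    simpa using this
  have h1 := norm_cfc_sub_integral_le hK hg hM hk Complex.continuous_re Complex.continuous_im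
    hN₁ hN₂
  have h2 := norm_cfc_sub_integral_le hK.star hg' (fun y x => by simpa using hM x y) hks
    Complex.continuous_im Complex.continuous_re hN₂ hN₁
  have hstar : ∀ X : ℝ → H →L[ℂ] H, star (∫ t, X t) = ∫ t, star (X t) := fun X =>
    ((starL' ℝ : (H →L[ℂ] H) ≃L[ℝ] (H →L[ℂ] H)).integral_comp_comm X).symm
  have hconst : kernelConst (fun u => star (k' u)) (fun u => star (l u)) = kernelConst k' l := by
    simp [kernelConst]
  rw [hconst, norm_sub_rev (cfc (fun z => (z.im : ℂ)) N₂), ← norm_star, star_sub, ← cfc_star,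
    hstar] at h2
  simp only [star_mul, ← cfc_star, star_star] at h2
  rw [← integral_cfc_mul_cfc_comm hK.decay_right hg hM hl hl' Complex.continuous_re
    Complex.continuous_im hN₁ hN₂, norm_sub_rev] at h2
  refine (norm_sub_le_norm_sub_add_norm_sub _ _ _).trans ((add_le_add h1 h2).trans ?_)
  have h3 := mul_le_mul_of_nonneg_left (norm_cfc_re_sub_le hN₁ hN₂) (mul_nonneg hC0 hM0)
  have h4 := mul_le_mul_of_nonneg_left (norm_cfc_im_sub_le hN₁ hN₂) (mul_nonneg hC0 hM0)
  linarith

end Commutation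

section FourierSupport

theorem integral_mul_dilate (h : ℝ → ℂ) (k : ℝ → ℂ) {r : ℝ} (hr : 0 < r) (z : ℝ) :
    ∫ x, h x * ((r : ℂ)⁻¹ * k ((x - z) / r)) = ∫ u, h (z + r * u) * k u := by
  have h1 := Measure.integral_comp_mul_left (fun s => h (z + s) * k (s / r)) r
  simp only [mul_div_cancel_left₀ _ hr.ne'] at h1
  rw [h1, abs_of_pos (inv_pos.2 hr),
    ← integral_sub_right_eq_self (fun y => h (z + y) * k (y / r)) z,
    ← integral_smul]
  congr 1 with x
  rw [Complex.real_smul, add_sub_cancel]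
  push_cast
  ring

theorem integral_prod_mul_dilate {h : ℝ → ℝ → ℂ} {M : ℝ} (hh : Continuous (Function.uncurry h))
    (hM : ∀ x y, ‖h x y‖ ≤ M) {k : ℝ → ℂ} (hk : Integrable k) {r r' : ℝ} (hr : 0 < r)
    (hr' : 0 < r') (x y : ℝ) :
    ∫ p : ℝ × ℝ, h p.1 p.2 * (((r : ℂ)⁻¹ * k ((p.1 - x) / r)) * ((r' : ℂ)⁻¹ * k ((p.2 - y) / r')))
      = ∫ p : ℝ × ℝ, h (x + r * p.1) (y + r' * p.2) * (k p.1 * k p.2) := by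
  have hkr : ∀ {r : ℝ}, 0 < r → ∀ z, Integrable fun u => (r : ℂ)⁻¹ * k ((u - z) / r) :=
    fun hr z => ((hk.comp_div hr.ne').comp_sub_right z).const_mul _
  have h1 : Integrable (fun p : ℝ × ℝ => h p.1 p.2 *
      (((r : ℂ)⁻¹ * k ((p.1 - x) / r)) * ((r' : ℂ)⁻¹ * k ((p.2 - y) / r')))) :=
    ((hkr hr x).mul_prod (hkr hr' y)).bdd_mul hh.aestronglyMeasurable (ae_of_all _ fun p => hM _ _)
  have h2 : Integrable (fun p : ℝ × ℝ => h (x + r * p.1) (y + r' * p.2) * (k p.1 * k p.2)) :=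
    (hk.mul_prod hk).bdd_mul (hh.comp (f := fun p : ℝ × ℝ => (x + r * p.1, y + r' * p.2))
      (by fun_prop)).aestronglyMeasurable (ae_of_all _ fun p => hM _ _)
  rw [Measure.volume_eq_prod] at h1 h2 ⊢
  rw [integral_prod _ h1, integral_prod _ h2]
  have h3 : ∀ s, ∫ t, h s t * (((r : ℂ)⁻¹ * k ((s - x) / r)) * ((r' : ℂ)⁻¹ * k ((t - y) / r')))
      = (∫ t, h s (y + r' * t) * k t) * ((r : ℂ)⁻¹ * k ((s - x) / r)) := fun s => by
    rw [← integral_mul_dilate _ _ hr', ← integral_mul_const]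
    congr 1 with t
    ring
  simp_rw [h3]
  rw [integral_mul_dilate _ _ hr]
  congr 1 with s
  rw [← integral_mul_const]
  congr 1 with t
  ring

theorem Complex.integral_eq_integral_prod (G : ℂ → ℂ) :
    ∫ z, G z = ∫ p : ℝ × ℝ, G (p.1 + p.2 * Complex.I) := by
  rw [← (Complex.volume_preserving_equiv_real_prod.symm).integral_comp
    Complex.measurableEquivRealProd.symm.measurableEmbedding]
  congr 1 with p
  rw [Complex.measurableEquivRealProd_symm_apply, Complex.mk_eq_add_mul_I]

theorem integral_exp_mul_dilate (b : ℝ → ℂ) {r : ℝ} (hr : 0 < r) (z x : ℝ) :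
    ∫ ξ : ℝ, Complex.exp ((-2 * Real.pi * ξ * (x - z) : ℝ) * Complex.I) * b (r * ξ)
      = (r : ℂ)⁻¹ * 𝓕 b ((x - z) / r) := by
  have h1 := Measure.integral_comp_mul_left
    (fun s => Complex.exp ((-2 * Real.pi * s * ((x - z) / r) : ℝ) * Complex.I) * b s) r
  rw [Real.fourier_real_eq_integral_exp_smul]
  rw [abs_of_pos (inv_pos.2 hr), Complex.real_smul, Complex.ofReal_inv] at h1
  simp_rw [smul_eq_mul]
  rw [← h1]
  congr 1 with ξ
  congr 4
  field_simp

/-- A dilated and modulated product of cut-off functions. -/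
noncomputable def modulatedBump (b : ℝ → ℂ) (r r' x y : ℝ) (ξ : ℂ) : ℂ :=
  Complex.exp ((2 * Real.pi * (ξ.re * x + ξ.im * y) : ℝ) * Complex.I) *
    (b (r * ξ.re) * b (r' * ξ.im))

theorem contDiff_modulatedBump {b : ℝ → ℂ} (hb : ContDiff ℝ (⊤ : ℕ∞) b) (r r' x y : ℝ) :
    ContDiff ℝ (⊤ : ℕ∞) (modulatedBump b r r' x y) := by
  have hre : ContDiff ℝ (⊤ : ℕ∞) Complex.re := Complex.reCLM.contDiff
  have him : ContDiff ℝ (⊤ : ℕ∞) Complex.im := Complex.imCLM.contDiff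
  have hof : ContDiff ℝ (⊤ : ℕ∞) Complex.ofReal := Complex.ofRealCLM.contDiff
  unfold modulatedBump
  fun_prop

theorem hasCompactSupport_modulatedBump {b : ℝ → ℂ} (hb : HasCompactSupport b) {r r' : ℝ}
    (hr : 0 < r) (hr' : 0 < r') (x y : ℝ) : HasCompactSupport (modulatedBump b r r' x y) := by
  obtain ⟨R, hR⟩ := hb.isCompact.isBounded.exists_norm_le
  have hR' : ∀ s, R < |s| → b s = 0 := fun s hs => by
    by_contra h
    exact hs.not_ge (hR s (subset_tsupport b h))
  refine HasCompactSupport.intro (isCompact_closedBall (0 : ℂ) (R / r + R / r')) fun ξ hξ => ?_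
  rw [mem_closedBall_zero_iff, not_le] at hξ
  have h1 := hξ.trans_le (Complex.norm_le_abs_re_add_abs_im ξ)
  have h2 : R / r < |ξ.re| ∨ R / r' < |ξ.im| := by
    by_contra! h
    linarith [h.1, h.2]
  unfold modulatedBump
  rcases h2 with h | h
  · rw [hR' (r * ξ.re), zero_mul, mul_zero]
    rwa [abs_mul, abs_of_pos hr, mul_comm, ← div_lt_iff₀ hr]
  · rw [hR' (r' * ξ.im), mul_zero, mul_zero]
    rwa [abs_mul, abs_of_pos hr', mul_comm, ← div_lt_iff₀ hr']

theorem fourier_modulatedBump (b : ℝ → ℂ) {r r' : ℝ} (hr : 0 < r) (hr' : 0 < r') (x y : ℝ)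
    (w : ℂ) : 𝓕 (modulatedBump b r r' x y) w
      = ((r : ℂ)⁻¹ * 𝓕 b ((w.re - x) / r)) * ((r' : ℂ)⁻¹ * 𝓕 b ((w.im - y) / r')) := by
  rw [← integral_exp_mul_dilate b hr, ← integral_exp_mul_dilate b hr', Real.fourier_eq',
    Complex.integral_eq_integral_prod, Measure.volume_eq_prod, ← integral_prod_mul]
  congr 1 with p
  rw [modulatedBump, smul_eq_mul, ← mul_assoc, ← Complex.exp_add, mul_mul_mul_comm,
    ← Complex.exp_add]
  congr 2
  · simp [Complex.inner]
    ring
  · simp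
  · simp

open SchwartzMap in
theorem integral_dilate_eq_of_fourierSupportedIn (b : 𝓢(ℝ, ℂ)) (hbc : HasCompactSupport b)
    (hb : ∀ x, |x| ≤ 2 → b x = 1) {f : ℂ → ℂ} {M σ : ℝ} (hf : Continuous f)
    (hM : ∀ z, ‖f z‖ ≤ M) (hσ : 0 < σ) (hfσ : FourierSupportedIn f σ) (x y : ℝ) {r r' s s' : ℝ}
    (hr : r ∈ Set.Ioc 0 σ⁻¹) (hr' : r' ∈ Set.Ioc 0 σ⁻¹) (hs : s ∈ Set.Ioc 0 σ⁻¹)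
    (hs' : s' ∈ Set.Ioc 0 σ⁻¹) :
    ∫ p : ℝ × ℝ, f ((x + r * p.1 : ℝ) + (y + r' * p.2 : ℝ) * Complex.I)
        * ((𝓕 b : 𝓢(ℝ, ℂ)) p.1 * (𝓕 b : 𝓢(ℝ, ℂ)) p.2)
      = ∫ p : ℝ × ℝ, f ((x + s * p.1 : ℝ) + (y + s' * p.2 : ℝ) * Complex.I)
        * ((𝓕 b : 𝓢(ℝ, ℂ)) p.1 * (𝓕 b : 𝓢(ℝ, ℂ)) p.2) := by
  have hbs : ContDiff ℝ (⊤ : ℕ∞) b := b.smooth _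
  set φ : 𝓢(ℂ, ℂ) := (hasCompactSupport_modulatedBump hbc hr.1 hr'.1 x y).toSchwartzMap
    (contDiff_modulatedBump hbs r r' x y)
  set ψ : 𝓢(ℂ, ℂ) := (hasCompactSupport_modulatedBump hbc hs.1 hs'.1 x y).toSchwartzMap
    (contDiff_modulatedBump hbs s s' x y)
  have hone : ∀ {t : ℝ}, t ∈ Set.Ioc 0 σ⁻¹ → ∀ u : ℝ, |u| < 2 * σ → b (t * u) = 1 :=
    fun {t} ht u hu => by
      refine hb _ ?_
      rw [abs_mul, abs_of_pos ht.1]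
      calc t * |u| ≤ σ⁻¹ * (2 * σ) :=
            mul_le_mul ht.2 hu.le (abs_nonneg u) (inv_pos.2 hσ).le
        _ = 2 := by field_simp
  have hsub : tsupport ⇑(φ - ψ) ⊆ (Metric.ball (0 : ℂ) (2 * σ))ᶜ := by
    refine closure_minimal (fun ξ hξ hmem => hξ ?_) Metric.isOpen_ball.isClosed_compl
    rw [mem_ball_zero_iff] at hmem
    have hre := (Complex.abs_re_le_norm ξ).trans_lt hmem
    have him := (Complex.abs_im_le_norm ξ).trans_lt hmem
    change modulatedBump b r r' x y ξ - modulatedBump b s s' x y ξ = 0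
    rw [modulatedBump, modulatedBump, hone hr _ hre, hone hr' _ him, hone hs _ hre, hone hs' _ him,
      sub_self]
  have hdisj : Disjoint (tsupport ⇑(φ - ψ)) (Metric.closedBall (0 : ℂ) σ) := by
    refine Set.disjoint_left.2 fun ξ hξ hmem => hsub hξ ?_
    rw [mem_closedBall_zero_iff] at hmem
    rw [mem_ball_zero_iff]
    linarith
  have hint : ∀ χ : 𝓢(ℂ, ℂ), Integrable fun w => f w * (𝓕 χ : 𝓢(ℂ, ℂ)) w := fun χ =>
    (𝓕 χ : 𝓢(ℂ, ℂ)).integrable.bdd_mul hf.aestronglyMeasurable (ae_of_all _ hM)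
  have hzero := hfσ (φ - ψ) hdisj
  rw [← SchwartzMap.fourier_coe, sub_eq_add_neg, FourierTransform.fourier_add,
    FourierTransform.fourier_neg, ← sub_eq_add_neg] at hzero
  simp only [sub_apply, mul_sub] at hzero
  rw [integral_sub (hint φ) (hint ψ), sub_eq_zero] at hzero
  have hfp : Continuous (Function.uncurry fun u v : ℝ => f (u + v * Complex.I)) :=
    hf.comp (f := fun p : ℝ × ℝ => (p.1 : ℂ) + p.2 * Complex.I) (by fun_prop)
  have key : ∀ {t t' : ℝ} (ht : 0 < t) (ht' : 0 < t') (χ : 𝓢(ℂ, ℂ)),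
      ⇑χ = modulatedBump b t t' x y → ∫ w, f w * (𝓕 χ : 𝓢(ℂ, ℂ)) w
        = ∫ p : ℝ × ℝ, f ((x + t * p.1 : ℝ) + (y + t' * p.2 : ℝ) * Complex.I)
        * ((𝓕 b : 𝓢(ℝ, ℂ)) p.1 * (𝓕 b : 𝓢(ℝ, ℂ)) p.2) := fun {t t'} ht ht' χ hχ => by
    rw [← integral_prod_mul_dilate hfp (fun u v => hM _) (𝓕 b : 𝓢(ℝ, ℂ)).integrable ht ht',
      Complex.integral_eq_integral_prod]
    simp_rw [SchwartzMap.fourier_coe, hχ, fourier_modulatedBump _ ht ht']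
    simp
  rw [← key hr.1 hr'.1 φ rfl, ← key hs.1 hs'.1 ψ rfl, hzero]

open SchwartzMap in
/-- Functions with Fourier transform supported in a disc are reproduced by averaging against
dilates of a product kernel. -/
theorem integral_dilate_eq_self (b : 𝓢(ℝ, ℂ)) (hbc : HasCompactSupport b)
    (hb : ∀ x, |x| ≤ 2 → b x = 1) {f : ℂ → ℂ} {M σ : ℝ} (hf : Continuous f)
    (hM : ∀ z, ‖f z‖ ≤ M) (hσ : 0 < σ) (hfσ : FourierSupportedIn f σ) (x y : ℝ) {r r' : ℝ}
    (hr : r ∈ Set.Icc 0 σ⁻¹) (hr' : r' ∈ Set.Icc 0 σ⁻¹) :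
    ∫ p : ℝ × ℝ, f ((x + r * p.1 : ℝ) + (y + r' * p.2 : ℝ) * Complex.I)
        * ((𝓕 b : 𝓢(ℝ, ℂ)) p.1 * (𝓕 b : 𝓢(ℝ, ℂ)) p.2) = f (x + y * Complex.I) := by
  have hkint := (𝓕 b : 𝓢(ℝ, ℂ)).integrable (μ := volume)
  have hkone : ∫ u, (𝓕 b : 𝓢(ℝ, ℂ)) u = 1 := by rw [integral_fourier, hb 0 (by simp)]
  set k : ℝ → ℂ := ⇑(𝓕 b : 𝓢(ℝ, ℂ))
  set J : ℝ × ℝ → ℂ := fun q =>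
    ∫ p : ℝ × ℝ, f ((x + q.1 * p.1 : ℝ) + (y + q.2 * p.2 : ℝ) * Complex.I) * (k p.1 * k p.2)
  have hJ : Continuous J := by
    have hcont : Continuous fun w : (ℝ × ℝ) × ℝ × ℝ =>
        f ((x + w.1.1 * w.2.1 : ℝ) + (y + w.1.2 * w.2.2 : ℝ) * Complex.I) :=
      hf.comp (by fun_prop)
    have hkk : Integrable fun p : ℝ × ℝ => k p.1 * k p.2 := hkint.mul_prod hkint
    refine continuous_of_dominated (bound := fun p => M * ‖k p.1 * k p.2‖) (fun q => ?_)
      (fun q => ae_of_all _ fun p => ?_) (hkk.norm.const_mul M) (ae_of_all _ fun p => ?_)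
    · exact (hcont.comp (Continuous.prodMk_right q)).aestronglyMeasurable.mul hkk.1
    · rw [norm_mul]
      exact mul_le_mul_of_nonneg_right (hM _) (norm_nonneg _)
    · exact (hcont.comp (Continuous.prodMk_left p)).mul continuous_const
  have hσ' : 0 < σ⁻¹ := inv_pos.2 hσ
  have hJconst : ∀ q ∈ Set.Icc 0 σ⁻¹ ×ˢ Set.Icc 0 σ⁻¹, J q = J (σ⁻¹, σ⁻¹) := by
    rw [← closure_Ioc hσ'.ne, ← closure_prod_eq]
    intro q hq
    refine closure_minimal (fun q' hq' => ?_) (isClosed_eq hJ continuous_const) hq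
    exact integral_dilate_eq_of_fourierSupportedIn b hbc hb hf hM hσ hfσ x y hq'.1 hq'.2
      ⟨hσ', le_rfl⟩ ⟨hσ', le_rfl⟩
  have h0 : J (0, 0) = f (x + y * Complex.I) := by
    simp only [J, zero_mul, add_zero]
    rw [integral_const_mul, Measure.volume_eq_prod, integral_prod_mul, hkone, mul_one, mul_one]
  rw [← h0, hJconst (0, 0) ⟨⟨le_rfl, hσ'.le⟩, ⟨le_rfl, hσ'.le⟩⟩]
  exact hJconst (r, r') ⟨hr, hr'⟩

open SchwartzMap in
theorem reproducing_fourier (b : 𝓢(ℝ, ℂ)) (hbc : HasCompactSupport b)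
    (hb : ∀ x, |x| ≤ 2 → b x = 1) {f : ℂ → ℂ} {M σ : ℝ} (hf : Continuous f)
    (hM : ∀ z, ‖f z‖ ≤ M) (hσ : 0 < σ) (hfσ : FourierSupportedIn f σ) :
    Reproducing (𝓕 b : 𝓢(ℝ, ℂ)) (fun x y => f ((x / σ : ℝ) + (y / σ : ℝ) * Complex.I)) ∧
    Reproducing (𝓕 b : 𝓢(ℝ, ℂ)) (fun y x => f ((x / σ : ℝ) + (y / σ : ℝ) * Complex.I)) := by
  have hkone : ∫ u, (𝓕 b : 𝓢(ℝ, ℂ)) u = 1 := by rw [integral_fourier, hb 0 (by simp)]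
  have hmem0 : (0 : ℝ) ∈ Set.Icc 0 σ⁻¹ := ⟨le_rfl, (inv_pos.2 hσ).le⟩
  have hmem : ∀ {r : ℝ}, r ∈ Set.Icc (0 : ℝ) 1 → r / σ ∈ Set.Icc 0 σ⁻¹ := fun {r} hr =>
    ⟨div_nonneg hr.1 hσ.le, by
      rw [div_eq_mul_inv]
      exact mul_le_of_le_one_left (inv_pos.2 hσ).le hr.2⟩
  constructor
  · intro r hr x y
    beta_reduce
    rw [← integral_dilate_eq_self b hbc hb hf hM hσ hfσ (x / σ) (y / σ) (hmem hr) hmem0,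
      Measure.volume_eq_prod]
    simp_rw [zero_mul, add_zero, ← mul_assoc]
    rw [integral_prod_mul (fun u : ℝ => f ((x / σ + r / σ * u : ℝ) + (y / σ : ℝ) * Complex.I)
      * (𝓕 b : 𝓢(ℝ, ℂ)) u), hkone, mul_one]
    congr 1 with u
    congr 4
    ring
  · intro r hr y x
    beta_reduce
    rw [← integral_dilate_eq_self b hbc hb hf hM hσ hfσ (x / σ) (y / σ) hmem0 (hmem hr),
      Measure.volume_eq_prod]
    have hcomm : ∀ p : ℝ × ℝ, ∀ w : ℂ, w * ((𝓕 b : 𝓢(ℝ, ℂ)) p.1 * (𝓕 b : 𝓢(ℝ, ℂ)) p.2)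
        = (𝓕 b : 𝓢(ℝ, ℂ)) p.1 * (w * (𝓕 b : 𝓢(ℝ, ℂ)) p.2) := fun p w => mul_left_comm _ _ _
    simp_rw [zero_mul, add_zero, hcomm]
    rw [integral_prod_mul _ (fun u : ℝ => f ((x / σ : ℝ) + (y / σ + r / σ * u : ℝ) * Complex.I)
      * (𝓕 b : 𝓢(ℝ, ℂ)) u), hkone, one_mul]
    congr 1 with u
    congr 5
    ring

end FourierSupport

section Besov

open SchwartzMap

theorem exists_schwartzMap_eq_one (R : ℝ) (hR : 0 < R) :
    ∃ b : 𝓢(ℝ, ℂ), HasCompactSupport b ∧ (∀ x, |x| ≤ R → b x = 1) ∧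
      ∀ x, R + 1 ≤ |x| → b x = 0 := by
  let B : ContDiffBump (0 : ℝ) := ⟨R, R + 1, hR, lt_add_one R⟩
  have hc : HasCompactSupport fun x => (B x : ℂ) :=
    B.hasCompactSupport.comp_left (g := Complex.ofReal) Complex.ofReal_zero
  refine ⟨hc.toSchwartzMap (Complex.ofRealCLM.contDiff.comp B.contDiff), hc, fun x hx => ?_,
    fun x hx => ?_⟩
  · change (B x : ℂ) = 1
    rw [B.one_of_mem_closedBall (by simpa using hx), Complex.ofReal_one]
  · change (B x : ℂ) = 0
    rw [B.zero_of_le_dist (by simpa using hx), Complex.ofReal_zero]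

theorem exists_kernelPair : ∃ b c : 𝓢(ℝ, ℂ), (HasCompactSupport b ∧ ∀ x, |x| ≤ 2 → b x = 1) ∧
    (HasCompactSupport c ∧ ∀ x, |x| ≤ 2 → c x = 1) ∧
    KernelPair (𝓕 b : 𝓢(ℝ, ℂ)) (deriv (𝓕 b : 𝓢(ℝ, ℂ))) (𝓕 c : 𝓢(ℝ, ℂ)) := by
  obtain ⟨b, hbc, hb1, hb0⟩ := exists_schwartzMap_eq_one 2 two_pos
  obtain ⟨c, hcc, hc1, -⟩ := exists_schwartzMap_eq_one 4 four_pos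
  refine ⟨b, c, ⟨hbc, hb1⟩, ⟨hcc, fun x hx => hc1 x (by linarith)⟩,
    kernelPair_fourier b c (hc1 0 (by simp)) fun ξ => ?_⟩
  rcases lt_or_ge |ξ| 4 with h | h
  · have hev : ⇑c =ᶠ[nhds ξ] fun _ => 1 := by
      filter_upwards [(isOpen_lt continuous_abs continuous_const).mem_nhds h] with x hx
      exact hc1 x (le_of_lt hx)
    rw [hev.deriv_eq, deriv_const, mul_zero]
  · rw [hb0 ξ (by linarith), zero_mul]

/-- Bounded functions with Fourier transform supported in a disc of radius `σ` are operator
Lipschitz on normal operators with constant proportional to `σ`. -/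
theorem exists_bernstein_const : ∃ C : ℝ, 0 ≤ C ∧
    ∀ (F : BoundedContinuousFunction ℂ ℂ) (σ : ℝ), 0 < σ → FourierSupportedIn F σ →
    ∀ (H : Type*) [NormedAddCommGroup H] [InnerProductSpace ℂ H] [CompleteSpace H]
      (N₁ N₂ : H →L[ℂ] H), IsStarNormal N₁ → IsStarNormal N₂ →
      ‖cfc F N₁ - cfc F N₂‖ ≤ C * (σ * ‖F‖) * ‖N₁ - N₂‖ := by
  obtain ⟨b, c, ⟨hbc, hb⟩, ⟨hcc, hc⟩, hK⟩ := exists_kernelPair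
  refine ⟨2 * kernelConst (deriv (𝓕 b : 𝓢(ℝ, ℂ))) (𝓕 c : 𝓢(ℝ, ℂ)),
    by unfold kernelConst; positivity, ?_⟩
  intro F σ hσ hF H _ _ _ N₁ N₂ hN₁ hN₂
  have hb' := reproducing_fourier b hbc hb F.continuous F.norm_coe_le_norm hσ hF
  have hc' := reproducing_fourier c hcc hc F.continuous F.norm_coe_le_norm hσ hF
  have hsmul : ∀ {N : H →L[ℂ] H}, IsStarNormal N → IsStarNormal ((σ : ℂ) • N) := fun hN =>
    inferInstance
  have hg : Continuous (Function.uncurry fun x y : ℝ =>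
      F ((x / σ : ℝ) + (y / σ : ℝ) * Complex.I)) := by
    refine F.continuous.comp
      (f := fun p : ℝ × ℝ => ((p.1 / σ : ℝ) : ℂ) + (p.2 / σ : ℝ) * Complex.I) ?_
    fun_prop
  have key := norm_cfc_sub_cfc_le_of_reproducing hK hg (fun x y => F.norm_coe_le_norm _)
    hb'.1 hb'.2 hc'.1 hc'.2 (hsmul hN₁) (hsmul hN₂)
  have hcfc : ∀ {N : H →L[ℂ] H}, IsStarNormal N →
      cfc (fun z : ℂ => F ((z.re / σ : ℝ) + (z.im / σ : ℝ) * Complex.I)) ((σ : ℂ) • N)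
        = cfc F N := fun {N} hN => by
    rw [← cfc_comp_const_mul (σ : ℂ) _ N (by fun_prop) hN]
    congr 1 with z
    rw [Complex.re_ofReal_mul, Complex.im_ofReal_mul, mul_div_cancel_left₀ _ hσ.ne',
      mul_div_cancel_left₀ _ hσ.ne', Complex.re_add_im]
  rw [hcfc hN₁, hcfc hN₂, ← smul_sub, norm_smul, Complex.norm_real, Real.norm_of_nonneg hσ.le]
    at key
  refine key.trans (le_of_eq ?_)
  ring

end Besov

/-- Functions of class `B¹_{∞1}(ℝ²)` are operator Lipschitz on normal operators:
`‖f(N₁) - f(N₂)‖ ≤ C M ‖N₁ - N₂‖`. -/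
theorem besov_operator_lipschitz :
    ∃ C : ℝ, 0 < C ∧
      ∀ (f : ℂ → ℂ) (M : ℝ), HasLPDecompBesov1 f M →
      ∀ (H : Type*) [NormedAddCommGroup H] [InnerProductSpace ℂ H] [CompleteSpace H]
        (N₁ N₂ : H →L[ℂ] H), IsStarNormal N₁ → IsStarNormal N₂ →
        ‖cfc f N₁ - cfc f N₂‖ ≤ C * M * ‖N₁ - N₂‖ := by
  obtain ⟨C, hC, hbern⟩ := exists_bernstein_const
  refine ⟨2 * C + 1, by positivity, ?_⟩
  rintro f M ⟨F, hF, hlim, hsum, hle⟩ H _ _ _ N₁ N₂ hN₁ hN₂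
  have hnn : ∀ n : ℤ, 0 ≤ (2 : ℝ) ^ n * ‖F n‖ := fun n => by positivity
  have hM : 0 ≤ M := (tsum_nonneg hnn).trans hle
  have htend : ∀ N : H →L[ℂ] H, Tendsto
      (fun m : ℕ => ∑ n ∈ Finset.Icc (-(m : ℤ)) m, cfc (F n) N) atTop (nhds (cfc f N)) :=
    fun N => by
    refine (tendsto_cfc_fun (hlim _ (spectrum.isCompact N))
      (Eventually.of_forall fun m => by fun_prop)).congr fun m => ?_
    rw [← cfc_sum _ _ _ fun n _ => (F n).continuous.continuousOn]
    congr 1 with z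
    simp
  refine le_of_tendsto ((htend N₁).sub (htend N₂)).norm (Eventually.of_forall fun m => ?_)
  rw [← Finset.sum_sub_distrib]
  calc ‖∑ n ∈ Finset.Icc (-(m : ℤ)) m, (cfc (F n) N₁ - cfc (F n) N₂)‖
      ≤ ∑ n ∈ Finset.Icc (-(m : ℤ)) m, 2 * C * ‖N₁ - N₂‖ * ((2 : ℝ) ^ n * ‖F n‖) := by
        refine norm_sum_le_of_le _ fun n _ => ?_
        refine (hbern (F n) _ (by positivity) (hF n) H N₁ N₂ hN₁ hN₂).trans (le_of_eq ?_)
        rw [zpow_add_one₀ two_ne_zero]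
        ring
    _ ≤ 2 * C * ‖N₁ - N₂‖ * M := by
        rw [← Finset.mul_sum]
        exact mul_le_mul_of_nonneg_left ((hsum.sum_le_tsum _ fun n _ => hnn n).trans hle)
          (by positivity)
    _ ≤ (2 * C + 1) * M * ‖N₁ - N₂‖ := by nlinarith [mul_nonneg hM (norm_nonneg (N₁ - N₂))]
end

section
/- There exists an absolute constant C > 0 such that: if f : ℂ → ℂ admits a Littlewood–Paley decomposition with homogeneous Besov B¹_{∞1}(ℝ²)-norm at most M, and N₁, N₂ are bounded normal operators on a complex Hilbert space H with N₁ − N₂ of trace class S₁, then f(N₁) − f(N₂) belongs to S₁ and ‖f(N₁) − f(N₂)‖_{S₁} ≤ C · M · ‖N₁ − N₂‖_{S₁}. -/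
open MeasureTheory Filter
open scoped FourierTransform

/-- The `j`-th singular value (approximation number) of a bounded operator `T`. -/
noncomputable def sNum {H : Type*} [NormedAddCommGroup H] [InnerProductSpace ℂ H]
    (T : H →L[ℂ] H) (j : ℕ) : ℝ :=
  sInf {c : ℝ | ∃ R : H →L[ℂ] H, LinearMap.rank (R : H →ₗ[ℂ] H) ≤ j ∧ c = ‖T - R‖}

/-- `T` is of trace class `S₁`. -/
def MemTraceClass {H : Type*} [NormedAddCommGroup H] [InnerProductSpace ℂ H]
    (T : H →L[ℂ] H) : Prop :=
  Summable fun j : ℕ => sNum T j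

section TraceDuality

variable {H : Type*} [NormedAddCommGroup H] [InnerProductSpace ℂ H]

/-- A finite family of vectors satisfying Bessel's inequality. -/
def IsBesselSystem {n : ℕ} (x : Fin n → H) : Prop :=
  ∀ v : H, ∑ i, ‖inner ℂ (x i) v‖ ^ 2 ≤ ‖v‖ ^ 2

/-- `T` has dual trace norm at most `c`: its pairings with Bessel systems are bounded by `c`. -/
def DualTraceBound (T : H →L[ℂ] H) (c : ℝ) : Prop :=
  ∀ (n : ℕ) (x y : Fin n → H), IsBesselSystem x → IsBesselSystem y →
    ∑ i, ‖inner ℂ (y i) (T (x i))‖ ≤ c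

lemma IsBesselSystem.norm_le_one {n : ℕ} {x : Fin n → H} (hx : IsBesselSystem x) (i : Fin n) :
    ‖x i‖ ≤ 1 := by
  have h1 := (Finset.single_le_sum (f := fun j => ‖inner ℂ (x j) (x i)‖ ^ 2)
    (fun j _ => by positivity) (Finset.mem_univ i)).trans (hx (x i))
  have h2 : ‖inner ℂ (x i) (x i)‖ = ‖x i‖ ^ 2 := by
    rw [inner_self_eq_norm_sq_to_K]; simp
  simp only [h2] at h1
  by_contra! h
  nlinarith [mul_pos (show 0 < ‖x i‖ ^ 2 by positivity) (show 0 < ‖x i‖ ^ 2 - 1 by nlinarith)]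

lemma IsBesselSystem.sum_norm_inner_le {n : ℕ} {x y : Fin n → H} (hx : IsBesselSystem x)
    (hy : IsBesselSystem y) (T : H →L[ℂ] H) :
    ∑ i, ‖inner ℂ (y i) (T (x i))‖ ≤ n * ‖T‖ := by
  calc ∑ i, ‖inner ℂ (y i) (T (x i))‖ ≤ ∑ _i : Fin n, ‖T‖ := by
        refine Finset.sum_le_sum fun i _ => (norm_inner_le_norm _ _).trans ?_
        have h1 := hy.norm_le_one i
        have h2 := hx.norm_le_one i
        have h3 : ‖T (x i)‖ ≤ ‖T‖ * 1 := T.le_opNorm_of_le h2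
        nlinarith [norm_nonneg (y i), norm_nonneg (T (x i))]
    _ = n * ‖T‖ := by simp

lemma IsBesselSystem.sum_mul_le {n : ℕ} {x y : Fin n → H} (hx : IsBesselSystem x)
    (hy : IsBesselSystem y) (u v : H) :
    ∑ i, ‖inner ℂ (y i) u‖ * ‖inner ℂ (x i) v‖ ≤ ‖u‖ * ‖v‖ := by
  refine (Real.sum_mul_le_sqrt_mul_sqrt _ _ _).trans ?_
  have h1 := Real.sqrt_le_sqrt (hy u)
  have h2 := Real.sqrt_le_sqrt (hx v)
  rw [Real.sqrt_sq (norm_nonneg _)] at h1 h2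
  gcongr

lemma DualTraceBound.add {T S : H →L[ℂ] H} {a b : ℝ} (hT : DualTraceBound T a)
    (hS : DualTraceBound S b) : DualTraceBound (T + S) (a + b) := by
  intro n x y hx hy
  refine le_trans ?_ (add_le_add (hT n x y hx hy) (hS n x y hx hy))
  rw [← Finset.sum_add_distrib]
  refine Finset.sum_le_sum fun i _ => ?_
  rw [add_apply, inner_add_right]
  exact norm_add_le _ _

lemma DualTraceBound.mono {T : H →L[ℂ] H} {a b : ℝ} (hT : DualTraceBound T a) (h : a ≤ b) :
    DualTraceBound T b := fun n x y hx hy => (hT n x y hx hy).trans h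

lemma DualTraceBound.zero : DualTraceBound (0 : H →L[ℂ] H) 0 := by
  intro n x y _ _
  simp

lemma DualTraceBound.sum {ι : Type*} (s : Finset ι) {T : ι → H →L[ℂ] H} {a : ι → ℝ}
    (h : ∀ i ∈ s, DualTraceBound (T i) (a i)) :
    DualTraceBound (∑ i ∈ s, T i) (∑ i ∈ s, a i) := by
  classical
  induction s using Finset.induction_on with
  | empty => simpa using DualTraceBound.zero
  | insert i s hi ih =>
    rw [Finset.sum_insert hi, Finset.sum_insert hi]
    exact (h i (by simp)).add (ih fun j hj => h j (by simp [hj]))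

lemma DualTraceBound.of_approx {T : H →L[ℂ] H} {c : ℝ}
    (h : ∀ ε > 0, ∃ S : H →L[ℂ] H, ‖T - S‖ ≤ ε ∧ DualTraceBound S (c + ε)) :
    DualTraceBound T c := by
  intro n x y hx hy
  refine le_of_forall_pos_le_add fun ε hε => ?_
  obtain ⟨S, hS, hSc⟩ := h (ε / (n + 1)) (by positivity)
  have h1 := hSc n x y hx hy
  have h2 := hx.sum_norm_inner_le hy (T - S)
  have h3 : ∑ i, ‖inner ℂ (y i) (T (x i))‖ ≤
      ∑ i, (‖inner ℂ (y i) (S (x i))‖ + ‖inner ℂ (y i) ((T - S) (x i))‖) := by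
    refine Finset.sum_le_sum fun i _ => ?_
    rw [sub_apply, inner_sub_right]
    calc _ = ‖inner ℂ (y i) (S (x i)) + (inner ℂ (y i) (T (x i)) - inner ℂ (y i) (S (x i)))‖ := by
          congr 1; ring
      _ ≤ _ := norm_add_le _ _
  rw [Finset.sum_add_distrib] at h3
  have h4 : (n : ℝ) * ‖T - S‖ ≤ n * (ε / (n + 1)) := by gcongr
  have h5 : (n : ℝ) * (ε / (n + 1)) + ε / (n + 1) = ε := by field_simp
  linarith

lemma sNum_nonneg (T : H →L[ℂ] H) (j : ℕ) : 0 ≤ sNum T j :=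
  Real.sInf_nonneg (by rintro c ⟨R, -, rfl⟩; positivity)

lemma sNum_le {T R : H →L[ℂ] H} {j : ℕ} (hR : LinearMap.rank (R : H →ₗ[ℂ] H) ≤ j) :
    sNum T j ≤ ‖T - R‖ :=
  csInf_le ⟨0, by rintro c ⟨R, -, rfl⟩; positivity⟩ ⟨R, hR, rfl⟩

lemma exists_rank_le_norm_sub_lt (T : H →L[ℂ] H) (j : ℕ) {ε : ℝ} (hε : 0 < ε) :
    ∃ R : H →L[ℂ] H, LinearMap.rank (R : H →ₗ[ℂ] H) ≤ j ∧ ‖T - R‖ < sNum T j + ε := by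
  have hne : {c : ℝ | ∃ R : H →L[ℂ] H, LinearMap.rank (R : H →ₗ[ℂ] H) ≤ j ∧
      c = ‖T - R‖}.Nonempty := ⟨_, 0, by simp, rfl⟩
  obtain ⟨c, ⟨R, hR, rfl⟩, hc⟩ := exists_lt_of_csInf_lt hne (lt_add_of_pos_right (sNum T j) hε)
  exact ⟨R, hR, hc⟩

lemma sNum_zero_le (T : H →L[ℂ] H) : sNum T 0 ≤ ‖T‖ := by
  simpa using sNum_le (T := T) (R := 0) (j := 0) (by simp)

lemma norm_le_sNum_zero (T : H →L[ℂ] H) : ‖T‖ ≤ sNum T 0 := by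
  refine le_of_forall_pos_le_add fun ε hε => ?_
  obtain ⟨R, hR, h⟩ := exists_rank_le_norm_sub_lt T 0 hε
  have : (R : H →ₗ[ℂ] H) = 0 := by
    have h0 : Module.rank ℂ (LinearMap.range (R : H →ₗ[ℂ] H)) = 0 :=
      le_antisymm (by simpa using hR) (zero_le)
    rwa [Submodule.rank_eq_zero, LinearMap.range_eq_bot] at h0
  have hR0 : R = 0 := by ext x; simpa using congrArg (fun L : H →ₗ[ℂ] H => L x) this
  simpa [hR0] using h.le

lemma sNum_antitone (T : H →L[ℂ] H) : Antitone (sNum T) := by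
  intro i j hij
  refine le_of_forall_pos_le_add fun ε hε => ?_
  obtain ⟨R, hR, h⟩ := exists_rank_le_norm_sub_lt T i hε
  exact (sNum_le (hR.trans (by exact_mod_cast hij))).trans h.le

lemma sNum_add_le {T S : H →L[ℂ] H} {r : ℕ}
    (h : LinearMap.rank ((T - S : H →L[ℂ] H) : H →ₗ[ℂ] H) ≤ r) (j : ℕ) :
    sNum T (j + r) ≤ sNum S j := by
  refine le_of_forall_pos_le_add fun ε hε => ?_
  obtain ⟨R, hR, h'⟩ := exists_rank_le_norm_sub_lt S j hε
  have : LinearMap.rank ((R + (T - S) : H →L[ℂ] H) : H →ₗ[ℂ] H) ≤ ((j + r : ℕ) : Cardinal) := by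
    rw [ContinuousLinearMap.toLinearMap_add, Nat.cast_add]
    exact (LinearMap.rank_add_le _ _).trans (add_le_add hR h)
  have h2 := sNum_le (T := T) this
  rw [show T - (R + (T - S)) = S - R by abel] at h2
  linarith

end TraceDuality

section TraceNorm

open InnerProductSpace

variable {H : Type*} [NormedAddCommGroup H] [InnerProductSpace ℂ H]

lemma rank_rankOne_le (x y : H) :
    LinearMap.rank ((rankOne ℂ x y : H →L[ℂ] H) : H →ₗ[ℂ] H) ≤ 1 := by
  have h : LinearMap.range ((rankOne ℂ x y : H →L[ℂ] H) : H →ₗ[ℂ] H) ≤ Submodule.span ℂ {x} := by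
    rintro _ ⟨v, rfl⟩
    simp only [ContinuousLinearMap.coe_coe, rankOne_apply]
    exact Submodule.smul_mem _ _ (Submodule.mem_span_singleton_self x)
  refine (Submodule.rank_mono h).trans ((rank_span_le _).trans ?_)
  simp

lemma rank_sub_compression_le (T : H →L[ℂ] H) (x y : H) :
    LinearMap.rank ((T - (1 - rankOne ℂ y y) * T * (1 - rankOne ℂ x x) : H →L[ℂ] H) :
      H →ₗ[ℂ] H) ≤ ((2 : ℕ) : Cardinal) := by
  have h : T - (1 - rankOne ℂ y y) * T * (1 - rankOne ℂ x x) =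
      rankOne ℂ y y * (T * (1 - rankOne ℂ x x)) + T * rankOne ℂ x x := by noncomm_ring
  rw [h, ContinuousLinearMap.toLinearMap_add]
  refine (LinearMap.rank_add_le _ _).trans ?_
  rw [show ((2 : ℕ) : Cardinal) = 1 + 1 by norm_num]
  refine add_le_add ?_ ?_
  · exact (LinearMap.rank_comp_le_left _ _).trans (rank_rankOne_le y y)
  · exact (LinearMap.rank_comp_le_right _ _).trans (rank_rankOne_le x x)

lemma norm_sub_rankOne_sq (x v : H) (hx : ‖x‖ = 1 ∨ x = 0) :
    ‖(1 - rankOne ℂ x x : H →L[ℂ] H) v‖ ^ 2 + ‖inner ℂ x v‖ ^ 2 = ‖v‖ ^ 2 := by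
  rcases hx with hx | rfl
  · simp only [sub_apply, one_apply_eq_self, rankOne_apply]
    rw [@norm_sub_sq ℂ, inner_smul_right, norm_smul, hx, ← inner_conj_symm v x, RCLike.mul_conj]
    norm_cast
    ring
  · simp

lemma inner_sub_rankOne_left (x u v : H) :
    inner ℂ ((1 - rankOne ℂ x x : H →L[ℂ] H) u) v =
      inner ℂ u ((1 - rankOne ℂ x x : H →L[ℂ] H) v) := by
  simp only [sub_apply, one_apply_eq_self, rankOne_apply, inner_sub_left,
    inner_sub_right, inner_smul_left, inner_smul_right, inner_conj_symm]
  ring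

lemma IsBesselSystem.cons {n : ℕ} {x : Fin n → H} (hx : IsBesselSystem x) {e : H}
    (he : ‖e‖ = 1 ∨ e = 0) :
    IsBesselSystem (Fin.cons e fun i => (1 - rankOne ℂ e e : H →L[ℂ] H) (x i) :
      Fin (n + 1) → H) := by
  intro v
  rw [Fin.sum_univ_succ]
  simp only [Fin.cons_zero, Fin.cons_succ, inner_sub_rankOne_left]
  have := hx ((1 - rankOne ℂ e e : H →L[ℂ] H) v)
  have := norm_sub_rankOne_sq e v he
  linarith

lemma exists_norm_le_two_mul_inner (T : H →L[ℂ] H) :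
    ∃ x y : H, (‖x‖ = 1 ∨ x = 0) ∧ (‖y‖ = 1 ∨ y = 0) ∧ ‖T‖ ≤ 2 * ‖inner ℂ y (T x)‖ := by
  rcases eq_or_ne T 0 with rfl | hT
  · exact ⟨0, 0, by simp, by simp, by simp⟩
  have hpos : 0 < ‖T‖ := norm_pos_iff.mpr hT
  obtain ⟨x, hx⟩ : ∃ x, ‖T‖ / 2 * ‖x‖ < ‖T x‖ := by
    by_contra! h
    have := T.opNorm_le_bound (by positivity) h
    linarith
  have hTx : 0 < ‖T x‖ := lt_of_le_of_lt (by positivity) hx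
  have hxpos : 0 < ‖x‖ := by
    rw [norm_pos_iff]; rintro rfl; simp at hTx
  refine ⟨((‖x‖⁻¹ : ℝ) : ℂ) • x, ((‖T x‖⁻¹ : ℝ) : ℂ) • T x, Or.inl ?_, Or.inl ?_, ?_⟩
  · rw [norm_smul]; simp [hxpos.ne']
  · rw [norm_smul]; simp [hTx.ne']
  · rw [map_smul, inner_smul_left, inner_smul_right, inner_self_eq_norm_sq_to_K]
    simp only [norm_mul, RCLike.norm_conj, Complex.norm_real, norm_inv, norm_norm,
      Complex.coe_algebraMap, norm_pow]
    rw [show 2 * (‖T x‖⁻¹ * (‖x‖⁻¹ * ‖T x‖ ^ 2)) = 2 * ‖T x‖ / ‖x‖ by field_simp,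
      le_div_iff₀ hxpos]
    linarith

lemma DualTraceBound.sum_sNum_two_mul_le (n : ℕ) : ∀ {T : H →L[ℂ] H} {c : ℝ},
    DualTraceBound T c → ∑ k ∈ Finset.range n, sNum T (2 * k) ≤ 2 * c := by
  induction n with
  | zero =>
    intro T c h
    have := h 0 Fin.elim0 Fin.elim0 (fun v => by simp) (fun v => by simp)
    simp at this ⊢
    exact this
  | succ n ih =>
    intro T c h
    obtain ⟨x, y, hx, hy, hT⟩ := exists_norm_le_two_mul_inner T
    have hS : DualTraceBound ((1 - rankOne ℂ y y) * T * (1 - rankOne ℂ x x))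
        (c - ‖inner ℂ y (T x)‖) := by
      intro m x' y' hx' hy'
      have h1 := h _ _ _ (hx'.cons hx) (hy'.cons hy)
      rw [Fin.sum_univ_succ] at h1
      simp only [Fin.cons_zero, Fin.cons_succ, inner_sub_rankOne_left] at h1
      simp only [ContinuousLinearMap.mul_def, ContinuousLinearMap.comp_apply] at h1 ⊢
      linarith
    have h2 := ih hS
    rw [Finset.sum_range_succ']
    have h3 : ∑ k ∈ Finset.range n, sNum T (2 * (k + 1)) ≤ ∑ k ∈ Finset.range n,
        sNum ((1 - rankOne ℂ y y) * T * (1 - rankOne ℂ x x)) (2 * k) :=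
      Finset.sum_le_sum fun k _ => sNum_add_le (rank_sub_compression_le T x y) (2 * k)
    have h4 := sNum_zero_le T
    simp only [mul_zero]
    linarith

lemma DualTraceBound.memTraceClass {T : H →L[ℂ] H} {c : ℝ} (h : DualTraceBound T c) :
    MemTraceClass T ∧ ∑' j, sNum T j ≤ 4 * c := by
  have key : ∀ n, ∑ j ∈ Finset.range n, sNum T j ≤ 4 * c := by
    intro n
    have h1 : ∀ n, ∑ j ∈ Finset.range (2 * n), sNum T j ≤
        2 * ∑ k ∈ Finset.range n, sNum T (2 * k) := by
      intro n
      induction n with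
      | zero => simp
      | succ n ih =>
        rw [show 2 * (n + 1) = 2 * n + 1 + 1 by ring, Finset.sum_range_succ,
          Finset.sum_range_succ, Finset.sum_range_succ _ n]
        have := sNum_antitone T (show 2 * n ≤ 2 * n + 1 by omega)
        linarith
    calc ∑ j ∈ Finset.range n, sNum T j ≤ ∑ j ∈ Finset.range (2 * n), sNum T j :=
          Finset.sum_le_sum_of_subset_of_nonneg (by simp; omega)
            fun _ _ _ => sNum_nonneg T _
      _ ≤ _ := by linarith [h1 n, h.sum_sNum_two_mul_le n]
  have hs : Summable fun j => sNum T j := summable_of_sum_range_le (sNum_nonneg T) key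
  exact ⟨hs, hs.tsum_le_of_sum_range_le key⟩

end TraceNorm

section Nuclear

open InnerProductSpace

variable {H : Type*} [NormedAddCommGroup H] [InnerProductSpace ℂ H]

/-- `R` is a finite sum of rank one operators with norms adding up to at most `c`. -/
def FinNuclear (R : H →L[ℂ] H) (c : ℝ) : Prop :=
  ∃ (ι : Type) (_ : Fintype ι) (u v : ι → H),
    R = ∑ j, rankOne ℂ (u j) (v j) ∧ ∑ j, ‖u j‖ * ‖v j‖ ≤ c

/-- `K` is an operator-norm limit of finite-rank operators of nuclear norm close to `c`. -/
def NuclearBound (K : H →L[ℂ] H) (c : ℝ) : Prop :=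
  ∀ ε > 0, ∃ R : H →L[ℂ] H, ‖K - R‖ ≤ ε ∧ FinNuclear R (c + ε)

lemma FinNuclear.mono {R : H →L[ℂ] H} {a b : ℝ} (h : FinNuclear R a) (hab : a ≤ b) :
    FinNuclear R b := by
  obtain ⟨ι, _, u, v, h1, h2⟩ := h
  exact ⟨ι, inferInstance, u, v, h1, h2.trans hab⟩

lemma FinNuclear.add {R S : H →L[ℂ] H} {a b : ℝ} (hR : FinNuclear R a) (hS : FinNuclear S b) :
    FinNuclear (R + S) (a + b) := by
  obtain ⟨ι, _, u, v, h1, h2⟩ := hR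
  obtain ⟨κ, _, u', v', h1', h2'⟩ := hS
  refine ⟨ι ⊕ κ, inferInstance, Sum.elim u u', Sum.elim v v', ?_, ?_⟩
  · simp [h1, h1']
  · simpa using add_le_add h2 h2'

lemma FinNuclear.smul {R : H →L[ℂ] H} {a : ℝ} (hR : FinNuclear R a) (z : ℂ) :
    FinNuclear (z • R) (‖z‖ * a) := by
  obtain ⟨ι, _, u, v, h1, h2⟩ := hR
  refine ⟨ι, inferInstance, fun j => z • u j, v, ?_, ?_⟩
  · simp [h1, Finset.smul_sum]
  · simp only [norm_smul, mul_assoc, ← Finset.mul_sum]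
    gcongr

lemma NuclearBound.add {R S : H →L[ℂ] H} {a b : ℝ} (hR : NuclearBound R a)
    (hS : NuclearBound S b) : NuclearBound (R + S) (a + b) := by
  intro ε hε
  obtain ⟨R', h1, h2⟩ := hR (ε / 2) (by positivity)
  obtain ⟨S', h1', h2'⟩ := hS (ε / 2) (by positivity)
  refine ⟨R' + S', ?_, (h2.add h2').mono (by linarith)⟩
  rw [add_sub_add_comm]
  exact (norm_add_le _ _).trans (by linarith)

lemma NuclearBound.smul {R : H →L[ℂ] H} {a : ℝ} (hR : NuclearBound R a) (z : ℂ) :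
    NuclearBound (z • R) (‖z‖ * a) := by
  intro ε hε
  obtain ⟨R', h1, h2⟩ := hR (ε / (‖z‖ + 1)) (by positivity)
  have h3 : ‖z‖ * (ε / (‖z‖ + 1)) ≤ ε := by
    rw [mul_div_assoc', div_le_iff₀ (by positivity)]
    nlinarith
  refine ⟨z • R', ?_, (h2.smul z).mono (by linarith)⟩
  rw [← smul_sub, norm_smul]
  refine le_trans ?_ h3
  gcongr

variable [CompleteSpace H]

lemma finNuclear_star {R : H →L[ℂ] H} {a : ℝ} (hR : FinNuclear R a) : FinNuclear (star R) a := by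
  obtain ⟨ι, _, u, v, h1, h2⟩ := hR
  refine ⟨ι, inferInstance, v, u, ?_, by simpa only [mul_comm] using h2⟩
  rw [h1, star_sum]
  refine Finset.sum_congr rfl fun j _ => ?_
  rw [ContinuousLinearMap.star_eq_adjoint, adjoint_rankOne]

lemma nuclearBound_star {R : H →L[ℂ] H} {a : ℝ} (hR : NuclearBound R a) :
    NuclearBound (star R) a := by
  intro ε hε
  obtain ⟨R', h1, h2⟩ := hR ε hε
  exact ⟨star R', by rwa [← star_sub, norm_star], finNuclear_star h2⟩

lemma finNuclear_of_rank_le {R : H →L[ℂ] H} {r : ℕ}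
    (h : LinearMap.rank (R : H →ₗ[ℂ] H) ≤ r) : FinNuclear R (r * ‖R‖) := by
  have hfin : FiniteDimensional ℂ (LinearMap.range (R : H →ₗ[ℂ] H)) :=
    Module.rank_lt_aleph0_iff.mp (lt_of_le_of_lt h Cardinal.natCast_lt_aleph0)
  set W := LinearMap.range (R : H →ₗ[ℂ] H)
  have hr : Module.finrank ℂ W ≤ r := Module.finrank_le_of_rank_le h
  set e := stdOrthonormalBasis ℂ W
  refine ⟨Fin (Module.finrank ℂ W), inferInstance, fun i => (e i : H),
    fun i => ContinuousLinearMap.adjoint R (e i : H), ?_, ?_⟩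
  · ext x
    have h1 := congrArg (fun w : W => (w : H)) (e.sum_repr' ⟨R x, ⟨x, rfl⟩⟩)
    simp only [Submodule.coe_sum, Submodule.coe_smul, Submodule.coe_inner] at h1
    simp only [sum_apply, rankOne_apply, ContinuousLinearMap.adjoint_inner_left]
    exact h1.symm
  · calc ∑ i, ‖(e i : H)‖ * ‖ContinuousLinearMap.adjoint R (e i : H)‖
        ≤ ∑ _i : Fin (Module.finrank ℂ W), ‖R‖ := by
          refine Finset.sum_le_sum fun i _ => ?_
          have h1 : ‖(e i : H)‖ = 1 := e.norm_eq_one i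
          have h2 := (ContinuousLinearMap.adjoint R).le_opNorm (e i : H)
          rw [LinearIsometryEquiv.norm_map, h1] at h2
          rw [h1]; linarith
      _ ≤ r * ‖R‖ := by
          simp only [Finset.sum_const, Finset.card_univ, Fintype.card_fin, nsmul_eq_mul]
          gcongr

lemma MemTraceClass.nuclearBound {K : H →L[ℂ] H} (h : MemTraceClass K) :
    NuclearBound K (14 * ∑' j, sNum K j) := by
  intro ε hε
  set S := ∑' j, sNum K j with hS
  set η : ℕ → ℝ := fun k => ε / 13 * (1 / 4) ^ k with hη
  have hηpos : ∀ k, 0 < η k := fun k => by positivity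
  have hsumle : ∀ s : Finset ℕ, ∑ j ∈ s, sNum K j ≤ S := fun s =>
    h.sum_le_tsum s fun j _ => sNum_nonneg K j
  choose R hRrank hRnorm using fun k : ℕ => exists_rank_le_norm_sub_lt K (2 ^ k) (hηpos k)
  have hind : ∀ n, FinNuclear (R n) (sNum K 0 + sNum K 1 + η 0 +
      ∑ k ∈ Finset.range n, 3 * 2 ^ k * (2 * sNum K (2 ^ k) + 2 * η k)) := by
    intro n
    induction n with
    | zero =>
      refine (finNuclear_of_rank_le (hRrank 0)).mono ?_
      have h1 := norm_le_sNum_zero K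
      have h2 := hRnorm 0
      have h3 := norm_sub_norm_le (R 0) K
      rw [norm_sub_rev] at h3
      simp only [pow_zero] at h2 ⊢
      simp only [Nat.cast_one, one_mul, Finset.range_zero, Finset.sum_empty, add_zero]
      linarith
    | succ n ih =>
      have hrk : LinearMap.rank ((R (n + 1) - R n : H →L[ℂ] H) : H →ₗ[ℂ] H) ≤
          ((3 * 2 ^ n : ℕ) : Cardinal) := by
        have e : (R (n + 1) - R n : H →L[ℂ] H) = R (n + 1) + (-1 : H →L[ℂ] H) * R n := by
          rw [neg_one_mul]; abel
        rw [e, ContinuousLinearMap.toLinearMap_add, show 3 * 2 ^ n = 2 ^ (n + 1) + 2 ^ n by ring,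
          Nat.cast_add]
        exact (LinearMap.rank_add_le _ _).trans (add_le_add (hRrank (n + 1))
          ((LinearMap.rank_comp_le_right _ _).trans (hRrank n)))
      have h1 := (ih.add (finNuclear_of_rank_le hrk))
      rw [add_sub_cancel] at h1
      refine h1.mono ?_
      rw [Finset.sum_range_succ, ← add_assoc]
      have h2 : ‖R (n + 1) - R n‖ ≤ 2 * sNum K (2 ^ n) + 2 * η n := by
        have h3 := norm_sub_le_norm_sub_add_norm_sub (R (n + 1)) K (R n)
        rw [norm_sub_rev (R (n + 1)) K] at h3
        have h4 := hRnorm n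
        have h5 := hRnorm (n + 1)
        have h6 := sNum_antitone K (Nat.pow_le_pow_right (show 0 < 2 by norm_num) n.le_succ)
        have h7 : η (n + 1) ≤ η n := by
          simp only [hη, pow_succ]
          have : (0 : ℝ) < ε / 13 * (1 / 4) ^ n := by positivity
          linarith
        simp only [Nat.succ_eq_add_one] at h6
        linarith
      push_cast
      gcongr
  have htend : Filter.Tendsto (fun n : ℕ => sNum K (2 ^ n)) Filter.atTop (nhds 0) :=
    h.tendsto_atTop_zero.comp (tendsto_pow_atTop_atTop_of_one_lt (by norm_num))
  obtain ⟨n, hn⟩ := (htend.eventually (ge_mem_nhds (show (0 : ℝ) < ε / 2 by positivity))).exists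
  refine ⟨R n, ?_, (hind n).mono ?_⟩
  · have h1 : η n ≤ ε / 13 := by
      have : ((1 : ℝ) / 4) ^ n ≤ 1 := pow_le_one₀ (by norm_num) (by norm_num)
      simp only [hη]
      nlinarith
    linarith [hRnorm n]
  · have h1 : ∑ k ∈ Finset.range n, 3 * 2 ^ k * (2 * sNum K (2 ^ k) + 2 * η k) =
        6 * ∑ k ∈ Finset.range n, 2 ^ k * sNum K (2 ^ k) +
          6 * ∑ k ∈ Finset.range n, 2 ^ k * η k := by
      rw [Finset.mul_sum, Finset.mul_sum, ← Finset.sum_add_distrib]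
      exact Finset.sum_congr rfl fun k _ => by ring
    have h2 : ∑ k ∈ Finset.range n, 2 ^ k * sNum K (2 ^ k) ≤ 2 * S := by
      have h3 := Finset.sum_condensed_le (f := sNum K) (fun a b _ hab => sNum_antitone K hab) n
      simp only [nsmul_eq_mul, Nat.cast_pow, Nat.cast_ofNat] at h3
      rw [Finset.sum_range_succ] at h3
      have h4 : 0 ≤ (2 : ℝ) ^ n * sNum K (2 ^ n) := mul_nonneg (by positivity) (sNum_nonneg K _)
      have h5 := hsumle (insert 1 (Finset.Ico 2 (2 ^ n + 1)))
      rw [Finset.sum_insert (by simp)] at h5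
      have h6 := sNum_nonneg K 1
      linarith
    have h3 : ∑ k ∈ Finset.range n, 2 ^ k * η k ≤ ε / 13 * 2 := by
      have : ∀ k ∈ Finset.range n, 2 ^ k * η k = ε / 13 * (1 / 2 : ℝ) ^ k := by
        intro k _
        simp only [hη]
        rw [mul_left_comm, ← mul_pow]
        norm_num
      rw [Finset.sum_congr rfl this, ← Finset.mul_sum]
      gcongr
      exact sum_geometric_two_le n
    have h4 := hsumle {0, 1}
    rw [Finset.sum_pair (by norm_num)] at h4
    have h5 : η 0 = ε / 13 := by simp [hη]
    have h6 : 0 ≤ sNum K 0 + sNum K 1 := add_nonneg (sNum_nonneg K 0) (sNum_nonneg K 1)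
    rw [h1, h5]
    linarith

end Nuclear

section Schur

open InnerProductSpace

lemma exists_finite_coordinates {𝓛 ι κ : Type*} [NormedAddCommGroup 𝓛] [InnerProductSpace ℂ 𝓛]
    [Finite ι] [Finite κ] (α : ι → 𝓛) (β : κ → 𝓛) :
    ∃ (d : ℕ) (a : ι → Fin d → ℂ) (b : κ → Fin d → ℂ),
      (∀ k l, inner ℂ (α k) (β l) = ∑ m, star (a k m) * b l m) ∧
      (∀ k, ∑ m, ‖a k m‖ ^ 2 = ‖α k‖ ^ 2) ∧ ∀ l, ∑ m, ‖b l m‖ ^ 2 = ‖β l‖ ^ 2 := by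
  set W := Submodule.span ℂ (Set.range α ∪ Set.range β)
  have : FiniteDimensional ℂ W :=
    FiniteDimensional.span_of_finite ℂ ((Set.finite_range α).union (Set.finite_range β))
  have hα : ∀ k, α k ∈ W := fun k => Submodule.subset_span (Or.inl ⟨k, rfl⟩)
  have hβ : ∀ l, β l ∈ W := fun l => Submodule.subset_span (Or.inr ⟨l, rfl⟩)
  set e := stdOrthonormalBasis ℂ W
  refine ⟨_, fun k m => inner ℂ (e m) (⟨α k, hα k⟩ : W),
    fun l m => inner ℂ (e m) (⟨β l, hβ l⟩ : W), ?_, ?_, ?_⟩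
  · intro k l
    have h := e.sum_inner_mul_inner (⟨α k, hα k⟩ : W) ⟨β l, hβ l⟩
    rw [Submodule.coe_inner] at h
    rw [← h]
    refine Finset.sum_congr rfl fun m _ => ?_
    rw [← inner_conj_symm]
    rfl
  · exact fun k => e.sum_sq_norm_inner_right ⟨α k, hα k⟩
  · exact fun l => e.sum_sq_norm_inner_right ⟨β l, hβ l⟩

variable {H : Type*} [NormedAddCommGroup H] [InnerProductSpace ℂ H] [CompleteSpace H]

lemma norm_sum_smul_star_mul_sq_le {ι : Type*} [Fintype ι] {E D : ι → H →L[ℂ] H}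
    (hE : ∀ u, ∑ k, ‖E k u‖ ^ 2 ≤ ‖u‖ ^ 2) (a : ι → ℂ) (u : H) :
    ‖(∑ k, a k • (star (E k) * D k)) u‖ ^ 2 ≤ ∑ k, ‖a k‖ ^ 2 * ‖D k u‖ ^ 2 := by
  set w := (∑ k, a k • (star (E k) * D k)) u with hw
  have h1 : ‖w‖ ^ 2 ≤ ∑ k, (‖a k‖ * ‖D k u‖) * ‖E k w‖ := by
    have h2 : inner ℂ w w = ∑ k, a k * inner ℂ (E k w) (D k u) := by
      nth_rewrite 2 [hw]
      rw [sum_apply, inner_sum]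
      refine Finset.sum_congr rfl fun k _ => ?_
      rw [smul_apply, inner_smul_right, ContinuousLinearMap.mul_def,
        ContinuousLinearMap.comp_apply, ContinuousLinearMap.star_eq_adjoint,
        ContinuousLinearMap.adjoint_inner_right]
    have h3 : ‖w‖ ^ 2 = ‖(inner ℂ w w : ℂ)‖ := by
      rw [inner_self_eq_norm_sq_to_K]; simp
    rw [h3, h2]
    refine (norm_sum_le _ _).trans (Finset.sum_le_sum fun k _ => ?_)
    rw [norm_mul, mul_assoc, mul_comm ‖D k u‖]
    gcongr
    exact norm_inner_le_norm _ _
  have h4 := Finset.sum_mul_sq_le_sq_mul_sq Finset.univ (fun k => ‖a k‖ * ‖D k u‖)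
    (fun k => ‖E k w‖)
  simp only [mul_pow] at h4
  have h5 : 0 ≤ ∑ k, ‖a k‖ ^ 2 * ‖D k u‖ ^ 2 := by positivity
  have h6 : (‖w‖ ^ 2) ^ 2 ≤ (∑ k, ‖a k‖ ^ 2 * ‖D k u‖ ^ 2) * ‖w‖ ^ 2 :=
    (pow_le_pow_left₀ (by positivity) h1 2).trans
      (h4.trans (mul_le_mul_of_nonneg_left (hE w) h5))
  rcases (sq_nonneg ‖w‖).eq_or_lt with h | h
  · rw [← h]; exact h5
  · rw [sq (‖w‖ ^ 2)] at h6
    exact le_of_mul_le_mul_right h6 h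

lemma sum_norm_sum_smul_star_mul_sq_le {ι : Type*} [Fintype ι] {d : ℕ} {E D : ι → H →L[ℂ] H}
    {A c : ℝ} (hE : ∀ u, ∑ k, ‖E k u‖ ^ 2 ≤ ‖u‖ ^ 2)
    (hD : ∀ u, ∑ k, ‖D k u‖ ^ 2 ≤ c ^ 2 * ‖u‖ ^ 2) {a : ι → Fin d → ℂ}
    (ha : ∀ k, ∑ m, ‖a k m‖ ^ 2 ≤ A ^ 2) (u : H) :
    ∑ m, ‖(∑ k, a k m • (star (E k) * D k)) u‖ ^ 2 ≤ (A * c) ^ 2 * ‖u‖ ^ 2 := by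
  calc _ ≤ ∑ m, ∑ k, ‖a k m‖ ^ 2 * ‖D k u‖ ^ 2 :=
        Finset.sum_le_sum fun m _ => norm_sum_smul_star_mul_sq_le hE _ u
    _ = ∑ k, (∑ m, ‖a k m‖ ^ 2) * ‖D k u‖ ^ 2 := by
        rw [Finset.sum_comm]; simp only [Finset.sum_mul]
    _ ≤ ∑ k, A ^ 2 * ‖D k u‖ ^ 2 := by
        gcongr with k; exact ha k
    _ ≤ _ := by
        rw [← Finset.mul_sum, mul_pow, mul_assoc]
        gcongr
        exact hD u

lemma norm_sum_star_mul_mul_le {d : ℕ} {A B : Fin d → H →L[ℂ] H} {a b : ℝ} (ha : 0 ≤ a)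
    (hb : 0 ≤ b) (hA : ∀ u, ∑ m, ‖A m u‖ ^ 2 ≤ a ^ 2 * ‖u‖ ^ 2)
    (hB : ∀ u, ∑ m, ‖B m u‖ ^ 2 ≤ b ^ 2 * ‖u‖ ^ 2) (K : H →L[ℂ] H) :
    ‖∑ m, star (A m) * (K * B m)‖ ≤ a * b * ‖K‖ := by
  refine ContinuousLinearMap.opNorm_le_bound _ (by positivity) fun u => ?_
  set w := (∑ m, star (A m) * (K * B m)) u with hw
  have h1 : ‖w‖ ^ 2 ≤ ‖K‖ * ∑ m, ‖A m w‖ * ‖B m u‖ := by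
    have h2 : inner ℂ w w = ∑ m, inner ℂ (A m w) (K (B m u)) := by
      nth_rewrite 2 [hw]
      rw [sum_apply, inner_sum]
      refine Finset.sum_congr rfl fun k _ => ?_
      rw [ContinuousLinearMap.mul_def,
        ContinuousLinearMap.comp_apply, ContinuousLinearMap.star_eq_adjoint,
        ContinuousLinearMap.adjoint_inner_right, ContinuousLinearMap.mul_def,
        ContinuousLinearMap.comp_apply]
    have h3 : ‖w‖ ^ 2 = ‖(inner ℂ w w : ℂ)‖ := by
      rw [inner_self_eq_norm_sq_to_K]; simp
    rw [h3, h2, Finset.mul_sum]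
    refine (norm_sum_le _ _).trans (Finset.sum_le_sum fun k _ => ?_)
    refine (norm_inner_le_norm _ _).trans ?_
    have := K.le_opNorm (B k u)
    calc _ ≤ ‖A k w‖ * (‖K‖ * ‖B k u‖) := by gcongr
      _ = _ := by ring
  have h4 : ∑ m, ‖A m w‖ * ‖B m u‖ ≤ (a * ‖w‖) * (b * ‖u‖) := by
    refine (Real.sum_mul_le_sqrt_mul_sqrt _ _ _).trans ?_
    have h5 := Real.sqrt_le_sqrt (hA w)
    have h6 := Real.sqrt_le_sqrt (hB u)
    rw [← mul_pow, Real.sqrt_sq (by positivity)] at h5 h6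
    gcongr
  rcases (norm_nonneg w).eq_or_lt with h | h
  · rw [← h]; positivity
  · have h7 : ‖w‖ * ‖w‖ ≤ (a * b * ‖K‖ * ‖u‖) * ‖w‖ := by
      calc ‖w‖ * ‖w‖ = ‖w‖ ^ 2 := by ring
        _ ≤ ‖K‖ * ((a * ‖w‖) * (b * ‖u‖)) := h1.trans (by gcongr)
        _ = _ := by ring
    exact le_of_mul_le_mul_right h7 h

lemma FinNuclear.dualTraceBound_sum {d : ℕ} {A B : Fin d → H →L[ℂ] H} {a b : ℝ} (ha : 0 ≤ a)
    (hb : 0 ≤ b) (hA : ∀ u, ∑ m, ‖star (A m) u‖ ^ 2 ≤ a ^ 2 * ‖u‖ ^ 2)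
    (hB : ∀ u, ∑ m, ‖star (B m) u‖ ^ 2 ≤ b ^ 2 * ‖u‖ ^ 2) {K : H →L[ℂ] H} {c : ℝ}
    (hK : FinNuclear K c) : DualTraceBound (∑ m, star (A m) * (K * B m)) (a * b * c) := by
  obtain ⟨ι, _, u, v, rfl, huv⟩ := hK
  intro n x y hx hy
  have h1 : ∀ i, ‖inner ℂ (y i) ((∑ m, star (A m) * ((∑ j, rankOne ℂ (u j) (v j)) * B m)) (x i))‖ ≤
      ∑ j, ∑ m, ‖inner ℂ (y i) (star (A m) (u j))‖ * ‖inner ℂ (x i) (star (B m) (v j))‖ := by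
    intro i
    rw [sum_apply, inner_sum, Finset.sum_comm]
    refine (norm_sum_le _ _).trans (Finset.sum_le_sum fun m _ => ?_)
    simp only [ContinuousLinearMap.mul_def, ContinuousLinearMap.comp_apply, sum_apply,
      rankOne_apply, map_sum, map_smul, inner_sum, inner_smul_right]
    refine (norm_sum_le _ _).trans (Finset.sum_le_sum fun j _ => le_of_eq ?_)
    rw [norm_mul, mul_comm, ContinuousLinearMap.star_eq_adjoint (B m),
      ContinuousLinearMap.adjoint_inner_right, norm_inner_symm (v j)]
  calc _ ≤ ∑ i, ∑ j, ∑ m,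
        ‖inner ℂ (y i) (star (A m) (u j))‖ * ‖inner ℂ (x i) (star (B m) (v j))‖ :=
        Finset.sum_le_sum fun i _ => h1 i
    _ = ∑ j, ∑ m, ∑ i,
        ‖inner ℂ (y i) (star (A m) (u j))‖ * ‖inner ℂ (x i) (star (B m) (v j))‖ := by
        rw [Finset.sum_comm]
        exact Finset.sum_congr rfl fun j _ => Finset.sum_comm
    _ ≤ ∑ j, ∑ m, ‖star (A m) (u j)‖ * ‖star (B m) (v j)‖ := by
        gcongr with j _ m _
        exact hx.sum_mul_le hy _ _
    _ ≤ ∑ j, (a * ‖u j‖) * (b * ‖v j‖) := by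
        refine Finset.sum_le_sum fun j _ => (Real.sum_mul_le_sqrt_mul_sqrt _ _ _).trans ?_
        have h5 := Real.sqrt_le_sqrt (hA (u j))
        have h6 := Real.sqrt_le_sqrt (hB (v j))
        rw [← mul_pow, Real.sqrt_sq (by positivity)] at h5 h6
        gcongr
    _ = a * b * ∑ j, ‖u j‖ * ‖v j‖ := by
        rw [Finset.mul_sum]
        exact Finset.sum_congr rfl fun j _ => by ring
    _ ≤ _ := by gcongr

lemma NuclearBound.dualTraceBound_sum {d : ℕ} {A B : Fin d → H →L[ℂ] H} {a b : ℝ} (ha : 0 ≤ a)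
    (hb : 0 ≤ b) (hA : ∀ u, ∑ m, ‖A m u‖ ^ 2 ≤ a ^ 2 * ‖u‖ ^ 2)
    (hB : ∀ u, ∑ m, ‖B m u‖ ^ 2 ≤ b ^ 2 * ‖u‖ ^ 2)
    (hA' : ∀ u, ∑ m, ‖star (A m) u‖ ^ 2 ≤ a ^ 2 * ‖u‖ ^ 2)
    (hB' : ∀ u, ∑ m, ‖star (B m) u‖ ^ 2 ≤ b ^ 2 * ‖u‖ ^ 2) {K : H →L[ℂ] H} {c : ℝ}
    (hK : NuclearBound K c) : DualTraceBound (∑ m, star (A m) * (K * B m)) (a * b * c) := by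
  refine DualTraceBound.of_approx fun ε hε => ?_
  obtain ⟨R, h1, h2⟩ := hK (ε / (a * b + 1)) (by positivity)
  have h3 : a * b * (ε / (a * b + 1)) ≤ ε := by
    rw [mul_div_assoc', div_le_iff₀ (by positivity)]
    nlinarith [mul_nonneg ha hb]
  refine ⟨∑ m, star (A m) * (R * B m), ?_, ?_⟩
  · rw [← Finset.sum_sub_distrib]
    simp only [← mul_sub, ← sub_mul]
    refine (norm_sum_star_mul_mul_le ha hb hA hB (K - R)).trans (le_trans ?_ h3)
    gcongr
  · refine (h2.dualTraceBound_sum ha hb hA' hB').mono ?_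
    rw [mul_add]
    linarith

lemma sum_star_mul_eq {ι κ : Type*} [Fintype ι] [Fintype κ] {d : ℕ} (a : ι → Fin d → ℂ)
    (b : κ → Fin d → ℂ) (P : ι → H →L[ℂ] H) (Q : κ → H →L[ℂ] H) :
    ∑ m, star (∑ k, a k m • P k) * (∑ l, b l m • Q l) =
      ∑ k, ∑ l, (∑ m, star (a k m) * b l m) • (star (P k) * Q l) := by
  simp only [star_sum, star_smul, Finset.sum_mul_sum, smul_mul_smul_comm, Finset.sum_smul]
  rw [Finset.sum_comm]
  exact Finset.sum_congr rfl fun k _ => Finset.sum_comm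

/-- Schur multipliers given by bounded Hilbert space valued kernels act on the difference of two
operators that are approximately diagonalised by the families `E` and `G`. -/
lemma exists_dualTraceBound_schur {𝓛 : Type*} {ι κ : Type} [NormedAddCommGroup 𝓛]
    [InnerProductSpace ℂ 𝓛]
    [Fintype ι] [Fintype κ] {E : ι → H →L[ℂ] H} {G : κ → H →L[ℂ] H} {X Y : H →L[ℂ] H}
    {p : ι → ℂ} {q : κ → ℂ} {δ c A B : ℝ} (hδ : 0 ≤ δ) (hA : 0 ≤ A) (hB : 0 ≤ B)
    (hEs : ∀ k, star (E k) = E k) (hGs : ∀ l, star (G l) = G l)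
    (hE : ∀ u, ∑ k, ‖E k u‖ ^ 2 ≤ ‖u‖ ^ 2) (hG : ∀ u, ∑ l, ‖G l u‖ ^ 2 ≤ ‖u‖ ^ 2)
    (hEX : ∀ k, Commute (E k) X) (hGY : ∀ l, Commute (G l) Y)
    (hX : ∀ u, ∑ k, ‖(star (p k • 1 - X) * E k) u‖ ^ 2 ≤ δ ^ 2 * ‖u‖ ^ 2)
    (hY : ∀ u, ∑ l, ‖((q l • 1 - Y) * G l) u‖ ^ 2 ≤ δ ^ 2 * ‖u‖ ^ 2)
    {α : ι → 𝓛} {β : κ → 𝓛} (hα : ∀ k, ‖α k‖ ≤ A) (hβ : ∀ l, ‖β l‖ ≤ B)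
    (hK : NuclearBound (X - Y) c) :
    ∃ S : H →L[ℂ] H, DualTraceBound S (A * B * c) ∧
      ‖(∑ k, ∑ l, (inner ℂ (α k) (β l) * (p k - q l)) • (E k * E k * (G l * G l))) - S‖ ≤
        2 * (A * B * δ) := by
  obtain ⟨d, a, b, hab, ha, hb⟩ := exists_finite_coordinates α β
  replace ha : ∀ k, ∑ m, ‖a k m‖ ^ 2 ≤ A ^ 2 := fun k => by
    rw [ha]; exact pow_le_pow_left₀ (norm_nonneg _) (hα k) 2
  replace hb : ∀ k, ∑ m, ‖b k m‖ ^ 2 ≤ B ^ 2 := fun k => by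
    rw [hb]; exact pow_le_pow_left₀ (norm_nonneg _) (hβ k) 2
  have hsa : ∀ {ι : Type} [Fintype ι] (a : ι → Fin d → ℂ) (E : ι → H →L[ℂ] H) 
      (_ : ∀ k, star (E k) = E k) (m : Fin d),
      star (∑ k, a k m • (star (E k) * E k)) = ∑ k, star (a k m) • (star (E k) * E k) := by
    intro ι _ a E hE m
    simp [star_sum, star_smul, hE]
  have hE' : ∀ u, ∑ k, ‖E k u‖ ^ 2 ≤ 1 ^ 2 * ‖u‖ ^ 2 := by simpa using hE
  have hG' : ∀ u, ∑ k, ‖G k u‖ ^ 2 ≤ 1 ^ 2 * ‖u‖ ^ 2 := by simpa using hG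
  have rA := sum_norm_sum_smul_star_mul_sq_le hE hE' ha
  have rB := sum_norm_sum_smul_star_mul_sq_le hG hG' hb
  have rA' := sum_norm_sum_smul_star_mul_sq_le hE hX ha
  have rB' := sum_norm_sum_smul_star_mul_sq_le hG hY hb
  have sA := sum_norm_sum_smul_star_mul_sq_le (a := fun k m => star (a k m)) hE hE'
    (by simpa using ha)
  have sB := sum_norm_sum_smul_star_mul_sq_le (a := fun k m => star (b k m)) hG hG'
    (by simpa using hb)
  simp only [← hsa a E hEs] at sA
  simp only [← hsa b G hGs] at sB
  simp only [mul_one] at rA rB sA sB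
  refine ⟨_, hK.dualTraceBound_sum hA hB rA rB sA sB, ?_⟩
  have e1 := norm_sum_star_mul_mul_le (by positivity) hB rA' rB 1
  have e2 := norm_sum_star_mul_mul_le hA (by positivity) rA rB' 1
  have n1 : ‖(1 : H →L[ℂ] H)‖ ≤ 1 := ContinuousLinearMap.norm_id_le
  have hkey : (∑ k, ∑ l, (inner ℂ (α k) (β l) * (p k - q l)) • (E k * E k * (G l * G l))) -
      ∑ m, star (∑ k, a k m • (star (E k) * E k)) *
        ((X - Y) * ∑ l, b l m • (star (G l) * G l)) =
      ∑ m, star (∑ k, a k m • (star (E k) * (star (p k • 1 - X) * E k))) *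
        (1 * ∑ l, b l m • (star (G l) * G l)) -
      ∑ m, star (∑ k, a k m • (star (E k) * E k)) *
        (1 * ∑ l, b l m • (star (G l) * ((q l • 1 - Y) * G l))) := by
    have hKsum : ∀ m, (X - Y) * ∑ l, b l m • (star (G l) * G l) =
        ∑ l, b l m • ((X - Y) * (star (G l) * G l)) := fun m => by
      rw [Finset.mul_sum]; simp only [mul_smul_comm]
    simp only [one_mul, hKsum, sum_star_mul_eq, ← hab]
    rw [sub_eq_iff_eq_add]
    rw [← Finset.sum_sub_distrib, ← Finset.sum_add_distrib]
    refine Finset.sum_congr rfl fun k _ => ?_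
    rw [← Finset.sum_sub_distrib, ← Finset.sum_add_distrib]
    refine Finset.sum_congr rfl fun l _ => ?_
    rw [← smul_sub, ← smul_add, mul_smul]
    congr 1
    simp only [star_mul, star_star, hEs, hGs]
    have c1 : E k * X = X * E k := hEX k
    have c2 : G l * Y = Y * G l := hGY l
    have t1 : E k * (p k • 1 - X) * E k = p k • (E k * E k) - E k * E k * X := by
      rw [mul_assoc (E k) (E k) X, c1]
      simp only [mul_sub, sub_mul, mul_smul_comm, smul_mul_assoc, mul_one, mul_assoc]
    have t2 : G l * ((q l • 1 - Y) * G l) = q l • (G l * G l) - Y * (G l * G l) := by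
      rw [← mul_assoc Y, ← c2]
      simp only [mul_sub, sub_mul, mul_smul_comm, smul_mul_assoc, one_mul, mul_assoc]
    rw [t1, t2]
    simp only [mul_sub, sub_mul, mul_smul_comm, smul_mul_assoc, sub_smul, mul_assoc]
    abel
  rw [hkey]
  refine (norm_sub_le _ _).trans ?_
  have : 0 ≤ A * B * δ := by positivity
  nlinarith

end Schur

section SpectralPartition

variable {H : Type*} [NormedAddCommGroup H] [InnerProductSpace ℂ H] [CompleteSpace H]

lemma exists_partition_of_isCompact {s : Set ℂ} (hs : IsCompact s) {δ : ℝ} (hδ : 0 < δ) :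
    ∃ (ι : Type) (_ : Fintype ι) (z : ι → ℂ) (e : ι → ℂ → ℂ), (∀ k, ContinuousOn (e k) s) ∧
      (∀ k w, star (e k w) = e k w) ∧ (∀ w ∈ s, ∑ k, e k w * e k w = 1) ∧
      ∀ k, z k ∈ s ∧ ∀ w, e k w ≠ 0 → ‖w - z k‖ < δ := by
  obtain ⟨t, hts, htf, hcov⟩ := hs.finite_cover_balls hδ
  have := htf.fintype
  set τ : t → ℂ → ℝ := fun k w => max 0 (δ - ‖w - k‖) with hτ
  have hτc : ∀ k, Continuous (τ k) := fun k => by fun_prop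
  have hτ0 : ∀ k w, 0 ≤ τ k w := fun k w => le_max_left _ _
  have hT : ∀ w ∈ s, 0 < ∑ k, τ k w := by
    intro w hw
    obtain ⟨x, hx, hwx⟩ := Set.mem_iUnion₂.1 (hcov hw)
    refine Finset.sum_pos' (fun k _ => hτ0 k w) ⟨⟨x, hx⟩, Finset.mem_univ _, ?_⟩
    rw [mem_ball_iff_norm] at hwx
    exact lt_max_of_lt_right (by simpa using hwx)
  refine ⟨t, this, Subtype.val, fun k w => (Real.sqrt (τ k w / ∑ j, τ j w) : ℂ), ?_, ?_, ?_, ?_⟩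
  · intro k
    refine Complex.continuous_ofReal.comp_continuousOn
      (Real.continuous_sqrt.comp_continuousOn ?_)
    exact (hτc k).continuousOn.div (by fun_prop) fun w hw => (hT w hw).ne'
  · intro k w
    exact Complex.conj_ofReal _
  · intro w hw
    have : ∀ k, Real.sqrt (τ k w / ∑ j, τ j w) * Real.sqrt (τ k w / ∑ j, τ j w) =
        τ k w / ∑ j, τ j w := fun k =>
      Real.mul_self_sqrt (div_nonneg (hτ0 _ _) (Finset.sum_nonneg fun j _ => hτ0 j w))
    simp only [← Complex.ofReal_mul, this]
    rw [← Complex.ofReal_sum, ← Finset.sum_div, div_self (hT w hw).ne', Complex.ofReal_one]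
  · refine fun k => ⟨hts k.2, fun w hw => ?_⟩
    by_contra! h
    have : τ k w = 0 := max_eq_left (by linarith)
    simp [this] at hw

lemma sum_norm_apply_sq_le {ι : Type*} [Fintype ι] (D : ι → H →L[ℂ] H) (u : H) :
    ∑ k, ‖D k u‖ ^ 2 ≤ ‖∑ k, star (D k) * D k‖ * ‖u‖ ^ 2 := by
  have h2 : inner ℂ u ((∑ k, star (D k) * D k) u) = ((∑ k, ‖D k u‖ ^ 2 : ℝ) : ℂ) := by
    rw [sum_apply, inner_sum]
    push_cast
    refine Finset.sum_congr rfl fun k _ => ?_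
    change inner ℂ u (star (D k) (D k u)) = _
    rw [ContinuousLinearMap.star_eq_adjoint,
      ContinuousLinearMap.adjoint_inner_right, inner_self_eq_norm_sq_to_K]
    rfl
  have h3 : ∑ k, ‖D k u‖ ^ 2 = ‖inner ℂ u ((∑ k, star (D k) * D k) u)‖ := by
    rw [h2, Complex.norm_real, Real.norm_of_nonneg (by positivity)]
  rw [h3]
  refine (norm_inner_le_norm _ _).trans ?_
  calc _ ≤ ‖u‖ * (‖∑ k, star (D k) * D k‖ * ‖u‖) := by
        gcongr; exact ContinuousLinearMap.le_opNorm _ _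
    _ = _ := by ring

/-- A quadratic partition of unity in the functional calculus of a normal operator, subordinate
to a cover of the spectrum by discs of radius `δ`. -/
lemma exists_spectral_partition (N : H →L[ℂ] H) [IsStarNormal N] {δ : ℝ} (hδ : 0 < δ) :
    ∃ (ι : Type) (_ : Fintype ι) (z : ι → ℂ) (E : ι → H →L[ℂ] H),
      (∀ k, z k ∈ spectrum ℂ N) ∧ (∀ k, star (E k) = E k) ∧ (∑ k, E k * E k = 1) ∧
      (∀ k (g : ℂ → ℂ), Commute (E k) (cfc g N)) ∧
      ∀ (g : ℂ → ℂ) (η : ℝ), ContinuousOn g (spectrum ℂ N) → 0 ≤ η →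
        (∀ k, ∀ w ∈ spectrum ℂ N, ‖w - z k‖ < δ → ‖g (z k) - g w‖ ≤ η) →
        (∀ u, ∑ k, ‖((g (z k) • 1 - cfc g N) * E k) u‖ ^ 2 ≤ η ^ 2 * ‖u‖ ^ 2) ∧
        ‖∑ k, g (z k) • (E k * E k) - cfc g N‖ ≤ η := by
  obtain ⟨ι, _, z, e, hec, hes, he1, hez⟩ :=
    exists_partition_of_isCompact (spectrum.isCompact (𝕜 := ℂ) N) hδ
  have hone : ∑ k, cfc (e k) N * cfc (e k) N = 1 := by
    have : ∀ k, cfc (e k) N * cfc (e k) N = cfc (fun w => e k w * e k w) N := fun k =>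
      (cfc_mul (e k) (e k) N (hec k) (hec k)).symm
    simp only [this]
    rw [← cfc_sum_univ (fun k w => e k w * e k w) N (fun k => (hec k).mul (hec k))]
    rw [cfc_congr (g := fun _ => (1 : ℂ)), cfc_const_one ℂ N]
    intro w hw
    simpa using he1 w hw
  refine ⟨ι, inferInstance, z, fun k => cfc (e k) N, fun k => (hez k).1, ?_, hone, ?_, ?_⟩
  · intro k
    rw [← cfc_star]
    simp only [hes]
  · exact fun k g => cfc_commute_cfc (e k) g N
  intro g η hg hη hgz
  have hD : ∀ k, (g (z k) • 1 - cfc g N) * cfc (e k) N =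
      cfc (fun w => (g (z k) - g w) * e k w) N := by
    intro k
    rw [cfc_mul (fun w => g (z k) - g w) (e k) N (continuousOn_const.sub hg) (hec k),
      cfc_sub (fun _ => g (z k)) g N continuousOn_const hg, cfc_const _ N,
      Algebra.algebraMap_eq_smul_one]
  have hDc : ∀ k, ContinuousOn (fun w => (g (z k) - g w) * e k w) (spectrum ℂ N) := fun k =>
    (continuousOn_const.sub hg).mul (hec k)
  have hnorm : ∀ k w, ‖e k w * e k w‖ = (e k w * e k w).re := by
    intro k w
    have : (e k w) = ((e k w).re : ℂ) := (Complex.conj_eq_iff_re.1 (hes k w)).symm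
    rw [this, ← Complex.ofReal_mul, Complex.norm_real, Complex.ofReal_re,
      Real.norm_of_nonneg (mul_self_nonneg _)]
  have hnorm1 : ∀ w ∈ spectrum ℂ N, ∑ k, ‖e k w * e k w‖ = 1 := by
    intro w hw
    simp only [hnorm]
    rw [← Complex.re_sum, he1 w hw, Complex.one_re]
  have hval : ∀ k, ∀ w ∈ spectrum ℂ N, e k w ≠ 0 → ‖g (z k) - g w‖ ≤ η :=
    fun k w hw h => hgz k w hw ((hez k).2 w h)
  constructor
  · intro u
    refine (sum_norm_apply_sq_le _ u).trans ?_
    gcongr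
    simp only [hD]
    have : ∀ k, star (cfc (fun w => (g (z k) - g w) * e k w) N) *
        cfc (fun w => (g (z k) - g w) * e k w) N =
        cfc (fun w => star ((g (z k) - g w) * e k w) * ((g (z k) - g w) * e k w)) N := fun k => by
      rw [cfc_mul _ _ N (hDc k).star (hDc k), cfc_star]
    simp only [this]
    rw [← cfc_sum_univ (fun k w => star ((g (z k) - g w) * e k w) * ((g (z k) - g w) * e k w)) N
      (fun k => (hDc k).star.mul (hDc k))]
    refine norm_cfc_le (by positivity) fun w hw => ?_
    rw [Finset.sum_apply]
    refine (norm_sum_le _ _).trans ?_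
    calc _ ≤ ∑ k, η ^ 2 * ‖e k w * e k w‖ := by
          refine Finset.sum_le_sum fun k _ => ?_
          by_cases h : e k w = 0
          · simp [h]
          · have := hval k w hw h
            simp only [norm_mul, norm_star]
            calc _ = ‖g (z k) - g w‖ ^ 2 * (‖e k w‖ * ‖e k w‖) := by ring
              _ ≤ _ := by gcongr
      _ = η ^ 2 := by rw [← Finset.mul_sum, hnorm1 w hw, mul_one]
  · have h1 : ∑ k, g (z k) • (cfc (e k) N * cfc (e k) N) - cfc g N =
        cfc (fun w => ∑ k, (g (z k) - g w) * e k w * e k w) N := by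
      have h2 : cfc g N = ∑ k, cfc g N * (cfc (e k) N * cfc (e k) N) := by
        rw [← Finset.mul_sum, hone, mul_one]
      rw [h2, ← Finset.sum_sub_distrib]
      have h3 := cfc_sum_univ (fun k w => (g (z k) - g w) * e k w * e k w) N
        (fun k => (hDc k).mul (hec k))
      rw [show (fun w => ∑ k, (g (z k) - g w) * e k w * e k w) =
        ∑ k, (fun w => (g (z k) - g w) * e k w * e k w) from by ext w; simp, h3]
      refine Finset.sum_congr rfl fun k _ => ?_
      rw [cfc_mul _ (e k) N (hDc k) (hec k), ← hD, sub_mul, sub_mul, smul_mul_assoc, one_mul,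
        smul_mul_assoc, mul_assoc]
    rw [h1]
    refine norm_cfc_le hη fun w hw => ?_
    refine (norm_sum_le _ _).trans ?_
    calc _ ≤ ∑ k, η * ‖e k w * e k w‖ := by
          refine Finset.sum_le_sum fun k _ => ?_
          by_cases h : e k w = 0
          · simp [h]
          · have := hval k w hw h
            rw [mul_assoc, norm_mul]
            gcongr
      _ = η := by rw [← Finset.mul_sum, hnorm1 w hw, mul_one]

end SpectralPartition

section SchurCFC

variable {H : Type*} [NormedAddCommGroup H] [InnerProductSpace ℂ H] [CompleteSpace H]

lemma cfc_re_eq (N : H →L[ℂ] H) [IsStarNormal N] :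
    cfc (fun z : ℂ => (z.re : ℂ)) N = (1 / 2 : ℂ) • N + (1 / 2 : ℂ) • star N := by
  have : (fun z : ℂ => (z.re : ℂ)) = fun z => (1 / 2 : ℂ) * z + (1 / 2 : ℂ) * star z := by
    ext z
    rw [Complex.re_eq_add_conj]
    simp only [Complex.star_def]
    ring
  rw [this, cfc_add N _ _ (by fun_prop) (by fun_prop), cfc_const_mul _ _ N (by fun_prop),
    cfc_const_mul _ _ N (by fun_prop), cfc_star (fun z => z), cfc_id' ℂ N]

lemma cfc_im_eq (N : H →L[ℂ] H) [IsStarNormal N] :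
    cfc (fun z : ℂ => (z.im : ℂ)) N =
      (1 / (2 * Complex.I) : ℂ) • N + (-(1 / (2 * Complex.I)) : ℂ) • star N := by
  have : (fun z : ℂ => (z.im : ℂ)) = fun z =>
      (1 / (2 * Complex.I) : ℂ) * z + (-(1 / (2 * Complex.I)) : ℂ) * star z := by
    ext z
    rw [Complex.im_eq_sub_conj]
    simp only [Complex.star_def]
    ring
  rw [this, cfc_add N _ _ (by fun_prop) (by fun_prop), cfc_const_mul _ _ N (by fun_prop),
    cfc_const_mul _ _ N (by fun_prop), cfc_star (fun z => z), cfc_id' ℂ N]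

lemma NuclearBound.cfc_re_sub {N₁ N₂ : H →L[ℂ] H} [IsStarNormal N₁] [IsStarNormal N₂] {c : ℝ}
    (h : NuclearBound (N₁ - N₂) c) :
    NuclearBound (cfc (fun z : ℂ => (z.re : ℂ)) N₁ - cfc (fun z : ℂ => (z.re : ℂ)) N₂) c := by
  have h1 := (h.smul (1 / 2)).add ((nuclearBound_star h).smul (1 / 2))
  rw [cfc_re_eq, cfc_re_eq]
  convert h1 using 1
  · rw [star_sub, smul_sub, smul_sub]; abel
  · norm_num; ring

lemma NuclearBound.cfc_im_sub {N₁ N₂ : H →L[ℂ] H} [IsStarNormal N₁] [IsStarNormal N₂] {c : ℝ}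
    (h : NuclearBound (N₁ - N₂) c) :
    NuclearBound (cfc (fun z : ℂ => (z.im : ℂ)) N₁ - cfc (fun z : ℂ => (z.im : ℂ)) N₂) c := by
  have h1 := (h.smul (1 / (2 * Complex.I))).add
    ((nuclearBound_star h).smul (-(1 / (2 * Complex.I))))
  rw [cfc_im_eq, cfc_im_eq]
  convert h1 using 1
  · rw [star_sub, smul_sub, smul_sub]; abel
  · simp; ring

/-- One summand of the Schur representation, for a real coordinate `g`. -/
lemma exists_dualTraceBound_schur_coord {𝓛 : Type*} [NormedAddCommGroup 𝓛]
    [InnerProductSpace ℂ 𝓛] {N₁ N₂ : H →L[ℂ] H} {ι κ : Type} [Fintype ι] [Fintype κ]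
    {z : ι → ℂ} {w : κ → ℂ} {E : ι → H →L[ℂ] H} {G : κ → H →L[ℂ] H} {δ c A B : ℝ}
    (hδ : 0 ≤ δ) (hA : 0 ≤ A) (hB : 0 ≤ B)
    (hEs : ∀ k, star (E k) = E k) (hGs : ∀ l, star (G l) = G l)
    (hE1 : ∑ k, E k * E k = 1) (hG1 : ∑ k, G k * G k = 1)
    {g : ℂ → ℝ}
    (hEX : ∀ k, Commute (E k) (cfc (fun z => (g z : ℂ)) N₁))
    (hGY : ∀ l, Commute (G l) (cfc (fun z => (g z : ℂ)) N₂))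
    (hX : ∀ u, ∑ k, ‖(((g (z k) : ℂ) • 1 - cfc (fun z => (g z : ℂ)) N₁) * E k) u‖ ^ 2 ≤
      δ ^ 2 * ‖u‖ ^ 2)
    (hY : ∀ u, ∑ l, ‖(((g (w l) : ℂ) • 1 - cfc (fun z => (g z : ℂ)) N₂) * G l) u‖ ^ 2 ≤
      δ ^ 2 * ‖u‖ ^ 2)
    {α β : ℂ → 𝓛} (hα : ∀ k, ‖α k‖ ≤ A) (hβ : ∀ l, ‖β l‖ ≤ B)
    (hK : NuclearBound (cfc (fun z => (g z : ℂ)) N₁ - cfc (fun z => (g z : ℂ)) N₂) c) :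
    ∃ S : H →L[ℂ] H, DualTraceBound S (A * B * c) ∧
      ‖(∑ k, ∑ l, (inner ℂ (α (z k)) (β (w l)) * ((g (z k) : ℂ) - g (w l))) •
        (E k * E k * (G l * G l))) - S‖ ≤ 2 * (A * B * δ) := by
  have hsum : ∀ {ι : Type} [Fintype ι] (E : ι → H →L[ℂ] H) (_ : ∀ k, star (E k) = E k)
      (_ : ∑ k, E k * E k = 1) (u : H), ∑ k, ‖E k u‖ ^ 2 ≤ ‖u‖ ^ 2 := by
    intro ι _ E hE h1 u
    have h := sum_norm_apply_sq_le E u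
    simp only [hE, h1] at h
    have n1 : ‖(1 : H →L[ℂ] H)‖ ≤ 1 := ContinuousLinearMap.norm_id_le
    nlinarith [sq_nonneg ‖u‖]
  refine exists_dualTraceBound_schur hδ hA hB hEs hGs (hsum E hEs hE1) (hsum G hGs hG1) hEX hGY
    ?_ hY (fun k => hα (z k)) (fun l => hβ (w l)) hK
  intro u
  have hs : ∀ k, star ((g (z k) : ℂ) • 1 - cfc (fun z => (g z : ℂ)) N₁) =
      (g (z k) : ℂ) • 1 - cfc (fun z => (g z : ℂ)) N₁ := by
    intro k
    rw [star_sub, star_smul, star_one, ← cfc_star]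
    simp
  simp only [hs]
  exact hX u

/-- If the divided differences of `f` in both coordinate directions are bounded Schur multipliers
then `f` respects trace class perturbations of normal operators. -/
lemma dualTraceBound_cfc_sub {𝓛 𝓜 : Type*} [NormedAddCommGroup 𝓛] [InnerProductSpace ℂ 𝓛]
    [NormedAddCommGroup 𝓜] [InnerProductSpace ℂ 𝓜] {f : ℂ → ℂ} (hf : Continuous f)
    {α β : ℂ → 𝓛} {γ ζ : ℂ → 𝓜} {A B A' B' c : ℝ} (hα : ∀ z, ‖α z‖ ≤ A) (hβ : ∀ z, ‖β z‖ ≤ B)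
    (hγ : ∀ z, ‖γ z‖ ≤ A') (hζ : ∀ z, ‖ζ z‖ ≤ B')
    (hrep : ∀ z w, f z - f w = inner ℂ (α z) (β w) * ((z.im : ℂ) - w.im) +
      inner ℂ (γ z) (ζ w) * ((z.re : ℂ) - w.re))
    {N₁ N₂ : H →L[ℂ] H} [IsStarNormal N₁] [IsStarNormal N₂] (hK : NuclearBound (N₁ - N₂) c) :
    DualTraceBound (cfc f N₁ - cfc f N₂) ((A * B + A' * B') * c) := by
  have hA : 0 ≤ A := (norm_nonneg _).trans (hα 0)
  have hB : 0 ≤ B := (norm_nonneg _).trans (hβ 0)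
  have hA' : 0 ≤ A' := (norm_nonneg _).trans (hγ 0)
  have hB' : 0 ≤ B' := (norm_nonneg _).trans (hζ 0)
  refine DualTraceBound.of_approx fun ε hε => ?_
  obtain ⟨δ₁, hδ₁, hf₁⟩ := Metric.uniformContinuousOn_iff.1
    ((spectrum.isCompact (𝕜 := ℂ) N₁).uniformContinuousOn_of_continuous hf.continuousOn) (ε / 4)
    (by positivity)
  obtain ⟨δ₂, hδ₂, hf₂⟩ := Metric.uniformContinuousOn_iff.1
    ((spectrum.isCompact (𝕜 := ℂ) N₂).uniformContinuousOn_of_continuous hf.continuousOn) (ε / 4)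
    (by positivity)
  obtain ⟨δ, hδ, hδ₁', hδ₂', hδε⟩ :
      ∃ δ > 0, δ ≤ δ₁ ∧ δ ≤ δ₂ ∧ 2 * ((A * B + A' * B') * δ) ≤ ε / 2 := by
    have h1 : 0 ≤ A * B + A' * B' := by positivity
    refine ⟨min (min δ₁ δ₂) (ε / (4 * (A * B + A' * B' + 1))), by positivity,
      (min_le_left _ _).trans (min_le_left _ _), (min_le_left _ _).trans (min_le_right _ _), ?_⟩
    generalize A * B + A' * B' = D at h1 ⊢
    calc _ ≤ 2 * (D * (ε / (4 * (D + 1)))) := by gcongr; exact min_le_right _ _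
      _ = ε / 2 * (D / (D + 1)) := by field_simp; ring
      _ ≤ ε / 2 * 1 := by
        gcongr
        rw [div_le_one (by positivity)]; linarith
      _ = _ := mul_one _
  obtain ⟨ι, _, z, E, hz, hEs, hE1, hEc, hEg⟩ := exists_spectral_partition N₁ hδ
  obtain ⟨κ, _, w, G, hw, hGs, hG1, hGc, hGg⟩ := exists_spectral_partition N₂ hδ
  have him : ∀ a b : ℂ, ‖b - a‖ < δ → ‖(a.im : ℂ) - b.im‖ ≤ δ := by
    intro a b h
    rw [← Complex.ofReal_sub, Complex.norm_real, ← Complex.sub_im]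
    rw [norm_sub_rev] at h
    exact (Complex.abs_im_le_norm _).trans h.le
  have hre : ∀ a b : ℂ, ‖b - a‖ < δ → ‖(a.re : ℂ) - b.re‖ ≤ δ := by
    intro a b h
    rw [← Complex.ofReal_sub, Complex.norm_real, ← Complex.sub_re]
    rw [norm_sub_rev] at h
    exact (Complex.abs_re_le_norm _).trans h.le
  have hcim : Continuous fun z : ℂ => (z.im : ℂ) := by fun_prop
  have hcre : Continuous fun z : ℂ => (z.re : ℂ) := by fun_prop
  obtain ⟨S₁, hS₁, hS₁'⟩ := exists_dualTraceBound_schur_coord (g := Complex.im) hδ.le hA hB hEs hGs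
    hE1 hG1 (fun k => hEc k _) (fun k => hGc k _)
    (hEg _ δ hcim.continuousOn hδ.le fun k b _ h => him _ _ h).1
    (hGg _ δ hcim.continuousOn hδ.le fun k b _ h => him _ _ h).1 hα hβ hK.cfc_im_sub
  obtain ⟨S₂, hS₂, hS₂'⟩ := exists_dualTraceBound_schur_coord (g := Complex.re) hδ.le hA' hB'
    hEs hGs
    hE1 hG1 (fun k => hEc k _) (fun k => hGc k _)
    (hEg _ δ hcre.continuousOn hδ.le fun k b _ h => hre _ _ h).1
    (hGg _ δ hcre.continuousOn hδ.le fun k b _ h => hre _ _ h).1 hγ hζ hK.cfc_re_sub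
  have hfE := (hEg f (ε / 4) hf.continuousOn (by positivity) fun k b hb h =>
    (hf₁ _ (hz k) _ hb (by rw [dist_comm, dist_eq_norm]; exact h.trans_le hδ₁')).le.trans_eq'
      (dist_eq_norm _ _)).2
  have hfG := (hGg f (ε / 4) hf.continuousOn (by positivity) fun k b hb h =>
    (hf₂ _ (hw k) _ hb (by rw [dist_comm, dist_eq_norm]; exact h.trans_le hδ₂')).le.trans_eq'
      (dist_eq_norm _ _)).2
  have hmain : ∑ k, f (z k) • (E k * E k) - ∑ l, f (w l) • (G l * G l) =
      (∑ k, ∑ l, (inner ℂ (α (z k)) (β (w l)) * (((z k).im : ℂ) - (w l).im)) •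
        (E k * E k * (G l * G l))) +
      ∑ k, ∑ l, (inner ℂ (γ (z k)) (ζ (w l)) * (((z k).re : ℂ) - (w l).re)) •
        (E k * E k * (G l * G l)) := by
    have e1 : ∑ k, f (z k) • (E k * E k) =
        ∑ k, ∑ l, f (z k) • (E k * E k * (G l * G l)) := by
      refine Finset.sum_congr rfl fun k _ => ?_
      rw [← Finset.smul_sum, ← Finset.mul_sum, hG1, mul_one]
    have e2 : ∑ l, f (w l) • (G l * G l) =
        ∑ k, ∑ l, f (w l) • (E k * E k * (G l * G l)) := by
      rw [Finset.sum_comm]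
      refine Finset.sum_congr rfl fun k _ => ?_
      rw [← Finset.smul_sum, ← Finset.sum_mul, hE1, one_mul]
    rw [e1, e2]
    simp only [← Finset.sum_sub_distrib, ← Finset.sum_add_distrib, ← sub_smul, ← add_smul, hrep]
  refine ⟨S₁ + S₂, ?_, (hS₁.add hS₂).mono (by linarith)⟩
  set P := ∑ k, f (z k) • (E k * E k)
  set Q := ∑ l, f (w l) • (G l * G l)
  have hsplit : cfc f N₁ - cfc f N₂ - (S₁ + S₂) =
      -(P - cfc f N₁) + (Q - cfc f N₂) +
      ((∑ k, ∑ l, (inner ℂ (α (z k)) (β (w l)) * (((z k).im : ℂ) - (w l).im)) •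
        (E k * E k * (G l * G l))) - S₁) +
      ((∑ k, ∑ l, (inner ℂ (γ (z k)) (ζ (w l)) * (((z k).re : ℂ) - (w l).re)) •
        (E k * E k * (G l * G l))) - S₂) := by
    have : cfc f N₁ - cfc f N₂ - (S₁ + S₂) =
        -(P - cfc f N₁) + (Q - cfc f N₂) + (P - Q) - S₁ - S₂ := by abel
    rw [this, hmain]
    abel
  rw [hsplit]
  refine (norm_add_le _ _).trans ?_
  refine (add_le_add_left (norm_add_le _ _) _).trans ?_
  refine (add_le_add_left (add_le_add_left (norm_add_le _ _) _) _).trans ?_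
  rw [norm_neg]
  linarith

end SchurCFC

section Wave

/-- The character `x ↦ exp (2πix)`. -/
noncomputable def wave (x : ℝ) : ℂ := Complex.exp (((2 * Real.pi * x : ℝ) : ℂ) * Complex.I)

lemma norm_wave (x : ℝ) : ‖wave x‖ = 1 := Complex.norm_exp_ofReal_mul_I _

@[fun_prop]
lemma continuous_wave : Continuous wave := by unfold wave; fun_prop

@[fun_prop]
lemma measurable_wave : Measurable wave := continuous_wave.measurable

lemma wave_add (x y : ℝ) : wave (x + y) = wave x * wave y := by
  unfold wave
  rw [← Complex.exp_add]
  congr 1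
  push_cast
  ring

lemma wave_zero : wave 0 = 1 := by simp [wave]

lemma wave_sub_one (x : ℝ) :
    wave x - 1 = x * ∫ s in Set.Ioc (0 : ℝ) 1, 2 * Real.pi * Complex.I * wave (s * x) := by
  have h : ∀ s : ℝ, HasDerivAt (fun s : ℝ => wave (s * x))
      (x * (2 * Real.pi * Complex.I * wave (s * x))) s := by
    intro s
    have h1 : HasDerivAt (fun s : ℝ => ((2 * Real.pi * (s * x) : ℝ) : ℂ) * Complex.I)
        (((2 * Real.pi * (1 * x) : ℝ) : ℂ) * Complex.I) s :=
      ((((hasDerivAt_id s).mul_const x).const_mul (2 * Real.pi)).ofReal_comp).mul_const _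
    refine HasDerivAt.congr_deriv (f := fun s : ℝ => wave (s * x)) h1.cexp ?_
    change wave (s * x) * _ = _
    push_cast
    ring
  rw [← integral_const_mul, ← intervalIntegral.integral_of_le zero_le_one,
    intervalIntegral.integral_eq_sub_of_hasDerivAt (f := fun s : ℝ => wave (s * x))
      (fun s _ => h s) (Continuous.intervalIntegrable (by fun_prop) _ _)]
  simp [wave_zero]

lemma exists_schwartz_fourier_eq_one :
    ∃ ψ : SchwartzMap ℝ ℂ, ∀ p : ℝ, |p| ≤ 1 → ∫ t : ℝ, wave (-(p * t)) * ψ t = 1 := by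
  let b : ContDiffBump (0 : ℝ) := ⟨1, 2, one_pos, one_lt_two⟩
  have h1 : HasCompactSupport (Complex.ofRealCLM ∘ b) := b.hasCompactSupport.comp_left rfl
  let χ : SchwartzMap ℝ ℂ := h1.toSchwartzMap (Complex.ofRealCLM.contDiff.comp b.contDiff)
  refine ⟨𝓕⁻ χ, fun p hp => ?_⟩
  have h2 : 𝓕 (𝓕⁻ χ) = χ := FourierTransform.fourier_fourierInv_eq χ
  have h3 : (𝓕 (𝓕⁻ χ) : SchwartzMap ℝ ℂ) p = 1 := by
    rw [h2]
    have : b p = 1 := b.one_of_mem_closedBall (by simpa using hp)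
    simp [χ, this]
  rw [SchwartzMap.fourier_coe, Real.fourier_real_eq_integral_exp_smul] at h3
  rw [← h3]
  congr 1
  ext t
  rw [wave, smul_eq_mul]
  congr 4
  ring

variable {Ω : Type*} [MeasurableSpace Ω] {μ : Measure Ω} [SFinite μ]

/-- A function whose frequencies lie in `[-1, 1]` is reproduced by convolution with a Schwartz
function whose Fourier transform is `1` on `[-1, 1]`. -/
lemma integral_mul_schwartz_eq {ψ : SchwartzMap ℝ ℂ}
    (hψ : ∀ p : ℝ, |p| ≤ 1 → ∫ t : ℝ, wave (-(p * t)) * ψ t = 1) {G : Ω → ℂ}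
    (hG : Integrable G μ) {p : Ω → ℝ} (hp : Measurable p) (hp1 : ∀ᵐ ω ∂μ, |p ω| ≤ 1) (a : ℝ) :
    ∫ t : ℝ, (∫ ω, G ω * wave (p ω * t) ∂μ) * ψ (a - t) = ∫ ω, G ω * wave (p ω * a) ∂μ := by
  have hψi : Integrable (fun t => ψ (a - t)) := ψ.integrable.comp_sub_left a
  have hint : Integrable (Function.uncurry fun (t : ℝ) ω => G ω * wave (p ω * t) * ψ (a - t))
      (volume.prod μ) := by
    have h1 := (hψi.mul_prod hG).bdd_mul (f := fun x => wave (p x.2 * x.1)) (c := 1)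
      (by fun_prop) (ae_of_all _ fun x => (norm_wave _).le)
    refine h1.congr (ae_of_all _ fun x => ?_)
    simp only [Function.uncurry]
    ring
  simp only [← integral_mul_const]
  rw [integral_integral_swap hint]
  refine integral_congr_ae ?_
  filter_upwards [hp1] with ω hω
  have h2 : ∀ t, G ω * wave (p ω * t) * ψ (a - t) =
      G ω * wave (p ω * a) * (wave (-(p ω * (a - t))) * ψ (a - t)) := by
    intro t
    rw [show p ω * t = p ω * a + -(p ω * (a - t)) by ring, wave_add]
    ring
  simp only [h2]
  rw [integral_const_mul, integral_sub_left_eq_self (fun t => wave (-(p ω * t)) * ψ t) volume a,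
    hψ _ hω, mul_one]

/-- The divided difference of a function with frequencies in `[-1, 1]` has the same property. -/
lemma exists_dividedDifference_reproducing {ψ : SchwartzMap ℝ ℂ}
    (hψ : ∀ p : ℝ, |p| ≤ 1 → ∫ t : ℝ, wave (-(p * t)) * ψ t = 1) {G : Ω → ℂ}
    (hG : Integrable G μ) {p : Ω → ℝ} (hp : Measurable p) (hp1 : ∀ᵐ ω ∂μ, |p ω| ≤ 1)
    {φ : ℝ → ℂ} (hφ : ∀ t, φ t = ∫ ω, G ω * wave (p ω * t) ∂μ) (y : ℝ) :
    ∃ g : ℝ → ℂ, (∀ t, φ y - φ t = (y - t) * g t) ∧ ∀ a, ∫ t, g t * ψ (a - t) = g a := by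
  set ν : Measure ℝ := volume.restrict (Set.Ioc 0 1)
  set G' : Ω × ℝ → ℂ := fun x =>
    G x.1 * (2 * Real.pi * Complex.I * p x.1 * wave (x.2 * (p x.1 * y)))
  set p' : Ω × ℝ → ℝ := fun x => (1 - x.2) * p x.1
  have hp' : Measurable p' := by fun_prop
  have hfst : ∀ᵐ x ∂μ.prod ν, |p x.1| ≤ 1 := Measure.quasiMeasurePreserving_fst.ae hp1
  have hsnd : ∀ᵐ x ∂μ.prod ν, x.2 ∈ Set.Ioc (0 : ℝ) 1 :=
    Measure.quasiMeasurePreserving_snd.ae (ae_restrict_mem measurableSet_Ioc)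
  have hp1' : ∀ᵐ x ∂μ.prod ν, |p' x| ≤ 1 := by
    filter_upwards [hfst, hsnd] with x h1 h2
    rw [abs_mul]
    exact mul_le_one₀ (abs_le.2 ⟨by linarith [h2.2], by linarith [h2.1]⟩) (abs_nonneg _) h1
  have hGp : Integrable (fun x : Ω × ℝ => G x.1) (μ.prod ν) := hG.comp_fst ν
  have hG' : Integrable G' (μ.prod ν) := by
    have h1 := hGp.bdd_mul
      (f := fun x => 2 * Real.pi * Complex.I * p x.1 * wave (x.2 * (p x.1 * y)))
      (c := 2 * Real.pi) (by fun_prop) (by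
        filter_upwards [hfst] with x h1
        simp only [norm_mul, norm_wave, Complex.norm_I, Complex.norm_real, Real.norm_eq_abs,
          abs_of_pos Real.pi_pos, Complex.norm_ofNat, mul_one]
        exact mul_le_of_le_one_right (by positivity) h1)
    refine h1.congr (ae_of_all _ fun x => ?_)
    simp only [G']
    ring
  refine ⟨fun t => ∫ x, G' x * wave (p' x * t) ∂μ.prod ν, fun t => ?_,
    fun a => integral_mul_schwartz_eq hψ hG' hp' hp1' a⟩
  have hi : Integrable (fun x => G' x * wave (p' x * t)) (μ.prod ν) := by
    refine (hG'.bdd_mul (f := fun x => wave (p' x * t)) (c := 1) (by fun_prop)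
      (ae_of_all _ fun x => (norm_wave _).le)).congr (ae_of_all _ fun x => mul_comm _ _)
  have hG1 : ∀ s : ℝ, Integrable (fun ω => G ω * wave (p ω * s)) μ := fun s =>
    (hG.bdd_mul (f := fun ω => wave (p ω * s)) (c := 1) (by fun_prop)
      (ae_of_all _ fun x => (norm_wave _).le)).congr (ae_of_all _ fun x => mul_comm _ _)
  beta_reduce
  rw [integral_prod _ hi, hφ, hφ, ← integral_sub (hG1 _) (hG1 _), ← integral_const_mul]
  congr 1
  ext ω
  have h1 := wave_sub_one (p ω * (y - t))
  have h2 : wave (p ω * y) = wave (p ω * t) * wave (p ω * (y - t)) := by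
    rw [← wave_add]; congr 1; ring
  have h3 : ∀ s : ℝ, G' (ω, s) * wave (p' (ω, s) * t) = G ω * p ω * wave (p ω * t) *
      (2 * Real.pi * Complex.I * wave (s * (p ω * (y - t)))) := by
    intro s
    simp only [G', p']
    have : wave (s * (p ω * y)) * wave ((1 - s) * p ω * t) =
        wave (p ω * t) * wave (s * (p ω * (y - t))) := by
      rw [← wave_add, ← wave_add]; congr 1; ring
    linear_combination (G ω * p ω * (2 * Real.pi * Complex.I)) * this
  simp only [h3]
  rw [integral_const_mul, h2]
  push_cast at h1
  linear_combination (G ω * wave (p ω * t)) * h1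

end Wave

section Bernstein

lemma SchwartzMap.exists_norm_sub_le (ψ : SchwartzMap ℝ ℂ) :
    ∃ C : ℝ, 0 ≤ C ∧ ∀ u v : ℝ, |u - v| ≤ 1 → ‖ψ u - ψ v‖ ≤ C * |u - v| * (1 + u ^ 2)⁻¹ := by
  set C := SchwartzMap.seminorm ℝ 0 1 ψ + SchwartzMap.seminorm ℝ 2 1 ψ with hC
  have hC0 : 0 ≤ C := by positivity
  have hd : ∀ s, ‖deriv ψ s‖ * (1 + s ^ 2) ≤ C := by
    intro s
    have h0 := SchwartzMap.le_seminorm' ℝ 0 1 ψ s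
    have h2 := SchwartzMap.le_seminorm' ℝ 2 1 ψ s
    rw [iteratedDeriv_one] at h0 h2
    rw [sq_abs] at h2
    rw [pow_zero] at h0
    linarith
  refine ⟨3 * C, by positivity, fun u v huv => ?_⟩
  have hb : ∀ s ∈ Set.uIcc v u, ‖deriv ψ s‖ ≤ 3 * C * (1 + u ^ 2)⁻¹ := by
    intro s hs
    have h1 : |u - s| ≤ 1 := (Set.abs_sub_right_of_mem_uIcc hs).trans huv
    have h2 := abs_le.1 h1
    rw [← div_eq_mul_inv, le_div_iff₀ (by positivity)]
    have h3 : 1 + u ^ 2 ≤ 3 * (1 + s ^ 2) := by nlinarith [sq_nonneg (u - 2 * s), sq_nonneg (u - s)]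
    calc _ ≤ ‖deriv ψ s‖ * (3 * (1 + s ^ 2)) := by gcongr
      _ ≤ _ := by linarith [hd s]
  have h4 := (convex_uIcc v u).norm_image_sub_le_of_norm_deriv_le
    (fun s _ => ψ.differentiableAt) hb Set.left_mem_uIcc Set.right_mem_uIcc
  rw [Real.norm_eq_abs] at h4
  linarith

/-- Bernstein's inequality on short intervals, for functions reproduced by a Schwartz kernel. -/
lemma SchwartzMap.exists_bernstein (ψ : SchwartzMap ℝ ℂ) :
    ∃ L : ℝ, 0 ≤ L ∧ ∀ (φ : ℝ → ℂ) (B : ℝ), Continuous φ → (∀ t, ‖φ t‖ ≤ B) →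
      (∀ a, ∫ t, φ t * ψ (a - t) = φ a) →
      ∀ a b, |a - b| ≤ 1 → ‖φ a - φ b‖ ≤ L * B * |a - b| := by
  obtain ⟨C, hC0, hC⟩ := ψ.exists_norm_sub_le
  refine ⟨C * Real.pi, by positivity, fun φ B hφc hB hφ a b hab => ?_⟩
  have hB0 : 0 ≤ B := (norm_nonneg _).trans (hB 0)
  have hi : ∀ a, Integrable fun t => φ t * ψ (a - t) := fun a =>
    (ψ.integrable.comp_sub_left a).bdd_mul (by fun_prop) (ae_of_all _ hB)
  rw [← hφ a, ← hφ b, ← integral_sub (hi a) (hi b)]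
  have hint : Integrable fun t : ℝ => B * (C * |a - b|) * (1 + (a - t) ^ 2)⁻¹ :=
    (integrable_inv_one_add_sq.comp_sub_left a).const_mul _
  refine (norm_integral_le_of_norm_le hint (ae_of_all _ fun t => ?_)).trans (le_of_eq ?_)
  · rw [← mul_sub, norm_mul, mul_assoc]
    have := hC (a - t) (b - t) (by simpa using hab)
    rw [sub_sub_sub_cancel_right] at this
    gcongr
    exact hB t
  · rw [integral_const_mul, integral_sub_left_eq_self (fun t : ℝ => (1 + t ^ 2)⁻¹) volume a,
      integral_univ_inv_one_add_sq]
    ring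

lemma inner_toLp_eq {u v : ℝ → ℂ} (hu : MemLp u 2) (hv : MemLp v 2) :
    inner ℂ (hu.toLp u) (hv.toLp v) = ∫ t, star (u t) * v t := by
  rw [L2.inner_def]
  refine integral_congr_ae ?_
  filter_upwards [hu.coeFn_toLp, hv.coeFn_toLp] with t h1 h2
  rw [h1, h2, RCLike.inner_apply']
  rfl

lemma norm_toLp_sq {u : ℝ → ℂ} (hu : MemLp u 2) :
    ‖hu.toLp u‖ ^ 2 = ∫ t, ‖u t‖ ^ 2 := by
  have h1 : (inner ℂ (hu.toLp u) (hu.toLp u) : ℂ) = ((∫ t, ‖u t‖ ^ 2 : ℝ) : ℂ) := by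
    rw [inner_toLp_eq, ← integral_complex_ofReal]
    congr 1
    ext t
    rw [Complex.star_def, Complex.conj_mul']
    push_cast
    rfl
  rw [inner_self_eq_norm_sq_to_K] at h1
  exact Complex.ofReal_injective (by rw [← h1]; push_cast; rfl)

/-- Divided differences of bounded functions with frequencies in `[-1, 1]` factor through a Hilbert
space, in either order. -/
lemma exists_dividedDifference_factorization :
    ∃ (C : ℝ) (b b' : ℝ → Lp ℂ 2 (volume : Measure ℝ)), 0 < C ∧ (∀ y, ‖b y‖ ≤ C) ∧
      (∀ y, ‖b' y‖ ≤ C) ∧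
      ∀ (μ : Measure ℂ) [SFinite μ] (G : ℂ → ℂ) (p : ℂ → ℝ) (φ : ℝ → ℂ) (B : ℝ),
        Integrable G μ → Measurable p → (∀ᵐ ω ∂μ, |p ω| ≤ 1) → Continuous φ →
        (∀ t, φ t = ∫ ω, G ω * wave (p ω * t) ∂μ) → (∀ t, ‖φ t‖ ≤ B) →
        ∀ y, ∃ a a' : Lp ℂ 2 (volume : Measure ℝ), ‖a‖ ≤ C * B ∧ ‖a'‖ ≤ C * B ∧
          ∀ t, φ y - φ t = (y - t) * inner ℂ a (b t) ∧ φ y - φ t = (y - t) * inner ℂ (b' t) a' := by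
  obtain ⟨ψ, hψ⟩ := exists_schwartz_fourier_eq_one
  obtain ⟨L, hL0, hL⟩ := ψ.exists_bernstein
  have hψ2 : ∀ y, MemLp (fun t => ψ (y - t)) 2 := fun y =>
    (ψ.memLp 2).comp_measurePreserving (Measure.measurePreserving_sub_left volume y)
  have hψ2' : ∀ y, MemLp (fun t => star (ψ (y - t))) 2 := fun y => (hψ2 y).star
  set P := ∫ t, ‖ψ t‖ ^ 2
  have hP0 : 0 ≤ P := integral_nonneg fun t => by positivity
  set C := 1 + P + Real.sqrt (Real.pi * (2 * L ^ 2 + 8)) with hC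
  have hC0 : 0 < C := by positivity
  have hPC : P ≤ C ^ 2 := by
    have : 1 + P ≤ C := le_add_of_nonneg_right (Real.sqrt_nonneg _)
    nlinarith
  have hLC : Real.pi * (2 * L ^ 2 + 8) ≤ C ^ 2 := by
    rw [← Real.sq_sqrt (show 0 ≤ Real.pi * (2 * L ^ 2 + 8) by positivity)]
    gcongr
    linarith
  have hψn : ∀ y, ∫ t, ‖ψ (y - t)‖ ^ 2 = P := fun y =>
    integral_sub_left_eq_self (fun t => ‖ψ t‖ ^ 2) volume y
  refine ⟨C, fun y => (hψ2 y).toLp _, fun y => (hψ2' y).toLp _, hC0, ?_, ?_, ?_⟩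
  · intro y
    refine le_of_sq_le_sq ?_ hC0.le
    rw [norm_toLp_sq, hψn]
    exact hPC
  · intro y
    refine le_of_sq_le_sq ?_ hC0.le
    rw [norm_toLp_sq]
    simp only [norm_star]
    rw [hψn]
    exact hPC
  intro μ _ G p φ B hG hp hp1 hφc hφ hB y
  have hB0 : 0 ≤ B := (norm_nonneg _).trans (hB 0)
  obtain ⟨g, hg, hgψ⟩ := exists_dividedDifference_reproducing hψ hG hp hp1 hφ y
  have hlip := hL φ B hφc hB (fun a => by
    simp only [hφ]; exact integral_mul_schwartz_eq hψ hG hp hp1 a)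
  have hne : ∀ᵐ t : ℝ, t ≠ y := by simp [ae_iff]
  have hgbd : ∀ t, t ≠ y → ‖g t‖ ^ 2 ≤ B ^ 2 * (2 * L ^ 2 + 8) * (1 + (y - t) ^ 2)⁻¹ := by
    intro t ht
    have hpos : 0 < |y - t| := abs_pos.2 (sub_ne_zero.2 ht.symm)
    have h1 : ‖φ y - φ t‖ = |y - t| * ‖g t‖ := by
      rw [hg, norm_mul, ← Complex.ofReal_sub, Complex.norm_real, Real.norm_eq_abs]
    have hsq : |y - t| ^ 2 = (y - t) ^ 2 := sq_abs _
    rw [← div_eq_mul_inv, le_div_iff₀ (by positivity)]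
    rcases le_or_gt |y - t| 1 with h | h
    · have h2 : |y - t| * ‖g t‖ ≤ |y - t| * (L * B) := by
        rw [← h1]; linarith [hlip y t h]
      have h3 : ‖g t‖ ≤ L * B := le_of_mul_le_mul_left h2 hpos
      have h4 : 1 + (y - t) ^ 2 ≤ 2 := by nlinarith
      calc _ ≤ (L * B) ^ 2 * 2 := by gcongr
        _ ≤ _ := by nlinarith [sq_nonneg B]
    · have h2 : |y - t| * ‖g t‖ ≤ 2 * B := by
        rw [← h1]; linarith [norm_sub_le (φ y) (φ t), hB y, hB t]
      have h3 : ‖g t‖ ^ 2 * (y - t) ^ 2 ≤ 4 * B ^ 2 := by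
        rw [← hsq, ← mul_pow, mul_comm]
        calc _ ≤ (2 * B) ^ 2 := by gcongr
          _ = _ := by ring
      have h4 : 1 ≤ (y - t) ^ 2 := by nlinarith
      nlinarith [sq_nonneg ‖g t‖, mul_nonneg (sq_nonneg B) (sq_nonneg L)]
  have hgm : AEStronglyMeasurable g volume := by
    have h1 : Measurable fun t : ℝ => (φ y - φ t) / ((y : ℂ) - t) := by
      have := hφc.measurable
      fun_prop
    refine h1.aestronglyMeasurable.congr ?_
    filter_upwards [hne] with t ht
    rw [hg, mul_div_cancel_left₀]
    rw [← Complex.ofReal_sub, Complex.ofReal_ne_zero]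
    exact sub_ne_zero.2 ht.symm
  have hbint : Integrable fun t : ℝ => B ^ 2 * (2 * L ^ 2 + 8) * (1 + (y - t) ^ 2)⁻¹ :=
    (integrable_inv_one_add_sq.comp_sub_left y).const_mul _
  have hgint : Integrable fun t => ‖g t‖ ^ 2 := by
    refine hbint.mono' (hgm.norm.pow 2) ?_
    filter_upwards [hne] with t ht
    rw [Real.norm_of_nonneg (by positivity)]
    exact hgbd t ht
  have hg2 : MemLp g 2 := (memLp_two_iff_integrable_sq_norm hgm).2 hgint
  have hgI : ∫ t, ‖g t‖ ^ 2 ≤ (C * B) ^ 2 := by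
    calc _ ≤ ∫ t : ℝ, B ^ 2 * (2 * L ^ 2 + 8) * (1 + (y - t) ^ 2)⁻¹ := by
          refine integral_mono_ae hgint hbint ?_
          filter_upwards [hne] with t ht using hgbd t ht
      _ = B ^ 2 * (Real.pi * (2 * L ^ 2 + 8)) := by
          rw [integral_const_mul,
            integral_sub_left_eq_self (fun t : ℝ => (1 + t ^ 2)⁻¹) volume y,
            integral_univ_inv_one_add_sq]
          ring
      _ ≤ B ^ 2 * C ^ 2 := by gcongr
      _ = _ := by ring
  refine ⟨hg2.star.toLp _, hg2.toLp _, ?_, ?_, fun t => ⟨?_, ?_⟩⟩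
  · refine le_of_sq_le_sq ?_ (by positivity)
    rw [norm_toLp_sq]
    simpa using hgI
  · refine le_of_sq_le_sq ?_ (by positivity)
    rw [norm_toLp_sq]
    exact hgI
  · rw [inner_toLp_eq]
    simp only [Pi.star_apply, star_star]
    rw [hgψ, hg]
  · rw [inner_toLp_eq]
    simp only [star_star, mul_comm (ψ _)]
    rw [hgψ, hg]

end Bernstein

section Plane

lemma fourier_complex_eq (g : ℂ → ℂ) (ξ : ℂ) :
    𝓕 g ξ = ∫ z : ℂ, wave (-(ξ.re * z.re + ξ.im * z.im)) * g z := by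
  rw [Real.fourier_eq']
  congr 1
  ext z
  rw [wave, smul_eq_mul, Complex.inner]
  congr 4
  simp only [Complex.mul_re, Complex.conj_re, Complex.conj_im]
  ring

lemma fourierInv_complex_eq (g : ℂ → ℂ) (z : ℂ) :
    𝓕⁻ g z = ∫ ξ : ℂ, wave (ξ.re * z.re + ξ.im * z.im) * g ξ := by
  rw [Real.fourierInv_eq']
  congr 1
  ext ξ
  rw [wave, smul_eq_mul, Complex.inner]
  congr 4
  simp only [Complex.mul_re, Complex.conj_re, Complex.conj_im]
  ring

lemma norm_wave_sub_one_le (x : ℝ) : ‖wave x - 1‖ ≤ 2 * Real.pi * |x| := by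
  have := Real.norm_exp_I_mul_ofReal_sub_one_le (x := 2 * Real.pi * x)
  rw [mul_comm] at this
  rwa [Real.norm_eq_abs, abs_mul, abs_of_pos Real.two_pi_pos] at this

/-- Multiplication by a cutoff `h` close to `1` on a given disc regularises a function with
compactly supported spectrum into the Fourier transform of an integrable function. -/
lemma FourierSupportedIn.exists_regularization {f : ℂ → ℂ} {B σ : ℝ} (hf : Continuous f)
    (hB : ∀ z, ‖f z‖ ≤ B) (hσ : 0 < σ) (hfσ : FourierSupportedIn f σ) (r : ℝ) {η : ℝ}
    (hη : 0 < η) :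
    ∃ h F : ℂ → ℂ, Continuous h ∧ (∀ z, ‖h z‖ ≤ 1) ∧ (∀ z, ‖z‖ ≤ r → ‖h z - 1‖ ≤ η) ∧
      IntegrableOn F (Metric.closedBall 0 (2 * σ)) ∧
      ∀ z, f z * h z =
        ∫ ξ in Metric.closedBall 0 (2 * σ), F ξ * wave (ξ.re * z.re + ξ.im * z.im) := by
  obtain ⟨ε, hε, hεσ, hεη⟩ : ∃ ε > 0, ε ≤ σ ∧ 4 * Real.pi * (ε * |r|) ≤ η := by
    refine ⟨min σ (η / (4 * Real.pi * (|r| + 1))), by positivity, min_le_left _ _, ?_⟩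
    calc _ ≤ 4 * Real.pi * (η / (4 * Real.pi * (|r| + 1)) * |r|) := by
          gcongr; exact min_le_right _ _
      _ = η * (|r| / (|r| + 1)) := by field_simp
      _ ≤ η * 1 := by
        gcongr
        rw [div_le_one (by positivity)]; linarith
      _ = η := mul_one _
  let b : ContDiffBump (0 : ℂ) := ⟨ε / 2, ε, by positivity, by linarith⟩
  set κ : ℂ → ℂ := fun z => (b.normed volume z : ℂ) with hκ
  have hκs : HasCompactSupport κ := b.hasCompactSupport_normed.comp_left (g := Complex.ofReal) rfl
  have hκd : ContDiff ℝ (⊤ : ℕ∞) κ := Complex.ofRealCLM.contDiff.comp b.contDiff_normed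
  have hκt : tsupport κ ⊆ Metric.closedBall 0 ε := by
    refine (tsupport_comp_subset (g := Complex.ofReal) rfl _).trans ?_
    rw [b.tsupport_normed_eq]
  have hκi : Integrable κ := b.integrable_normed.ofReal
  have hκ1 : ∫ z, κ z = 1 := by
    rw [hκ, integral_complex_ofReal, b.integral_normed, Complex.ofReal_one]
  have hκn : ∫ z, ‖κ z‖ = 1 := by
    rw [← b.integral_normed (μ := volume)]
    congr 1
    ext z
    rw [hκ, Complex.norm_real, Real.norm_of_nonneg (b.nonneg_normed z)]
  set K : SchwartzMap ℂ ℂ := hκs.toSchwartzMap hκd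
  set h : SchwartzMap ℂ ℂ := 𝓕 K with hh
  have hh' : ∀ z, h z = ∫ ξ : ℂ, wave (-(z.re * ξ.re + z.im * ξ.im)) * κ ξ := fun z => by
    rw [hh, SchwartzMap.fourier_coe, fourier_complex_eq]
    rfl
  have hwc : ∀ z : ℂ, Continuous fun ξ : ℂ => wave (-(z.re * ξ.re + z.im * ξ.im)) := fun z => by
    fun_prop
  have hwi : ∀ z : ℂ, Integrable fun ξ : ℂ => wave (-(z.re * ξ.re + z.im * ξ.im)) * κ ξ :=
    fun z => hκi.bdd_mul (hwc z).aestronglyMeasurable (ae_of_all _ fun ξ => (norm_wave _).le)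
  have hfh : Integrable fun z => f z * h z :=
    h.integrable.bdd_mul hf.aestronglyMeasurable (ae_of_all _ hB)
  set F := 𝓕 fun z => f z * h z with hF
  have hFc : Continuous F :=
    VectorFourier.fourierIntegral_continuous Real.continuous_fourierChar
      (by exact continuous_inner) hfh
  have hF0 : ∀ ξ, ξ ∉ Metric.closedBall (0 : ℂ) (2 * σ) → F ξ = 0 := by
    intro ξ hξ
    rw [mem_closedBall_zero_iff, not_le] at hξ
    have hs' : HasCompactSupport fun v => κ (v - ξ) :=
      hκs.comp_homeomorph (Homeomorph.subRight ξ)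
    set K' : SchwartzMap ℂ ℂ := hs'.toSchwartzMap (hκd.comp (contDiff_id.sub contDiff_const))
    have hsub : tsupport (K' : ℂ → ℂ) ⊆ Metric.closedBall ξ ε := by
      refine closure_minimal (fun v hv => ?_) Metric.isClosed_closedBall
      have h1 : v - ξ ∈ tsupport κ := subset_tsupport _ hv
      have h2 := hκt h1
      rwa [mem_closedBall_zero_iff, ← dist_eq_norm] at h2
    have hd := hfσ K' (Set.disjoint_of_subset_left hsub
      (Metric.closedBall_disjoint_closedBall (by rw [dist_zero_right]; linarith)))
    rw [hF, fourier_complex_eq, ← hd]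
    congr 1
    ext z
    rw [fourier_complex_eq]
    have h3 : ∀ v : ℂ, wave (-(z.re * v.re + z.im * v.im)) * K' v =
        wave (-(ξ.re * z.re + ξ.im * z.im)) *
          (wave (-(z.re * (v - ξ).re + z.im * (v - ξ).im)) * κ (v - ξ)) := by
      intro v
      rw [← mul_assoc, ← wave_add]
      congr 2
      simp only [Complex.sub_re, Complex.sub_im]
      ring
    simp only [h3]
    rw [integral_const_mul, integral_sub_right_eq_self
      (fun v : ℂ => wave (-(z.re * v.re + z.im * v.im)) * κ v) ξ, ← hh']
    ring
  have hFi : IntegrableOn F (Metric.closedBall 0 (2 * σ)) :=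
    hFc.continuousOn.integrableOn_compact (isCompact_closedBall _ _)
  have hFint : Integrable F := by
    rwa [← integrableOn_iff_integrable_of_support_subset (s := Metric.closedBall 0 (2 * σ))]
    intro ξ hξ
    by_contra hc
    exact hξ (hF0 ξ hc)
  refine ⟨h, F, h.continuous, fun z => ?_, fun z hz => ?_, hFi, fun z => ?_⟩
  · rw [hh', ← hκn]
    refine (norm_integral_le_integral_norm _).trans (le_of_eq ?_)
    simp only [norm_mul, norm_wave, one_mul]
  · rw [hh', ← hκ1, ← integral_sub (hwi z) hκi]
    refine (norm_integral_le_of_norm_le (hκi.norm.const_mul η) (ae_of_all _ fun ξ => ?_)).trans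
      (le_of_eq (by rw [integral_const_mul, hκn, mul_one]))
    rw [← sub_one_mul, norm_mul]
    by_cases hξ : κ ξ = 0
    · simp [hξ]
    gcongr
    refine (norm_wave_sub_one_le _).trans (le_trans ?_ hεη)
    have h1 : ‖ξ‖ ≤ ε := by
      have := hκt (subset_tsupport κ hξ)
      rwa [mem_closedBall_zero_iff] at this
    have h2 : ‖z‖ ≤ |r| := hz.trans (le_abs_self r)
    have h3 : |z.re * ξ.re + z.im * ξ.im| ≤ 2 * (ε * |r|) := by
      refine (abs_add_le _ _).trans ?_
      rw [abs_mul, abs_mul]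
      have h4 : |z.re| * |ξ.re| ≤ |r| * ε :=
        mul_le_mul ((Complex.abs_re_le_norm z).trans h2) ((Complex.abs_re_le_norm ξ).trans h1)
          (abs_nonneg _) (abs_nonneg _)
      have h5 : |z.im| * |ξ.im| ≤ |r| * ε :=
        mul_le_mul ((Complex.abs_im_le_norm z).trans h2) ((Complex.abs_im_le_norm ξ).trans h1)
          (abs_nonneg _) (abs_nonneg _)
      linarith
    rw [abs_neg]
    calc _ ≤ 2 * Real.pi * (2 * (ε * |r|)) := by gcongr
      _ = _ := by ring
  · have hcont : Continuous fun z => f z * h z := hf.mul h.continuous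
    have h1 : 𝓕⁻ F z = f z * h z := by
      rw [hF, hcont.fourierInv_fourier_eq hfh hFint]
    rw [← h1, fourierInv_complex_eq, setIntegral_eq_integral_of_forall_compl_eq_zero
      (fun ξ hξ => by rw [hF0 ξ hξ, zero_mul])]
    simp only [mul_comm]

end Plane

section BandLimited

variable {H : Type*} [NormedAddCommGroup H] [InnerProductSpace ℂ H] [CompleteSpace H]

lemma dualTraceBound_cfc_sub_of_approx {f : ℂ → ℂ} {N₁ N₂ : H →L[ℂ] H} {c : ℝ}
    (hf₁ : ContinuousOn f (spectrum ℂ N₁)) (hf₂ : ContinuousOn f (spectrum ℂ N₂))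
    (h : ∀ ε > 0, ∃ g : ℂ → ℂ, Continuous g ∧
      (∀ z ∈ spectrum ℂ N₁ ∪ spectrum ℂ N₂, ‖f z - g z‖ ≤ ε) ∧
      DualTraceBound (cfc g N₁ - cfc g N₂) c) :
    DualTraceBound (cfc f N₁ - cfc f N₂) c := by
  refine DualTraceBound.of_approx fun ε hε => ?_
  obtain ⟨g, hg, hfg, hgc⟩ := h (ε / 2) (half_pos hε)
  refine ⟨_, ?_, hgc.mono (le_add_of_nonneg_right hε.le)⟩
  have h1 : ‖cfc f N₁ - cfc g N₁‖ ≤ ε / 2 := by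
    rw [← cfc_sub f g N₁ hf₁ hg.continuousOn]
    exact norm_cfc_le (half_pos hε).le fun z hz => hfg z (.inl hz)
  have h2 : ‖cfc f N₂ - cfc g N₂‖ ≤ ε / 2 := by
    rw [← cfc_sub f g N₂ hf₂ hg.continuousOn]
    exact norm_cfc_le (half_pos hε).le fun z hz => hfg z (.inr hz)
  calc _ = ‖(cfc f N₁ - cfc g N₁) - (cfc f N₂ - cfc g N₂)‖ := by congr 1; abel
    _ ≤ ε / 2 + ε / 2 := (norm_sub_le _ _).trans (add_le_add h1 h2)
    _ = ε := add_halves ε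

/-- The trace-norm estimate for Fourier transforms of integrable functions on a disc. -/
lemma exists_dualTraceBound_cfc_sub_of_fourier_integral :
    ∃ C : ℝ, 0 < C ∧ ∀ {H : Type*} [NormedAddCommGroup H] [InnerProductSpace ℂ H]
      [CompleteSpace H] {N₁ N₂ : H →L[ℂ] H} [IsStarNormal N₁] [IsStarNormal N₂] {c : ℝ}
      (_ : NuclearBound (N₁ - N₂) c) {g F : ℂ → ℂ} {B R : ℝ} (_ : Continuous g) (_ : 0 < R)
      (_ : ∀ z, ‖g z‖ ≤ B) (_ : IntegrableOn F (Metric.closedBall 0 R))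
      (_ : ∀ z, g z =
        ∫ ξ in Metric.closedBall 0 R, F ξ * wave (ξ.re * z.re + ξ.im * z.im)),
      DualTraceBound (cfc g N₁ - cfc g N₂) (C * R * B * c) := by
  obtain ⟨C, b, b', hC, hb, hb', hfac⟩ := exists_dividedDifference_factorization
  refine ⟨2 * C ^ 2, by positivity, ?_⟩
  intro H _ _ _ N₁ N₂ _ _ c hK g F B R hg hR hgB hF hgF
  have hB : 0 ≤ B := (norm_nonneg _).trans (hgB 0)
  have hRC : (R : ℂ) ≠ 0 := by exact_mod_cast hR.ne'
  have hball : ∀ᵐ ξ ∂volume.restrict (Metric.closedBall (0 : ℂ) R), ‖ξ‖ ≤ R := by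
    filter_upwards [ae_restrict_mem Metric.isClosed_closedBall.measurableSet] with ξ hξ
    rwa [mem_closedBall_zero_iff] at hξ
  have hwave : ∀ p : ℂ → ℝ, Measurable p → Integrable (fun ξ => F ξ * wave (p ξ))
      (volume.restrict (Metric.closedBall (0 : ℂ) R)) := fun p hp =>
    hF.mul_bdd (c := 1) (by fun_prop) (ae_of_all _ fun ξ => (norm_wave _).le)
  have him : ∀ x y : ℝ, ∃ a : Lp ℂ 2 (volume : Measure ℝ), ‖a‖ ≤ C * B ∧ ∀ t : ℝ,
      g ⟨x, y / R⟩ - g ⟨x, t / R⟩ = (y - t) * inner ℂ a (b t) := by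
    intro x y
    obtain ⟨a, a', ha, -, h⟩ := hfac (volume.restrict (Metric.closedBall (0 : ℂ) R))
      (fun ξ => F ξ * wave (ξ.re * x)) (fun ξ => ξ.im / R) (fun t => g ⟨x, t / R⟩) B
      (hwave _ (by fun_prop)) (by fun_prop)
      (by
        filter_upwards [hball] with ξ hξ
        rw [abs_div, abs_of_pos hR]
        exact div_le_one_of_le₀ ((Complex.abs_im_le_norm ξ).trans hξ) hR.le)
      (hg.comp (by
        simp only [Complex.mk_eq_add_mul_I]
        fun_prop))
      (fun t => by
        rw [hgF]
        refine integral_congr_ae (ae_of_all _ fun ξ => ?_)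
        dsimp only
        rw [wave_add, mul_assoc]
        congr 3
        ring)
      (fun t => hgB _) y
    exact ⟨a, ha, fun t => (h t).1⟩
  have hre : ∀ x y : ℝ, ∃ a : Lp ℂ 2 (volume : Measure ℝ), ‖a‖ ≤ C * B ∧ ∀ t : ℝ,
      g ⟨x / R, y⟩ - g ⟨t / R, y⟩ = (x - t) * inner ℂ (b' t) a := by
    intro x y
    obtain ⟨a, a', -, ha, h⟩ := hfac (volume.restrict (Metric.closedBall (0 : ℂ) R))
      (fun ξ => F ξ * wave (ξ.im * y)) (fun ξ => ξ.re / R) (fun t => g ⟨t / R, y⟩) B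
      (hwave _ (by fun_prop)) (by fun_prop)
      (by
        filter_upwards [hball] with ξ hξ
        rw [abs_div, abs_of_pos hR]
        exact div_le_one_of_le₀ ((Complex.abs_re_le_norm ξ).trans hξ) hR.le)
      (hg.comp (by
        simp only [Complex.mk_eq_add_mul_I]
        fun_prop))
      (fun t => by
        rw [hgF]
        refine integral_congr_ae (ae_of_all _ fun ξ => ?_)
        dsimp only
        rw [add_comm, wave_add, mul_assoc]
        congr 3
        ring)
      (fun t => hgB _) x
    exact ⟨a', ha, fun t => (h t).2⟩
  choose a ha hia using him
  choose a' ha' hia' using hre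
  have hnR : ‖(R : ℂ)‖ = R := by rw [Complex.norm_real, Real.norm_of_nonneg hR.le]
  have key := dualTraceBound_cfc_sub hg
    (α := fun z => (R : ℂ) • a z.re (R * z.im)) (β := fun w => b (R * w.im))
    (γ := fun z => (R : ℂ) • b' (R * z.re)) (ζ := fun w => a' (R * w.re) w.im)
    (A := R * (C * B)) (B := C) (A' := R * C) (B' := C * B)
    (fun z => by rw [norm_smul, hnR]; gcongr; exact ha _ _)
    (fun w => hb _)
    (fun z => by rw [norm_smul, hnR]; gcongr; exact hb' _)
    (fun w => ha' _ _)
    (fun z w => by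
      have h1 := hia z.re (R * z.im) (R * w.im)
      have h2 := hia' (R * w.re) w.im (R * z.re)
      rw [mul_div_cancel_left₀ _ hR.ne', mul_div_cancel_left₀ _ hR.ne'] at h1 h2
      push_cast at h1 h2
      simp only [Complex.eta] at h1 h2
      rw [inner_smul_left, inner_smul_left, Complex.conj_ofReal]
      linear_combination h1 - h2)
    hK
  refine key.mono (le_of_eq ?_)
  ring

/-- Operator Lipschitz-type Bernstein inequality in trace norm for band-limited functions. -/
lemma exists_dualTraceBound_cfc_sub_of_fourierSupportedIn :
    ∃ C : ℝ, 0 < C ∧ ∀ {H : Type*} [NormedAddCommGroup H] [InnerProductSpace ℂ H]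
      [CompleteSpace H] {N₁ N₂ : H →L[ℂ] H} [IsStarNormal N₁] [IsStarNormal N₂] {c : ℝ}
      (_ : NuclearBound (N₁ - N₂) c) {f : ℂ → ℂ} {B σ : ℝ} (_ : Continuous f) (_ : 0 < σ)
      (_ : ∀ z, ‖f z‖ ≤ B) (_ : FourierSupportedIn f σ),
      DualTraceBound (cfc f N₁ - cfc f N₂) (C * σ * B * c) := by
  obtain ⟨C, hC, hbound⟩ := exists_dualTraceBound_cfc_sub_of_fourier_integral
  refine ⟨2 * C, by positivity, ?_⟩
  intro H _ _ _ N₁ N₂ _ _ c hK f B σ hf hσ hB hfσ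
  have hB0 : 0 ≤ B := (norm_nonneg _).trans (hB 0)
  refine dualTraceBound_cfc_sub_of_approx hf.continuousOn hf.continuousOn fun ε hε => ?_
  obtain ⟨r, hr⟩ := ((spectrum.isCompact N₁).union
    (spectrum.isCompact N₂)).isBounded.subset_closedBall (0 : ℂ)
  obtain ⟨h, F, hh, hh1, hhr, hF, hfh⟩ :=
    hfσ.exists_regularization hf hB hσ r (η := ε / (B + 1)) (by positivity)
  refine ⟨fun z => f z * h z, hf.mul hh, fun z hz => ?_, ?_⟩
  · rw [← mul_one_sub, norm_mul, norm_sub_rev]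
    calc _ ≤ (B + 1) * (ε / (B + 1)) := by
          gcongr
          · exact (hB z).trans (by linarith)
          · exact hhr z (mem_closedBall_zero_iff.1 (hr hz))
      _ = ε := by field_simp
  · refine (hbound hK (B := B) (hf.mul hh) (by positivity) (fun z => ?_) hF hfh).mono
      (le_of_eq (by ring))
    rw [Pi.mul_apply, norm_mul]
    exact (mul_le_of_le_one_right (norm_nonneg _) (hh1 z)).trans (hB z)

end BandLimited

/-- Functions of class `B¹_{∞1}(ℝ²)` respect trace class perturbations:
if `N₁ - N₂ ∈ S₁` then `f(N₁) - f(N₂) ∈ S₁` with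
`‖f(N₁) - f(N₂)‖_{S₁} ≤ C M ‖N₁ - N₂‖_{S₁}`. -/
theorem besov_trace_class :
    ∃ C : ℝ, 0 < C ∧
      ∀ (f : ℂ → ℂ) (M : ℝ), HasLPDecompBesov1 f M →
      ∀ (H : Type*) [NormedAddCommGroup H] [InnerProductSpace ℂ H] [CompleteSpace H]
        (N₁ N₂ : H →L[ℂ] H), IsStarNormal N₁ → IsStarNormal N₂ →
        MemTraceClass (N₁ - N₂) →
        MemTraceClass (cfc f N₁ - cfc f N₂) ∧
          ∑' j : ℕ, sNum (cfc f N₁ - cfc f N₂) j ≤ C * M * ∑' j : ℕ, sNum (N₁ - N₂) j := by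
  obtain ⟨C, hC, hbound⟩ := exists_dualTraceBound_cfc_sub_of_fourierSupportedIn
  refine ⟨4 * (2 * C * 14), by positivity, ?_⟩
  rintro f M ⟨F, hF, hlim, hsum, hM⟩ H _ _ _ N₁ N₂ hN₁ hN₂ hK
  set S := ∑' j : ℕ, sNum (N₁ - N₂) j with hS
  have hS0 : 0 ≤ S := tsum_nonneg fun j => sNum_nonneg _ j
  have hnuc := hK.nuclearBound
  rw [← hS] at hnuc
  have hlimK := hlim _ ((spectrum.isCompact N₁).union (spectrum.isCompact N₂))
  have hpc : ∀ N : ℕ, Continuous fun z => ∑ n ∈ Finset.Icc (-(N : ℤ)) (N : ℤ), F n z :=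
    fun N => continuous_finsetSum _ fun n _ => (F n).continuous
  have hfc := hlimK.continuousOn (Frequently.of_forall fun N => (hpc N).continuousOn)
  have hpart : ∀ N : ℕ, DualTraceBound
      (cfc (fun z => ∑ n ∈ Finset.Icc (-(N : ℤ)) (N : ℤ), F n z) N₁ -
        cfc (fun z => ∑ n ∈ Finset.Icc (-(N : ℤ)) (N : ℤ), F n z) N₂)
      (2 * C * M * (14 * S)) := by
    intro N
    have h1 : (fun z => ∑ n ∈ Finset.Icc (-(N : ℤ)) (N : ℤ), F n z) =
        ∑ n ∈ Finset.Icc (-(N : ℤ)) (N : ℤ), ⇑(F n) := by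
      ext z
      rw [Finset.sum_apply]
    rw [h1, cfc_sum _ _ _ fun n _ => (F n).continuous.continuousOn,
      cfc_sum _ _ _ fun n _ => (F n).continuous.continuousOn, ← Finset.sum_sub_distrib]
    refine (DualTraceBound.sum _ fun n _ => hbound hnuc (F n).continuous
      (by positivity : (0 : ℝ) < 2 ^ (n + 1)) (F n).norm_coe_le_norm (hF n)).mono ?_
    have h2 : ∀ n : ℤ, C * 2 ^ (n + 1) * ‖F n‖ * (14 * S) =
        2 * C * (14 * S) * (2 ^ n * ‖F n‖) := fun n => by
      rw [zpow_add_one₀ two_ne_zero]; ring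
    simp only [h2]
    rw [← Finset.mul_sum, mul_right_comm (2 * C) M]
    gcongr
    exact (hsum.sum_le_tsum _ fun n _ => by positivity).trans hM
  have hdual : DualTraceBound (cfc f N₁ - cfc f N₂) (2 * C * M * (14 * S)) := by
    refine dualTraceBound_cfc_sub_of_approx (hfc.mono Set.subset_union_left)
      (hfc.mono Set.subset_union_right) fun ε hε => ?_
    obtain ⟨N, hN⟩ := (Metric.tendstoUniformlyOn_iff.1 hlimK ε hε).exists
    exact ⟨_, hpc N, fun z hz => (dist_eq_norm (f z) _) ▸ (hN z hz).le, hpart N⟩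
  refine ⟨hdual.memTraceClass.1, hdual.memTraceClass.2.trans (le_of_eq ?_)⟩
  ring
end
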